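/- Let (x_*,u_*) be a local minimum of radius R(·) for problem (P'_DAE) with dynamics Eẋ(t)=g(x(t),u(t)), where the m×n_x matrix E is not of full row rank and g is strictly differentiable. Suppose that for all (t,x,u,v)∈C_φ^{ε,R} the WBCQ holds and M_φ is calm at (0,x,u,v) (for instance, one of the sufficient conditions — linear CQ, quasinormality, FOSCMS, SOSCMS, or RCPLD — holds). Suppose further that C_φ^{ε,R} is compact and there exists δ>0 with R(t)≥δ. Then there exist an arc p, λ₀∈{0,1}, and measurable functions λ_φ:[t₀,t₁]→ℝ^m, μ:[t₀,t₁]→ℝ^{n_u} with μ(t)∈N^C_U(u_*(t)) a.e., satisfying the nontriviality condition (λ₀,p(t))≠0 for all t, the transversality condition (p(t₀),−p(t₁))∈λ₀∂f(x_*(t₀),x_*(t₁))+N_S(x_*(t₀),x_*(t₁)), the Weierstrass condition (for a.e. t: u∈U, Ev=g(x_*(t),u), |(u,v)−(u_*(t),ẋ_*(t))|<R(t) imply ⟨p(t),v−ẋ_*(t)⟩≤0), and the Euler adjoint equations for a.e. t: ṗ(t)=−∇_x g(x_*(t),u_*(t))^Tλ_φ(t), μ(t)=∇_u g(x_*(t),u_*(t))^Tλ_φ(t),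 and p(t)=E^Tλ_φ(t). If N^C_U(u_*(t))={0}, then |λ_φ(t)|≤k|p(t)| a.e. for some positive constant k. In the free end point case λ₀ can be taken as 1. -/

import Mathlib

open Filter Topology Set MeasureTheory
open scoped RealInnerProductSpace ENNReal NNReal

noncomputable section

abbrev Euc (n : ℕ) : Type := EuclideanSpace ℝ (Fin n)

abbrev PL2 (α β : Type) : Type := WithLp 2 (α × β)

abbrev PL3 (α β γ : Type) : Type := PL2 α (PL2 β γ)

def pl2 {α β : Type} (a : α) (b : β) : PL2 α β := (WithLp.equiv 2 (α × β)).symm (a, b)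

def pl2fst {α β : Type} (z : PL2 α β) : α := (WithLp.equiv 2 (α × β) z).1

def pl2snd {α β : Type} (z : PL2 α β) : β := (WithLp.equiv 2 (α × β) z).2

def pl3 {α β γ : Type} (a : α) (b : β) (c : γ) : PL3 α β γ := pl2 a (pl2 b c)

section Variational

variable {E : Type} [NormedAddCommGroup E] [InnerProductSpace ℝ E]

/-- Fréchet normal cone. -/
def frechetNC (C : Set E) (x : E) : Set E :=
  {v | ∀ ε > 0, ∃ δ > 0, ∀ y ∈ C, ‖y - x‖ < δ → ⟪v, y - x⟫ ≤ ε * ‖y - x‖}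

/-- Limiting (Mordukhovich) normal cone. -/
def limitingNC (C : Set E) (x : E) : Set E :=
  {v | ∃ xs vs : ℕ → E, (∀ n, xs n ∈ C ∧ vs n ∈ frechetNC C (xs n)) ∧
      Tendsto xs atTop (𝓝 x) ∧ Tendsto vs atTop (𝓝 v)}

/-- Clarke normal cone: closed convex hull of the limiting normal cone. -/
def clarkeNC (C : Set E) (x : E) : Set E := closure (convexHull ℝ (limitingNC C x))

def NormallyRegular (C : Set E) : Prop := ∀ x ∈ C, frechetNC C x = limitingNC C x

/-- Proximal subdifferential of a real-valued function. -/
def proxSubdiff (g : E → ℝ) (x : E) : Set E :=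
  {ζ | ∃ σ > 0, ∃ δ > 0, ∀ y, ‖y - x‖ < δ →
    g x + ⟪ζ, y - x⟫ - σ * ‖y - x‖ ^ 2 ≤ g y}

/-- Limiting (Mordukhovich) subdifferential. -/
def limSubdiff (g : E → ℝ) (x : E) : Set E :=
  {ζ | ∃ xs ζs : ℕ → E, (∀ n, ζs n ∈ proxSubdiff g (xs n)) ∧
      Tendsto xs atTop (𝓝 x) ∧ Tendsto (fun n => g (xs n)) atTop (𝓝 (g x)) ∧
      Tendsto ζs atTop (𝓝 ζ)}

/-- Clarke generalized gradient: convex hull of the limiting subdifferential. -/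
def clarkeSubdiff (g : E → ℝ) (x : E) : Set E := convexHull ℝ (limSubdiff g x)

/-- Tangent (contingent) cone. -/
def tangentC (C : Set E) (x : E) : Set E :=
  {w | ∃ (t : ℕ → ℝ) (ws : ℕ → E), (∀ n, 0 < t n ∧ x + t n • ws n ∈ C) ∧
      Tendsto t atTop (𝓝 0) ∧ Tendsto ws atTop (𝓝 w)}

/-- Directional limiting normal cone in direction `w`. -/
def dirLimitingNC (C : Set E) (x : E) (w : E) : Set E :=
  {v | ∃ (t : ℕ → ℝ) (ws vs : ℕ → E),
      (∀ n, 0 < t n ∧ vs n ∈ frechetNC C (x + t n • ws n)) ∧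
      Tendsto t atTop (𝓝 0) ∧ Tendsto ws atTop (𝓝 w) ∧ Tendsto vs atTop (𝓝 v)}

end Variational

section Maps

variable {F G : Type} [NormedAddCommGroup F] [NormedAddCommGroup G]

/-- Calmness of a set-valued map at a point of its graph (neighborhood-ball form). -/
def Calm (Ψ : F → Set G) (x₀ : F) (y₀ : G) : Prop :=
  ∃ μ : ℝ, 0 ≤ μ ∧ ∃ Ux ∈ 𝓝 x₀, ∃ Vy ∈ 𝓝 y₀,
    ∀ x ∈ Ux, ∀ y ∈ Ψ x ∩ Vy, ∃ z ∈ Ψ x₀, ‖y - z‖ ≤ μ * ‖x - x₀‖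

/-- Upper Lipschitz continuity at a point. -/
def UpperLipschitzAt (Ψ : F → Set G) (x₀ : F) : Prop :=
  ∃ μ : ℝ, 0 ≤ μ ∧ ∃ Ux ∈ 𝓝 x₀,
    ∀ x ∈ Ux, ∀ y ∈ Ψ x, ∃ z ∈ Ψ x₀, ‖y - z‖ ≤ μ * ‖x - x₀‖

end Maps

/-- An absolutely continuous arc on `[t0,t1]` with values in `ℝ^n`,
recorded together with its a.e. derivative. -/
structure Arc (n : ℕ) (t0 t1 : ℝ) where
  f : ℝ → Euc n
  d : ℝ → Euc n
  intble : IntervalIntegrable d volume t0 t1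
  rel : ∀ t ∈ Set.Icc t0 t1, f t = f t0 + ∫ s in t0..t, d s


namespace ProblemPDAE

variable {nx nu m : ℕ} {t0 t1 : ℝ}

/-- Matrix–vector multiplication on Euclidean spaces. -/
def mV (A : Matrix (Fin m) (Fin nx) ℝ) (x : Euc nx) : Euc m :=
  (EuclideanSpace.equiv (Fin m) ℝ).symm (A.mulVec (EuclideanSpace.equiv (Fin nx) ℝ x))

/-- Admissible pairs of problem (P'_DAE): `E ẋ(t) = g(x(t),u(t))` a.e.,
`u(t) ∈ U` a.e., `(x(t₀),x(t₁)) ∈ S`. -/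
def Admissible (E : Matrix (Fin m) (Fin nx) ℝ) (g : PL2 (Euc nx) (Euc nu) → Euc m)
    (Uset : Set (Euc nu)) (S : Set (PL2 (Euc nx) (Euc nx)))
    (x : Arc nx t0 t1) (u : ℝ → Euc nu) : Prop :=
  Measurable u ∧
  (∀ᵐ t ∂(volume.restrict (Set.Icc t0 t1)),
    mV E (x.d t) = g (pl2 (x.f t) (u t)) ∧ u t ∈ Uset) ∧
  pl2 (x.f t0) (x.f t1) ∈ S

/-- `(x_*,u_*)` is a local minimum of radius `R(·)` for (P'_DAE). -/
def IsLocalMinOfRadius (E : Matrix (Fin m) (Fin nx) ℝ)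
    (g : PL2 (Euc nx) (Euc nu) → Euc m) (f : PL2 (Euc nx) (Euc nx) → ℝ)
    (Uset : Set (Euc nu)) (S : Set (PL2 (Euc nx) (Euc nx)))
    (ε : ℝ) (R : ℝ → ℝ≥0∞) (xs : Arc nx t0 t1) (us : ℝ → Euc nu) : Prop :=
  Admissible E g Uset S xs us ∧
  ∀ (x : Arc nx t0 t1) (u : ℝ → Euc nu), Admissible E g Uset S x u →
    (∀ᵐ t ∂(volume.restrict (Set.Icc t0 t1)),
      ‖x.f t - xs.f t‖ ≤ ε ∧
      (‖pl2 (u t - us t) (x.d t - xs.d t)‖₊ : ℝ≥0∞) ≤ R t) →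
    (∫ t in t0..t1, ‖x.d t - xs.d t‖) ≤ ε →
    f (pl2 (xs.f t0) (xs.f t1)) ≤ f (pl2 (x.f t0) (x.f t1))

/-- The set `C_φ^{ε,R}` for `φ(x,u,v) = Ev − g(x,u)` and `K_φ = {0}`. -/
def Cset (E : Matrix (Fin m) (Fin nx) ℝ) (g : PL2 (Euc nx) (Euc nu) → Euc m)
    (Uset : Set (Euc nu)) (ε : ℝ) (R : ℝ → ℝ≥0∞)
    (xs : Arc nx t0 t1) (us : ℝ → Euc nu) : Set (ℝ × Euc nx × Euc nu × Euc nx) :=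
  closure {q : ℝ × Euc nx × Euc nu × Euc nx | q.1 ∈ Set.Icc t0 t1 ∧
    q.2.2.1 ∈ Uset ∧ mV E q.2.2.2 = g (pl2 q.2.1 q.2.2.1) ∧
    ‖q.2.1 - xs.f q.1‖ ≤ ε ∧
    (‖pl2 (q.2.2.1 - us q.1) (q.2.2.2 - xs.d q.1)‖₊ : ℝ≥0∞) ≤ R q.1}

/-- The perturbed constraint map `M_φ(Θ) = {(x,u,v) : Ev − g(x,u) + Θ = 0, u ∈ U}`. -/
def Mmap (E : Matrix (Fin m) (Fin nx) ℝ) (g : PL2 (Euc nx) (Euc nu) → Euc m)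
    (Uset : Set (Euc nu)) : Euc m → Set (PL3 (Euc nx) (Euc nu) (Euc nx)) :=
  fun Θ => {z | pl2fst (pl2snd z) ∈ Uset ∧
    mV E (pl2snd (pl2snd z)) - g (pl2 (pl2fst z) (pl2fst (pl2snd z))) + Θ = 0}

end ProblemPDAE

namespace ProblemPDAE

/-- The (smooth) WBCQ at `(x,u,v)` for `φ(x,u,v) = Ev − g(x,u)`:
`[λ_φ ∈ ℝ^m, (α,0,0) ∈ ∇φ(x,u,v)ᵀλ_φ + {0} × N_U(u) × {0}] ⟹ α = 0`. -/
def WBCQ {nx nu m : ℕ} (E : Matrix (Fin m) (Fin nx) ℝ)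
    (g' : PL2 (Euc nx) (Euc nu) → (PL2 (Euc nx) (Euc nu) →L[ℝ] Euc m))
    (Uset : Set (Euc nu)) (x : Euc nx) (u : Euc nu) (v : Euc nx) : Prop :=
  ∀ (lam : Euc m) (α : Euc nx),
    (∃ η ∈ limitingNC Uset u, ∀ (dx : Euc nx) (du : Euc nu) (dv : Euc nx),
      ⟪α, dx⟫ = ⟪lam, mV E dv - g' (pl2 x u) (pl2 dx du)⟫ + ⟪η, du⟫) →
    α = 0

theorem sqrt_le_add_div {a b : ℝ} (ha : 0 ≤ a) (hb : 0 < b) :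
    √a ≤ √b + (a - b) / (2 * √b) := by
  have hs := Real.sqrt_pos.2 hb
  have h1 : a - b = √a ^ 2 - √b ^ 2 := by rw [Real.sq_sqrt ha, Real.sq_sqrt hb.le]
  rw [h1, ← sub_le_iff_le_add', le_div_iff₀ (by positivity)]
  nlinarith [sq_nonneg (√a - √b)]

/-- Ekeland's variational principle on a set that is sequentially complete for a
pseudo-distance `d` along which `F` is continuous. -/
theorem ekeland {Z : Type} (A : Set Z) (d : Z → Z → ℝ) (F : Z → ℝ)
    (hd0 : ∀ z w, 0 ≤ d z w) (hself : ∀ z, d z z = 0)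
    (htri : ∀ x y z, d x z ≤ d x y + d y z) (hF0 : ∀ z ∈ A, 0 ≤ F z)
    (hcomp : ∀ z : ℕ → Z, (∀ n, z n ∈ A) →
      (∀ e > 0, ∃ N, ∀ n ≥ N, ∀ k ≥ n, d (z n) (z k) < e) →
      ∃ l ∈ A, Tendsto (fun n => d (z n) l) atTop (𝓝 0) ∧
        Tendsto (fun n => F (z n)) atTop (𝓝 (F l)))
    {z0 : Z} (hz0 : z0 ∈ A) {α : ℝ} (hα : 0 < α) :
    ∃ w ∈ A, F w + α * d z0 w ≤ F z0 ∧ ∀ z ∈ A, F w ≤ F z + α * d w z := by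
  let Sl : Z → Set Z := fun z => {w | w ∈ A ∧ F w + α * d z w ≤ F z}
  have hbdd : ∀ z, BddBelow (F '' Sl z) := fun z => ⟨0, by
    rintro _ ⟨w, hw, rfl⟩; exact hF0 w hw.1⟩
  have hne : ∀ z ∈ A, z ∈ Sl z := fun z hz => ⟨hz, by simp [hself]⟩
  have hstep : ∀ (n : ℕ) (z : A), ∃ w : A, (w : Z) ∈ Sl z ∧
      ∀ x ∈ Sl z, F w ≤ F x + (1 / 2 : ℝ) ^ n := by
    rintro n ⟨z, hz⟩
    obtain ⟨_, ⟨w, hw, rfl⟩, hlt⟩ := exists_lt_of_csInf_lt (Set.Nonempty.image F ⟨z, hne z hz⟩)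
      (lt_add_of_pos_right (sInf (F '' Sl z)) (by positivity : (0 : ℝ) < (1 / 2) ^ n))
    exact ⟨⟨w, hw.1⟩, hw, fun x hx => by
      linarith [csInf_le (hbdd z) (mem_image_of_mem F hx)]⟩
  choose nx hnx hmin using hstep
  let z : ℕ → A := fun n => Nat.rec ⟨z0, hz0⟩ (fun n w => nx n w) n
  have hz1 : ∀ n, (z (n + 1)).1 ∈ Sl (z n).1 := fun n => hnx n (z n)
  have hz2 : ∀ n, ∀ x ∈ Sl (z n).1, F (z (n + 1)).1 ≤ F x + (1 / 2 : ℝ) ^ n := fun n => hmin n (z n)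
  have htrans : ∀ {a b c}, b ∈ Sl a → c ∈ Sl b → c ∈ Sl a := by
    rintro a b c ⟨_, hb⟩ ⟨hc, hc'⟩
    exact ⟨hc, by nlinarith [htri a b c]⟩
  have hmem : ∀ n k, n ≤ k → (z k).1 ∈ Sl (z n).1 := by
    intro n k hk
    induction k, hk using Nat.le_induction with
    | base => exact hne _ (z n).2
    | succ k _ ih => exact htrans ih (hz1 k)
  have hanti : Antitone fun n => F (z n).1 := antitone_nat_of_succ_le fun n => by
    have := (hz1 n).2; nlinarith [hd0 (z n).1 (z (n + 1)).1]
  have hbd : BddBelow (range fun n => F (z n).1) := ⟨0, by rintro _ ⟨n, rfl⟩; exact hF0 _ (z n).2⟩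
  have hconv := tendsto_atTop_ciInf hanti hbd
  set I := ⨅ n, F (z n).1
  have hI : ∀ n, I ≤ F (z n).1 := fun n => ciInf_le hbd n
  obtain ⟨l, hl, hdl, hFl⟩ := hcomp (fun n => (z n).1) (fun n => (z n).2) (by
    intro e he
    have h1 := (tendsto_order.1 hconv).2 (I + α * e) (by have := mul_pos hα he; linarith)
    obtain ⟨N, hN⟩ := eventually_atTop.1 h1
    refine ⟨N, fun n hn k hk => ?_⟩
    have := (hmem n k hk).2
    have h2 := hN n hn
    have h3 := hI k
    have : α * d (z n).1 (z k).1 < α * e := by linarith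
    exact lt_of_mul_lt_mul_left this hα.le)
  have hlI : F l = I := tendsto_nhds_unique hFl hconv
  have hlS : ∀ n, l ∈ Sl (z n).1 := by
    intro n
    refine ⟨hl, ?_⟩
    have hlim : Tendsto (fun k => F (z n).1 + α * d (z k).1 l - F (z k).1) atTop (𝓝 (F (z n).1 + α * 0 - F l)) :=
      ((tendsto_const_nhds.add (hdl.const_mul α)).sub hFl)
    have : α * d (z n).1 l ≤ F (z n).1 + α * 0 - F l := ge_of_tendsto hlim (by
      filter_upwards [eventually_ge_atTop n] with k hk
      have := (hmem n k hk).2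
      nlinarith [htri (z n).1 (z k).1 l])
    linarith
  refine ⟨l, hl, (hlS 0).2, fun w hw => ?_⟩
  by_contra! hlt
  have hwl : w ∈ Sl l := ⟨hw, hlt.le⟩
  have hge : F l ≤ F w := by
    have hlim : Tendsto (fun n => F w + (1 / 2 : ℝ) ^ n - F (z (n + 1)).1) atTop (𝓝 (F w + 0 - F l)) :=
      (tendsto_const_nhds.add (tendsto_pow_atTop_nhds_zero_of_lt_one (by norm_num) (by norm_num))).sub
        ((tendsto_add_atTop_iff_nat (f := fun n => F (z n).1) 1).2 hFl)
    have : 0 ≤ F w + 0 - F l := ge_of_tendsto' hlim fun n => by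
      linarith [hz2 n w (htrans (hlS n) hwl)]
    linarith
  nlinarith [hd0 l w]

section Normals

variable {E : Type} [NormedAddCommGroup E] [InnerProductSpace ℝ E]

theorem frechetNC_smul {C : Set E} {x v : E} (hv : v ∈ frechetNC C x) {c : ℝ} (hc : 0 < c) :
    c • v ∈ frechetNC C x := by
  intro e he
  obtain ⟨δ, hδ, h⟩ := hv (e / c) (by positivity)
  refine ⟨δ, hδ, fun y hy hyx => ?_⟩
  rw [real_inner_smul_left]
  calc c * ⟪v, y - x⟫ ≤ c * (e / c * ‖y - x‖) := by gcongr; exact h y hy hyx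
    _ = e * ‖y - x‖ := by field_simp

theorem limitingNC_smul {C : Set E} {x v : E} (hv : v ∈ limitingNC C x) {c : ℝ} (hc : 0 < c) :
    c • v ∈ limitingNC C x := by
  obtain ⟨xs, vs, h, hx, hv⟩ := hv
  exact ⟨xs, fun n => c • vs n, fun n => ⟨(h n).1, frechetNC_smul (h n).2 hc⟩, hx, hv.const_smul c⟩

open scoped Pointwise in
theorem clarkeNC_smul {C : Set E} {x v : E} (hv : v ∈ clarkeNC C x) {c : ℝ} (hc : 0 < c) :
    c • v ∈ clarkeNC C x := by
  have h1 : ∀ v ∈ convexHull ℝ (limitingNC C x), c • v ∈ convexHull ℝ (limitingNC C x) := by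
    intro v hv
    have : c • v ∈ c • convexHull ℝ (limitingNC C x) := smul_mem_smul_set hv
    rw [← convexHull_smul] at this
    refine convexHull_mono ?_ this
    rintro _ ⟨w, hw, rfl⟩
    exact limitingNC_smul hw hc
  exact map_mem_closure (continuous_const_smul c) hv h1

/-- Limits of approximate limiting normals are limiting normals. -/
theorem mem_limitingNC_of_approx {C : Set E} {x v : E}
    (h : ∀ e > 0, ∃ y ∈ C, ∃ w ∈ frechetNC C y, ‖y - x‖ < e ∧ ‖w - v‖ < e) :
    v ∈ limitingNC C x := by
  choose! y hy w hw hyx hwv using h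
  have hpos : ∀ n : ℕ, (0 : ℝ) < 1 / (n + 1) := fun n => by positivity
  refine ⟨fun n => y (1 / (n + 1)), fun n => w (1 / (n + 1)),
    fun n => ⟨hy _ (hpos n), hw _ (hpos n)⟩, ?_, ?_⟩
  · exact tendsto_iff_norm_sub_tendsto_zero.2 (squeeze_zero (fun _ => norm_nonneg _)
      (fun n => (hyx _ (hpos n)).le) tendsto_one_div_add_atTop_nhds_zero_nat)
  · exact tendsto_iff_norm_sub_tendsto_zero.2 (squeeze_zero (fun _ => norm_nonneg _)
      (fun n => (hwv _ (hpos n)).le) tendsto_one_div_add_atTop_nhds_zero_nat)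

theorem exists_frechet_of_limiting {C : Set E} {x v : E} (h : v ∈ limitingNC C x) {e : ℝ}
    (he : 0 < e) : ∃ y ∈ C, ∃ w ∈ frechetNC C y, ‖y - x‖ < e ∧ ‖w - v‖ < e := by
  obtain ⟨xs, vs, h, hx, hv⟩ := h
  have h1 := (tendsto_iff_norm_sub_tendsto_zero.1 hx).eventually (gt_mem_nhds he)
  have h2 := (tendsto_iff_norm_sub_tendsto_zero.1 hv).eventually (gt_mem_nhds he)
  obtain ⟨n, h1, h2⟩ := (h1.and h2).exists
  exact ⟨xs n, (h n).1, vs n, (h n).2, h1, h2⟩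

theorem limitingNC_closed_graph {C : Set E} {x v : E} {xs vs : ℕ → E}
    (h : ∀ n, vs n ∈ limitingNC C (xs n)) (hx : Tendsto xs atTop (𝓝 x))
    (hv : Tendsto vs atTop (𝓝 v)) : v ∈ limitingNC C x := by
  refine mem_limitingNC_of_approx fun e he => ?_
  have h1 := (tendsto_iff_norm_sub_tendsto_zero.1 hx).eventually (gt_mem_nhds (half_pos he))
  have h2 := (tendsto_iff_norm_sub_tendsto_zero.1 hv).eventually (gt_mem_nhds (half_pos he))
  obtain ⟨n, h1, h2⟩ := (h1.and h2).exists
  obtain ⟨y, hy, w, hw, hyx, hwv⟩ := exists_frechet_of_limiting (h n) (half_pos he)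
  exact ⟨y, hy, w, hw, by linarith [norm_sub_le_norm_sub_add_norm_sub y (xs n) x],
    by linarith [norm_sub_le_norm_sub_add_norm_sub w (vs n) v]⟩

theorem frechetNC_subset_limitingNC {C : Set E} {x v : E} (hx : x ∈ C) (h : v ∈ frechetNC C x) :
    v ∈ limitingNC C x :=
  ⟨fun _ => x, fun _ => v, fun _ => ⟨hx, h⟩, tendsto_const_nhds, tendsto_const_nhds⟩

theorem limitingNC_univ {x v : E} (h : v ∈ limitingNC (univ : Set E) x) : v = 0 := by
  obtain ⟨xs, vs, h, hx, hv⟩ := h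
  have : ∀ n, vs n = 0 := by
    intro n
    by_contra hne
    have hn : 0 < ‖vs n‖ := norm_pos_iff.2 hne
    obtain ⟨δ, hδ, hh⟩ := (h n).2 (‖vs n‖ / 2) (by positivity)
    have hs : 0 < δ / (2 * ‖vs n‖) := by positivity
    have := hh (xs n + (δ / (2 * ‖vs n‖)) • vs n) trivial (by
      rw [add_sub_cancel_left, norm_smul, Real.norm_of_nonneg hs.le]
      field_simp; linarith)
    rw [add_sub_cancel_left, norm_smul, Real.norm_of_nonneg hs.le, real_inner_smul_right,
      real_inner_self_eq_norm_sq] at this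
    have h3 : 0 < δ / (2 * ‖vs n‖) * ‖vs n‖ ^ 2 := by positivity
    nlinarith
  simp only [funext this] at hv
  exact (tendsto_nhds_unique hv tendsto_const_nhds)

theorem mem_limSubdiff_of_approx {f : E → ℝ} (hf : Continuous f) {x ζ : E}
    (h : ∀ e > 0, ∃ y, ∃ w ∈ proxSubdiff f y, ‖y - x‖ < e ∧ ‖w - ζ‖ < e) :
    ζ ∈ limSubdiff f x := by
  choose! y w hw hyx hwv using h
  have hpos : ∀ n : ℕ, (0 : ℝ) < 1 / (n + 1) := fun n => by positivity
  have hy : Tendsto (fun n : ℕ => y (1 / (n + 1))) atTop (𝓝 x) :=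
    tendsto_iff_norm_sub_tendsto_zero.2 (squeeze_zero (fun _ => norm_nonneg _)
      (fun n => (hyx _ (hpos n)).le) tendsto_one_div_add_atTop_nhds_zero_nat)
  exact ⟨fun n => y (1 / (n + 1)), fun n => w (1 / (n + 1)), fun n => hw _ (hpos n), hy,
    (hf.tendsto x).comp hy,
    tendsto_iff_norm_sub_tendsto_zero.2 (squeeze_zero (fun _ => norm_nonneg _)
      (fun n => (hwv _ (hpos n)).le) tendsto_one_div_add_atTop_nhds_zero_nat)⟩

variable [FiniteDimensional ℝ E]

/-- A vector that is normal up to a linear error `a` and a quadratic error is within `4 a` of a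
Fréchet normal at a nearby point. -/
theorem exists_frechet_near {C : Set E} (hC : IsClosed C) {x v : E} (hx : x ∈ C) {a K ρ : ℝ}
    (ha : 0 ≤ a) (hK : 0 ≤ K) (hρ : 0 < ρ)
    (h : ∀ y ∈ C, ‖y - x‖ < ρ → ⟪v, y - x⟫ ≤ a * ‖y - x‖ + K * ‖y - x‖ ^ 2) :
    ∃ y ∈ C, ∃ w ∈ frechetNC C y, ‖y - x‖ < ρ ∧ ‖w - v‖ ≤ 4 * a := by
  have : ProperSpace E := FiniteDimensional.proper_real E
  set s : ℝ := min (1 / (4 * (K + 1))) (ρ / (4 * (‖v‖ + 1))) with hs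
  have hs0 : 0 < s := lt_min (by positivity) (by positivity)
  have hs1 : s * (4 * (K + 1)) ≤ 1 := by
    have : s ≤ 1 / (4 * (K + 1)) := min_le_left _ _
    rwa [le_div_iff₀ (by positivity)] at this
  have hs2 : s * (4 * (‖v‖ + 1)) ≤ ρ := by
    have : s ≤ ρ / (4 * (‖v‖ + 1)) := min_le_right _ _
    rwa [le_div_iff₀ (by positivity)] at this
  obtain ⟨y, hy, hdist⟩ := hC.exists_infDist_eq_dist ⟨x, hx⟩ (x + s • v)
  have hnear : ∀ z ∈ C, ‖x + s • v - y‖ ≤ ‖x + s • v - z‖ := fun z hz => by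
    rw [← dist_eq_norm, ← dist_eq_norm, ← hdist]; exact Metric.infDist_le_dist_of_mem hz
  have hx1 := hnear x hx
  have hsv : ‖s • v‖ = s * ‖v‖ := by rw [norm_smul, Real.norm_of_nonneg hs0.le]
  rw [add_sub_cancel_left] at hx1
  have e1 : x + s • v - y = s • v - (y - x) := by abel
  have hyx : ‖y - x‖ ≤ 2 * (s * ‖v‖) := by
    have := norm_sub_norm_le (y - x) (s • v)
    rw [norm_sub_rev (y - x) (s • v), ← e1] at this
    linarith
  have hyρ : ‖y - x‖ < ρ := by nlinarith [norm_nonneg v]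
  have hq : ‖y - x‖ ^ 2 ≤ 2 * s * ⟪v, y - x⟫ := by
    have h1 : ‖x + s • v - y‖ ^ 2 ≤ ‖s • v‖ ^ 2 := by gcongr
    rw [e1, norm_sub_sq_real, real_inner_smul_left] at h1
    linarith
  have hb : ‖y - x‖ ≤ 4 * a * s := by
    rcases eq_or_lt_of_le (norm_nonneg (y - x)) with h0 | h0
    · rw [← h0]; positivity
    · have h2 := h y hy hyρ
      have h3 : ‖y - x‖ ^ 2 ≤ 2 * s * (a * ‖y - x‖ + K * ‖y - x‖ ^ 2) := by nlinarith
      have h4 : ‖y - x‖ * ‖y - x‖ ≤ ‖y - x‖ * (2 * s * a + 2 * s * K * ‖y - x‖) := by nlinarith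
      have h5 := le_of_mul_le_mul_left h4 h0
      have h6 : 2 * s * K ≤ 1 / 2 := by nlinarith
      nlinarith
  refine ⟨y, hy, s⁻¹ • (x + s • v - y), ?_, hyρ, ?_⟩
  · refine frechetNC_smul ?_ (by positivity)
    intro e he
    refine ⟨e, he, fun z hz hzy => ?_⟩
    have h1 : ‖x + s • v - y‖ ^ 2 ≤ ‖x + s • v - z‖ ^ 2 := by gcongr; exact hnear z hz
    have e2 : x + s • v - z = (x + s • v - y) - (z - y) := by abel
    rw [e2, norm_sub_sq_real (x + s • v - y) (z - y)] at h1
    nlinarith [norm_nonneg (z - y)]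
  · have e3 : s⁻¹ • (x + s • v - y) - v = s⁻¹ • (x - y) := by
      rw [show x + s • v - y = (x - y) + s • v by abel, smul_add, smul_smul,
        inv_mul_cancel₀ hs0.ne', one_smul, add_sub_cancel_right]
    rw [e3, norm_smul, Real.norm_of_nonneg (by positivity), norm_sub_rev, inv_mul_le_iff₀ hs0]
    linarith

/-- Limits of normals with vanishing linear error and arbitrary quadratic errors. -/
theorem mem_limitingNC_of_tendsto {C : Set E} (hC : IsClosed C) {x v : E} {xs vs : ℕ → E}
    {a : ℕ → ℝ} (ha : ∀ n, 0 ≤ a n) (hx : Tendsto xs atTop (𝓝 x)) (hv : Tendsto vs atTop (𝓝 v))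
    (ha0 : Tendsto a atTop (𝓝 0)) (hxC : ∀ n, xs n ∈ C)
    (h : ∀ n, ∃ K ≥ 0, ∃ ρ > 0, ∀ y ∈ C, ‖y - xs n‖ < ρ →
      ⟪vs n, y - xs n⟫ ≤ a n * ‖y - xs n‖ + K * ‖y - xs n‖ ^ 2) :
    v ∈ limitingNC C x := by
  refine mem_limitingNC_of_approx fun e he => ?_
  have h1 := (tendsto_iff_norm_sub_tendsto_zero.1 hx).eventually (gt_mem_nhds (half_pos he))
  have h2 := (tendsto_iff_norm_sub_tendsto_zero.1 hv).eventually (gt_mem_nhds (half_pos he))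
  have h3 := ha0.eventually (gt_mem_nhds (show 0 < e / 8 by positivity))
  obtain ⟨n, ⟨h1, h2⟩, h3⟩ := ((h1.and h2).and h3).exists
  obtain ⟨K, hK, ρ, hρ, hh⟩ := h n
  obtain ⟨y, hy, w, hw, hyx, hwv⟩ := exists_frechet_near hC (hxC n) (ha n) hK
    (lt_min hρ (half_pos he)) fun y hy hyx => hh y hy (lt_of_lt_of_le hyx (min_le_left _ _))
  refine ⟨y, hy, w, hw, ?_, ?_⟩
  · linarith [norm_sub_le_norm_sub_add_norm_sub y (xs n) x, min_le_right ρ (e / 2)]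
  · linarith [norm_sub_le_norm_sub_add_norm_sub w (vs n) v]

/-- A subgradient up to a linear error `a` and a quadratic error is within `8 a` of a proximal
subgradient at a nearby point. -/
theorem exists_proxSubdiff_near {f : E → ℝ} (hf : Continuous f) {x ζ : E} {a K ρ : ℝ}
    (ha : 0 ≤ a) (hK : 0 ≤ K) (hρ : 0 < ρ)
    (h : ∀ y, ‖y - x‖ < ρ → f x + ⟪ζ, y - x⟫ - a * ‖y - x‖ - K * ‖y - x‖ ^ 2 ≤ f y) :
    ∃ y, ∃ w ∈ proxSubdiff f y, ‖y - x‖ < ρ ∧ ‖w - ζ‖ ≤ 8 * a := by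
  have : ProperSpace E := FiniteDimensional.proper_real E
  set c : ℝ := 2 * K + 2 + 4 * a / ρ
  have hc : 0 < c := by positivity
  obtain ⟨y, hy, hmin⟩ := (isCompact_closedBall x (ρ / 2)).exists_isMinOn
    ⟨x, Metric.mem_closedBall_self (by positivity)⟩
    (f := fun y => f y - ⟪ζ, y - x⟫ + c * ‖y - x‖ ^ 2) (by fun_prop)
  rw [mem_closedBall_iff_norm] at hy
  have hx := hmin (Metric.mem_closedBall_self (by positivity : 0 ≤ ρ / 2))
  simp only [mem_ofPred_eq, sub_self, inner_zero_right, norm_zero] at hx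
  have hyρ : ‖y - x‖ < ρ := by linarith
  have hb : c * ‖y - x‖ ≤ 2 * a := by
    rcases eq_or_lt_of_le (norm_nonneg (y - x)) with h0 | h0
    · rw [← h0]; nlinarith
    · have h2 := h y hyρ
      have h4 : ‖y - x‖ * (c * ‖y - x‖) ≤ ‖y - x‖ * (a + K * ‖y - x‖) := by nlinarith
      have h5 := le_of_mul_le_mul_left h4 h0
      have h6 : K ≤ c / 2 := by
        have : 0 ≤ 4 * a / ρ := by positivity
        simp only [c]; linarith
      nlinarith
  have hlt : ‖y - x‖ < ρ / 2 := by
    have h7 : 4 * a / ρ * (ρ / 2) = 2 * a := by field_simp; ring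
    by_contra! hge
    have h8 : c * (ρ / 2) ≤ 2 * a := by nlinarith
    have : c * (ρ / 2) = (2 * K + 2) * (ρ / 2) + 2 * a := by rw [← h7]; simp only [c]; ring
    nlinarith
  refine ⟨y, ζ - (2 * c) • (y - x), ⟨c, hc, ρ / 2 - ‖y - x‖, by linarith, fun z hz => ?_⟩, hyρ, ?_⟩
  · have hzx : z ∈ Metric.closedBall x (ρ / 2) := by
      rw [mem_closedBall_iff_norm]
      linarith [norm_sub_le_norm_sub_add_norm_sub z y x]
    have h9 := hmin hzx
    simp only [mem_ofPred_eq] at h9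
    have e1 : z - x = (z - y) + (y - x) := by abel
    rw [e1, inner_add_right, norm_add_sq_real] at h9
    rw [inner_sub_left, real_inner_smul_left, real_inner_comm]
    rw [real_inner_comm] at h9
    rw [real_inner_comm (z - y) (y - x), real_inner_comm ζ (z - y)]
    rw [real_inner_comm (z - y) ζ] at *
    nlinarith
  · rw [show ζ - (2 * c) • (y - x) - ζ = -((2 * c) • (y - x)) by abel, norm_neg, norm_smul,
      Real.norm_of_nonneg (by positivity)]
    linarith

theorem mem_limSubdiff_of_tendsto {f : E → ℝ} (hf : Continuous f) {x ζ : E} {xs ζs : ℕ → E}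
    {a : ℕ → ℝ} (ha : ∀ n, 0 ≤ a n) (hx : Tendsto xs atTop (𝓝 x)) (hζ : Tendsto ζs atTop (𝓝 ζ))
    (ha0 : Tendsto a atTop (𝓝 0))
    (h : ∀ᶠ n in atTop, ∃ K ≥ 0, ∃ ρ > 0, ∀ y, ‖y - xs n‖ < ρ →
      f (xs n) + ⟪ζs n, y - xs n⟫ - a n * ‖y - xs n‖ - K * ‖y - xs n‖ ^ 2 ≤ f y) :
    ζ ∈ limSubdiff f x := by
  refine mem_limSubdiff_of_approx hf fun e he => ?_
  have h1 := (tendsto_iff_norm_sub_tendsto_zero.1 hx).eventually (gt_mem_nhds (half_pos he))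
  have h2 := (tendsto_iff_norm_sub_tendsto_zero.1 hζ).eventually (gt_mem_nhds (half_pos he))
  have h3 := ha0.eventually (gt_mem_nhds (show 0 < e / 16 by positivity))
  obtain ⟨n, ⟨⟨h1, h2⟩, h3⟩, K, hK, ρ, hρ, hh⟩ := (((h1.and h2).and h3).and h).exists
  obtain ⟨y, w, hw, hyx, hwv⟩ := exists_proxSubdiff_near hf (ha n) hK
    (lt_min hρ (half_pos he)) fun y hyx => hh y (lt_of_lt_of_le hyx (min_le_left _ _))
  refine ⟨y, w, hw, ?_, ?_⟩
  · linarith [norm_sub_le_norm_sub_add_norm_sub y (xs n) x, min_le_right ρ (e / 2)]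
  · linarith [norm_sub_le_norm_sub_add_norm_sub w (ζs n) ζ]

theorem limSubdiff_nonempty {f : E → ℝ} (hf : LocallyLipschitz f) (x : E) :
    (limSubdiff f x).Nonempty := by
  have : ProperSpace E := FiniteDimensional.proper_real E
  obtain ⟨L, s, hs, hL⟩ := hf x
  obtain ⟨ρ, hρ, hball⟩ := Metric.mem_nhds_iff.1 hs
  have key : ∀ n : ℕ, ∃ y, ∃ w ∈ proxSubdiff f y, ‖y - x‖ < min ρ (1 / (n + 1)) ∧ ‖w - 0‖ ≤ 8 * L := by
    intro n
    refine exists_proxSubdiff_near hf.continuous L.2 le_rfl (by positivity) fun y hy => ?_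
    have h1 : y ∈ s := hball (mem_ball_iff_norm.2 (lt_of_lt_of_le hy (min_le_left _ _)))
    have h2 := hL.dist_le_mul x (mem_of_mem_nhds hs) y h1
    rw [Real.dist_eq, dist_comm, dist_eq_norm] at h2
    have := le_abs_self (f x - f y)
    simp only [inner_zero_left, zero_mul]
    change _ - (L : ℝ) * _ - _ ≤ _
    linarith
  choose y w hw hy hwb using key
  obtain ⟨ζ, _, φ, hφ, hlim⟩ := (isCompact_closedBall (0 : E) (8 * L)).tendsto_subseq
    (x := w) fun n => by rw [mem_closedBall_iff_norm]; exact hwb n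
  have hyx : Tendsto y atTop (𝓝 x) :=
    tendsto_iff_norm_sub_tendsto_zero.2 (squeeze_zero (fun _ => norm_nonneg _)
      (fun n => (hy n).le.trans (min_le_right _ _)) tendsto_one_div_add_atTop_nhds_zero_nat)
  have hyφ := hyx.comp hφ.tendsto_atTop
  exact ⟨ζ, y ∘ φ, w ∘ φ, fun n => hw _, hyφ, (hf.continuous.tendsto x).comp hyφ, hlim⟩

end Normals

section Products

variable {A B C : Type}

@[simp] theorem pl2fst_pl2 (a : A) (b : B) : pl2fst (pl2 a b) = a := rfl
@[simp] theorem pl2snd_pl2 (a : A) (b : B) : pl2snd (pl2 a b) = b := rfl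
@[simp] theorem pl2_eta (z : PL2 A B) : pl2 (pl2fst z) (pl2snd z) = z := rfl

variable [NormedAddCommGroup A] [NormedAddCommGroup B] [NormedAddCommGroup C]

@[simp] theorem pl2fst_sub (z w : PL2 A B) : pl2fst (z - w) = pl2fst z - pl2fst w := rfl
@[simp] theorem pl2snd_sub (z w : PL2 A B) : pl2snd (z - w) = pl2snd z - pl2snd w := rfl
@[simp] theorem pl2fst_add (z w : PL2 A B) : pl2fst (z + w) = pl2fst z + pl2fst w := rfl
@[simp] theorem pl2snd_add (z w : PL2 A B) : pl2snd (z + w) = pl2snd z + pl2snd w := rfl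
@[simp] theorem pl2fst_zero : pl2fst (0 : PL2 A B) = 0 := rfl
@[simp] theorem pl2snd_zero : pl2snd (0 : PL2 A B) = 0 := rfl

theorem pl2_sub (a a' : A) (b b' : B) : pl2 a b - pl2 a' b' = pl2 (a - a') (b - b') := rfl

theorem norm_pl2_sq (z : PL2 A B) : ‖z‖ ^ 2 = ‖pl2fst z‖ ^ 2 + ‖pl2snd z‖ ^ 2 :=
  WithLp.prod_norm_sq_eq_of_L2 z

theorem norm_pl2fst_le (z : PL2 A B) : ‖pl2fst z‖ ≤ ‖z‖ :=
  abs_le_of_sq_le_sq' (by rw [norm_pl2_sq]; nlinarith [norm_nonneg (pl2snd z)]) (norm_nonneg _) |>.2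

theorem norm_pl2snd_le (z : PL2 A B) : ‖pl2snd z‖ ≤ ‖z‖ :=
  abs_le_of_sq_le_sq' (by rw [norm_pl2_sq]; nlinarith [norm_nonneg (pl2fst z)]) (norm_nonneg _) |>.2

theorem norm_le_pl2 (z : PL2 A B) : ‖z‖ ≤ ‖pl2fst z‖ + ‖pl2snd z‖ :=
  abs_le_of_sq_le_sq' (by
    rw [norm_pl2_sq]; nlinarith [norm_nonneg (pl2fst z), norm_nonneg (pl2snd z)])
    (by positivity) |>.2

theorem norm_pl2_zero_left (b : B) : ‖pl2 (0 : A) b‖ = ‖b‖ :=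
  le_antisymm ((norm_le_pl2 _).trans (by simp)) (norm_pl2snd_le (pl2 (0 : A) b))

theorem norm_pl2_zero_right (a : A) : ‖pl2 a (0 : B)‖ = ‖a‖ :=
  le_antisymm ((norm_le_pl2 _).trans (by simp)) (norm_pl2fst_le (pl2 a (0 : B)))

@[fun_prop] theorem continuous_pl2fst : Continuous (pl2fst : PL2 A B → A) :=
  WithLp.prod_continuous_ofLp 2 A B |>.fst

@[fun_prop] theorem continuous_pl2snd : Continuous (pl2snd : PL2 A B → B) :=
  WithLp.prod_continuous_ofLp 2 A B |>.snd

theorem continuous_pl2_uncurry : Continuous (fun z : A × B => pl2 z.1 z.2) :=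
  WithLp.prod_continuous_toLp 2 A B

@[fun_prop] theorem continuous_pl2 {T : Type*} [TopologicalSpace T] {a : T → A} {b : T → B}
    (ha : Continuous a) (hb : Continuous b) : Continuous fun t => pl2 (a t) (b t) :=
  continuous_pl2_uncurry.comp (ha.prodMk hb)

theorem tendsto_pl2 {T : Type*} {l : Filter T} {a : T → A} {b : T → B} {a0 : A} {b0 : B}
    (ha : Tendsto a l (𝓝 a0)) (hb : Tendsto b l (𝓝 b0)) :
    Tendsto (fun t => pl2 (a t) (b t)) l (𝓝 (pl2 a0 b0)) :=
  (continuous_pl2_uncurry.tendsto (a0, b0)).comp (ha.prodMk_nhds hb)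

variable [InnerProductSpace ℝ A] [InnerProductSpace ℝ B] [InnerProductSpace ℝ C]

@[simp] theorem pl2fst_smul (c : ℝ) (z : PL2 A B) : pl2fst (c • z) = c • pl2fst z := rfl
@[simp] theorem pl2snd_smul (c : ℝ) (z : PL2 A B) : pl2snd (c • z) = c • pl2snd z := rfl

theorem inner_pl2 (z w : PL2 A B) :
    ⟪z, w⟫ = ⟪pl2fst z, pl2fst w⟫ + ⟪pl2snd z, pl2snd w⟫ := by
  rw [WithLp.prod_inner_apply]; rfl

/-- The first projection as a continuous linear map. -/
def fstCLM (A B : Type) [NormedAddCommGroup A] [NormedAddCommGroup B] [InnerProductSpace ℝ A]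
    [InnerProductSpace ℝ B] : PL2 A B →L[ℝ] A :=
  ⟨⟨⟨pl2fst, fun _ _ => rfl⟩, fun _ _ => rfl⟩, continuous_pl2fst⟩

/-- The second projection as a continuous linear map. -/
def sndCLM (A B : Type) [NormedAddCommGroup A] [NormedAddCommGroup B] [InnerProductSpace ℝ A]
    [InnerProductSpace ℝ B] : PL2 A B →L[ℝ] B :=
  ⟨⟨⟨pl2snd, fun _ _ => rfl⟩, fun _ _ => rfl⟩, continuous_pl2snd⟩

@[simp] theorem fstCLM_apply (z : PL2 A B) : fstCLM A B z = pl2fst z := rfl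
@[simp] theorem sndCLM_apply (z : PL2 A B) : sndCLM A B z = pl2snd z := rfl

theorem limitingNC_preimage_fst_snd {U : Set B} {w ξ : PL2 A (PL2 B C)}
    (h : ξ ∈ limitingNC {z : PL2 A (PL2 B C) | pl2fst (pl2snd z) ∈ U} w) :
    pl2fst ξ = 0 ∧ pl2snd (pl2snd ξ) = 0 ∧
      pl2fst (pl2snd ξ) ∈ limitingNC U (pl2fst (pl2snd w)) := by
  obtain ⟨ws, vs, hn, hw, hv⟩ := h
  have key : ∀ n, pl2fst (vs n) = 0 ∧ pl2snd (pl2snd (vs n)) = 0 := by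
    intro n
    set d : PL2 A (PL2 B C) := pl2 (pl2fst (vs n)) (pl2 0 (pl2snd (pl2snd (vs n)))) with hd
    have hin : ⟪vs n, d⟫ = ‖d‖ ^ 2 := by
      rw [inner_pl2, inner_pl2, norm_pl2_sq, norm_pl2_sq]
      simp [hd]
    have hd0 : d = 0 := by
      by_contra hne
      have hpos : 0 < ‖d‖ := norm_pos_iff.2 hne
      obtain ⟨δ, hδ, hh⟩ := (hn n).2 (‖d‖ / 2) (by positivity)
      have hs : 0 < δ / (2 * ‖d‖) := by positivity
      have := hh (ws n + (δ / (2 * ‖d‖)) • d) (by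
        have := (hn n).1
        rw [mem_ofPred_eq] at this ⊢
        simpa [hd] using this) (by
        rw [add_sub_cancel_left, norm_smul, Real.norm_of_nonneg hs.le]
        field_simp; linarith)
      rw [add_sub_cancel_left, norm_smul, Real.norm_of_nonneg hs.le, real_inner_smul_right,
        hin] at this
      have h3 : 0 < δ / (2 * ‖d‖) * ‖d‖ ^ 2 := by positivity
      nlinarith
    exact ⟨congrArg pl2fst hd0, congrArg (fun z => pl2snd (pl2snd z)) hd0⟩
  refine ⟨?_, ?_, fun n => pl2fst (pl2snd (ws n)), fun n => pl2fst (pl2snd (vs n)), ?_, ?_, ?_⟩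
  · exact tendsto_nhds_unique ((continuous_pl2fst.tendsto _).comp hv)
      (by simp [Function.comp_def, key])
  · exact tendsto_nhds_unique (((continuous_pl2snd.comp continuous_pl2snd).tendsto _).comp hv)
      (by simp [Function.comp_def, key])
  · intro n
    refine ⟨(hn n).1, fun e he => ?_⟩
    obtain ⟨δ, hδ, hh⟩ := (hn n).2 e he
    refine ⟨δ, hδ, fun y hy hyx => ?_⟩
    set z : PL2 A (PL2 B C) := pl2 (pl2fst (ws n)) (pl2 y (pl2snd (pl2snd (ws n))))
    have e1 : z - ws n = pl2 0 (pl2 (y - pl2fst (pl2snd (ws n))) 0) := by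
      rw [← pl2_eta (z - ws n), ← pl2_eta (pl2snd (z - ws n))]
      simp [z]
    have e2 : ‖z - ws n‖ = ‖y - pl2fst (pl2snd (ws n))‖ := by
      rw [e1, norm_pl2_zero_left, norm_pl2_zero_right]
    have := hh z hy (by rwa [e2])
    rw [e2, e1, inner_pl2, inner_pl2] at this
    simpa using this
  · exact ((continuous_pl2fst.comp continuous_pl2snd).tendsto _).comp hw
  · exact ((continuous_pl2fst.comp continuous_pl2snd).tendsto _).comp hv

end Products

section CalmNormals

variable {W Y : Type} [NormedAddCommGroup W] [InnerProductSpace ℝ W]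
  [NormedAddCommGroup Y] [InnerProductSpace ℝ Y]

theorem frechetNC_of_isMin {C : Set W} {x v : W} {H : W → ℝ} {L : W →L[ℝ] ℝ} {ρ : ℝ}
    (hH : HasFDerivAt H L x) (hρ : 0 < ρ) (hmin : ∀ y ∈ C, ‖y - x‖ < ρ → H x ≤ H y)
    (hL : ∀ y, ⟪v, y⟫ = -L y) : v ∈ frechetNC C x := by
  intro e he
  have h1 := hasFDerivAt_iff_isLittleO.1 hH
  have h2 := Asymptotics.isLittleO_iff.1 h1 he
  obtain ⟨δ, hδ, h3⟩ := Metric.eventually_nhds_iff.1 h2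
  refine ⟨min δ ρ, lt_min hδ hρ, fun y hy hyx => ?_⟩
  have h4 := h3 (y := y) (by rw [dist_eq_norm]; exact hyx.trans_le (min_le_left _ _))
  have h5 := hmin y hy (hyx.trans_le (min_le_right _ _))
  rw [hL]
  have := (abs_le.1 (Real.norm_eq_abs _ ▸ h4)).2
  have h6 := (abs_le.1 (Real.norm_eq_abs _ ▸ h4)).1
  linarith

theorem continuous_of_hasStrictFDerivAt {φ : W → Y} {φ' : W → W →L[ℝ] Y}
    (h : ∀ z, HasStrictFDerivAt φ (φ' z) z) : Continuous φ' := by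
  refine continuous_iff_continuousAt.2 fun z => ?_
  rw [ContinuousAt, tendsto_iff_norm_sub_tendsto_zero, Metric.tendsto_nhds]
  intro e he
  have h1 := Asymptotics.isLittleO_iff.1 (hasStrictFDerivAt_iff_isLittleO.1 (h z)) (half_pos he)
  rw [Metric.eventually_nhds_iff] at h1
  obtain ⟨ρ, hρ, h2⟩ := h1
  filter_upwards [Metric.ball_mem_nhds z hρ] with y hy
  rw [Metric.mem_ball] at hy
  have h3 : HasFDerivAt (fun w => φ w - φ' z w) (φ' y - φ' z) y :=
    (h y).hasFDerivAt.sub (φ' z).hasFDerivAt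
  have h4 : ‖φ' y - φ' z‖ ≤ e / 2 := by
    refine h3.le_of_lip' (half_pos he).le ?_
    filter_upwards [Metric.isOpen_ball.mem_nhds (Metric.mem_ball.2 hy)] with w hw
    have := h2 (y := (w, y)) (by
      rw [Prod.dist_eq]; exact max_lt hw hy)
    rw [map_sub] at this
    rwa [show φ w - φ' z w - (φ y - φ' z y) = φ w - φ y - (φ' z w - φ' z y) by abel]
  rw [dist_zero_right, norm_norm]
  linarith

end CalmNormals

theorem tendsto_clm_apply {F G T : Type*} [NormedAddCommGroup F] [NormedSpace ℝ F]
    [NormedAddCommGroup G] [NormedSpace ℝ G] {l : Filter T} {A : T → F →L[ℝ] G} {a : T → F}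
    {A0 : F →L[ℝ] G} {a0 : F} (hA : Tendsto A l (𝓝 A0)) (ha : Tendsto a l (𝓝 a0)) :
    Tendsto (fun t => A t (a t)) l (𝓝 (A0 a0)) :=
  ((isBoundedBilinearMap_apply (𝕜 := ℝ) (E := F) (F := G)).continuous.tendsto (A0, a0)).comp
    (hA.prodMk_nhds ha)

section CalmNormals

variable {W Y : Type} [NormedAddCommGroup W] [InnerProductSpace ℝ W]
  [NormedAddCommGroup Y] [InnerProductSpace ℝ Y] [FiniteDimensional ℝ W] [FiniteDimensional ℝ Y]

/-- One smoothing step: an approximate multiplier for a Fréchet normal to a calm constraint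
system. -/
theorem exists_approx_multiplier {Ω : Set W} (hΩ : IsClosed Ω) {φ : W → Y} {φ' : W → W →L[ℝ] Y}
    (hφ : ∀ z, HasStrictFDerivAt φ (φ' z) z) {w ξ : W} (hw : w ∈ Ω) (hφw : φ w = 0)
    {μ : ℝ} (hμ : 0 ≤ μ)
    (hcalm : ∀ᶠ y in 𝓝 w, y ∈ Ω → ∃ z ∈ Ω, φ z = 0 ∧ ‖y - z‖ ≤ μ * ‖φ y‖)
    (hξ : ξ ∈ frechetNC {z | z ∈ Ω ∧ φ z = 0} w) {e : ℝ} (he : 0 < e) :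
    ∃ y ∈ Ω, ‖y - w‖ < e ∧ ∃ lam : Y, ‖lam‖ ≤ (‖ξ‖ + e) * μ ∧ ∃ v ∈ frechetNC Ω y,
      ‖v - (ξ - ContinuousLinearMap.adjoint (φ' y) lam)‖ ≤ 4 * e := by
  have : ProperSpace W := FiniteDimensional.proper_real W
  have hφc : Continuous φ := continuous_iff_continuousAt.2 fun z => (hφ z).continuousAt
  obtain ⟨δ, hδ, hfr⟩ := hξ e he
  set κ := (‖ξ‖ + e) * μ with hκ
  have hκ0 : 0 ≤ κ := by positivity
  have hpen : ∀ᶠ y in 𝓝 w, y ∈ Ω → ⟪ξ, y - w⟫ ≤ κ * ‖φ y‖ + e * ‖y - w‖ := by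
    have hsmall : Tendsto (fun y => ‖y - w‖ + μ * ‖φ y‖) (𝓝 w) (𝓝 0) := by
      have : Continuous (fun y => ‖y - w‖ + μ * ‖φ y‖) := by fun_prop
      simpa [hφw] using this.tendsto w
    filter_upwards [hcalm, hsmall.eventually (gt_mem_nhds hδ)] with y h1 h2 hy
    obtain ⟨z, hz, hz0, hzy⟩ := h1 hy
    have hzw : ‖z - w‖ ≤ ‖y - w‖ + μ * ‖φ y‖ := by
      have := norm_sub_le_norm_sub_add_norm_sub z y w
      rw [norm_sub_rev z y] at this; linarith
    have h3 := hfr z ⟨hz, hz0⟩ (by linarith)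
    have h4 : ⟪ξ, y - z⟫ ≤ ‖ξ‖ * (μ * ‖φ y‖) :=
      (real_inner_le_norm _ _).trans (by gcongr)
    have h5 : ⟪ξ, y - w⟫ = ⟪ξ, y - z⟫ + ⟪ξ, z - w⟫ := by rw [← inner_add_right]; congr 1; abel
    rw [h5, hκ]
    nlinarith
  obtain ⟨ρ0, hρ0, hpen⟩ := Metric.eventually_nhds_iff.1 hpen
  set ρ : ℝ := min (ρ0 / 2) (e / 2)
  have hρ : 0 < ρ := lt_min (by positivity) (by positivity)
  have hρe : ρ ≤ e / 2 := min_le_right _ _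
  have hρ1 : ρ ≤ ρ0 / 2 := min_le_left _ _
  set σ : ℝ := e * ρ / (2 * (κ + 1)) with hσ
  have hσ0 : 0 < σ := by positivity
  have hκσ : κ * σ < e * ρ := by
    rw [hσ, mul_div_assoc', div_lt_iff₀ (by positivity)]
    have : 0 < e * ρ := by positivity
    nlinarith
  let H : W → ℝ := fun y => -⟪ξ, y - w⟫ + κ * √(‖φ y‖ ^ 2 + σ ^ 2) + 2 * e / ρ * ‖y - w‖ ^ 2
  have hHc : Continuous H := by fun_prop
  obtain ⟨y, ⟨hyΩ, hyb⟩, hmin⟩ := ((isCompact_closedBall w ρ).inter_left hΩ).exists_isMinOn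
    ⟨w, hw, Metric.mem_closedBall_self hρ.le⟩ hHc.continuousOn
  rw [mem_closedBall_iff_norm] at hyb
  have hHw : H w = κ * σ := by simp [H, hφw, Real.sqrt_sq hσ0.le]
  have hHy : H y ≤ κ * σ := hHw ▸ hmin ⟨hw, Metric.mem_closedBall_self hρ.le⟩
  have hp := hpen (y := y) (by rw [dist_eq_norm]; linarith) hyΩ
  have hsq : ‖φ y‖ ≤ √(‖φ y‖ ^ 2 + σ ^ 2) := Real.le_sqrt_of_sq_le (by nlinarith)
  have hlow : 2 * e / ρ * ‖y - w‖ ^ 2 - e * ‖y - w‖ ≤ κ * σ := by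
    have : κ * ‖φ y‖ ≤ κ * √(‖φ y‖ ^ 2 + σ ^ 2) := by gcongr
    simp only [H] at hHy
    linarith
  have hint : ‖y - w‖ < ρ := by
    refine lt_of_le_of_ne hyb fun h => ?_
    rw [h] at hlow
    have : 2 * e / ρ * ρ ^ 2 = 2 * (e * ρ) := by field_simp
    linarith
  set D := √(‖φ y‖ ^ 2 + σ ^ 2) with hD
  have hD0 : 0 < D := Real.sqrt_pos.2 (by positivity)
  set lam : Y := (κ / D) • φ y with hlam
  have hnorm : ‖lam‖ ≤ κ := by
    rw [hlam, norm_smul, Real.norm_of_nonneg (by positivity), div_mul_eq_mul_div, div_le_iff₀ hD0]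
    gcongr
  set h' : W := (4 * e / ρ) • (y - w) with hh'
  have hh'n : ‖h'‖ ≤ 4 * e := by
    rw [hh', norm_smul, Real.norm_of_nonneg (by positivity), div_mul_eq_mul_div, div_le_iff₀ hρ]
    gcongr
  refine ⟨y, hyΩ, by linarith, lam, hnorm,
    ξ - ContinuousLinearMap.adjoint (φ' y) lam - h', ?_, ?_⟩
  · have d1 : HasFDerivAt (fun y => -⟪ξ, y - w⟫) (-(innerSL ℝ ξ)) y :=
      (((innerSL ℝ ξ).hasFDerivAt.comp y ((hasFDerivAt_id y).sub_const w))).neg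
    have d2 := (((hφ y).hasFDerivAt.norm_sq.add_const (σ ^ 2)).sqrt (by positivity)).const_mul κ
    have d3 := (((hasFDerivAt_id y).sub_const w).norm_sq).const_mul (2 * e / ρ)
    refine frechetNC_of_isMin ((d1.add d2).add d3) (sub_pos.2 hint) (fun z hz hzy => ?_)
      fun z => ?_
    · refine hmin ⟨hz, ?_⟩
      rw [mem_closedBall_iff_norm]
      linarith [norm_sub_le_norm_sub_add_norm_sub z y w]
    · rw [inner_sub_left, inner_sub_left, ContinuousLinearMap.adjoint_inner_left]
      simp only [hlam, hh', real_inner_smul_left]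
      simp [inner_sub_left]
      rw [← hD]
      field_simp
      ring
  · rw [sub_sub_cancel_left, norm_neg]; exact hh'n

theorem exists_multiplier {Ω : Set W} (hΩ : IsClosed Ω) {φ : W → Y} {φ' : W → W →L[ℝ] Y}
    (hφ : ∀ z, HasStrictFDerivAt φ (φ' z) z) {w ξ : W} (hw : w ∈ Ω) (hφw : φ w = 0)
    {μ : ℝ} (hμ : 0 ≤ μ)
    (hcalm : ∀ᶠ y in 𝓝 w, y ∈ Ω → ∃ z ∈ Ω, φ z = 0 ∧ ‖y - z‖ ≤ μ * ‖φ y‖)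
    (hξ : ξ ∈ frechetNC {z | z ∈ Ω ∧ φ z = 0} w) :
    ∃ lam : Y, ‖lam‖ ≤ ‖ξ‖ * μ ∧
      ξ - ContinuousLinearMap.adjoint (φ' w) lam ∈ limitingNC Ω w := by
  have : ProperSpace Y := FiniteDimensional.proper_real Y
  have hpos : ∀ n : ℕ, (0 : ℝ) < 1 / (n + 1) := fun n => by positivity
  have hlim := tendsto_one_div_add_atTop_nhds_zero_nat (𝕜 := ℝ)
  choose y hyΩ hyw lam hlam v hv hvl using fun n : ℕ =>
    exists_approx_multiplier hΩ hφ hw hφw hμ hcalm hξ (hpos n)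
  obtain ⟨l, _, ψ, hψ, hl⟩ := (isCompact_closedBall (0 : Y) ((‖ξ‖ + 1) * μ)).tendsto_subseq
    (x := lam) fun n => by
      rw [mem_closedBall_zero_iff]
      refine (hlam n).trans ?_
      gcongr
      rw [div_le_one (by positivity)]
      linarith [n.cast_nonneg (α := ℝ)]
  have hy : Tendsto y atTop (𝓝 w) := tendsto_iff_norm_sub_tendsto_zero.2
    (squeeze_zero (fun _ => norm_nonneg _) (fun n => (hyw n).le) hlim)
  have hψt := hψ.tendsto_atTop
  have hadj : Tendsto (fun n => ξ - ContinuousLinearMap.adjoint (φ' (y (ψ n))) (lam (ψ n))) atTop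
      (𝓝 (ξ - ContinuousLinearMap.adjoint (φ' w) l)) := by
    have h1 := ((continuous_of_hasStrictFDerivAt hφ).tendsto w).comp (hy.comp hψt)
    have h2 : Tendsto (fun n => ContinuousLinearMap.adjoint (φ' (y (ψ n)))) atTop
        (𝓝 (ContinuousLinearMap.adjoint (φ' w))) :=
      ((ContinuousLinearMap.adjoint (𝕜 := ℝ) (E := W) (F := Y)).continuous.tendsto _).comp h1
    exact tendsto_const_nhds.sub (tendsto_clm_apply h2 hl)
  refine ⟨l, ?_, fun n => y (ψ n), fun n => v (ψ n), fun n => ⟨hyΩ _, hv _⟩, hy.comp hψt, ?_⟩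
  · have h1 : Tendsto (fun n => (‖ξ‖ + 1 / ((ψ n : ℝ) + 1)) * μ) atTop (𝓝 ((‖ξ‖ + 0) * μ)) :=
      ((hlim.comp hψt).const_add _).mul_const _
    rw [add_zero] at h1
    exact le_of_tendsto_of_tendsto' hl.norm h1 fun n => hlam (ψ n)
  · have h1 : Tendsto (fun n => v (ψ n) - (ξ - ContinuousLinearMap.adjoint (φ' (y (ψ n))) (lam (ψ n))))
        atTop (𝓝 0) := by
      refine squeeze_zero_norm (fun n => hvl (ψ n)) ?_
      simpa using (hlim.comp hψt).const_mul 4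
    simpa using h1.add hadj

end CalmNormals

section Dynamics

variable {nx nu m : ℕ}

/-- `mV E` as a continuous linear map. -/
def mVL (E : Matrix (Fin m) (Fin nx) ℝ) : Euc nx →L[ℝ] Euc m :=
  LinearMap.toContinuousLinearMap (Matrix.toEuclideanLin E)

theorem inner_mV (E : Matrix (Fin m) (Fin nx) ℝ) (l : Euc m) (v : Euc nx) :
    ⟪l, mV E v⟫ = ⟪mV E.transpose l, v⟫ := by
  have e1 : ⟪l, mV E v⟫ = dotProduct (E.mulVec (fun i => v i)) (fun i => l i) := by
    rw [PiLp.inner_apply]; rfl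
  have e2 : ⟪mV E.transpose l, v⟫ = dotProduct (fun i => v i) (E.transpose.mulVec (fun i => l i)) := by
    rw [PiLp.inner_apply]; rfl
  rw [e1, e2, Matrix.mulVec_transpose, dotProduct_comm, Matrix.dotProduct_mulVec, dotProduct_comm]

/-- The projection `(x,u,v) ↦ (x,u)`. -/
def xuCLM (nx nu : ℕ) : PL3 (Euc nx) (Euc nu) (Euc nx) →L[ℝ] PL2 (Euc nx) (Euc nu) :=
  ⟨⟨⟨fun z => pl2 (pl2fst z) (pl2fst (pl2snd z)), fun _ _ => rfl⟩, fun _ _ => rfl⟩,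
    continuous_pl2 continuous_pl2fst (continuous_pl2fst.comp continuous_pl2snd)⟩

/-- The constraint function `φ(x,u,v) = Ev − g(x,u)`. -/
def phi (E : Matrix (Fin m) (Fin nx) ℝ) (g : PL2 (Euc nx) (Euc nu) → Euc m)
    (z : PL3 (Euc nx) (Euc nu) (Euc nx)) : Euc m :=
  mV E (pl2snd (pl2snd z)) - g (pl2 (pl2fst z) (pl2fst (pl2snd z)))

/-- The derivative of `phi`. -/
def phi' (E : Matrix (Fin m) (Fin nx) ℝ)
    (g' : PL2 (Euc nx) (Euc nu) → (PL2 (Euc nx) (Euc nu) →L[ℝ] Euc m))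
    (z : PL3 (Euc nx) (Euc nu) (Euc nx)) : PL3 (Euc nx) (Euc nu) (Euc nx) →L[ℝ] Euc m :=
  (mVL E).comp ((sndCLM _ _).comp (sndCLM _ _)) - (g' (xuCLM nx nu z)).comp (xuCLM nx nu)

theorem phi'_apply (E : Matrix (Fin m) (Fin nx) ℝ)
    (g' : PL2 (Euc nx) (Euc nu) → (PL2 (Euc nx) (Euc nu) →L[ℝ] Euc m))
    (z w : PL3 (Euc nx) (Euc nu) (Euc nx)) : phi' E g' z w =
      mV E (pl2snd (pl2snd w)) - g' (pl2 (pl2fst z) (pl2fst (pl2snd z)))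
        (pl2 (pl2fst w) (pl2fst (pl2snd w))) := rfl

variable {E : Matrix (Fin m) (Fin nx) ℝ} {g : PL2 (Euc nx) (Euc nu) → Euc m}
  {g' : PL2 (Euc nx) (Euc nu) → (PL2 (Euc nx) (Euc nu) →L[ℝ] Euc m)} {U : Set (Euc nu)}

theorem hasStrictFDerivAt_phi (hg : ∀ z, HasStrictFDerivAt g (g' z) z)
    (z : PL3 (Euc nx) (Euc nu) (Euc nx)) : HasStrictFDerivAt (phi E g) (phi' E g' z) z :=
  by
  have h1 := ((mVL E).comp ((sndCLM (Euc nu) (Euc nx)).comp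
    (sndCLM (Euc nx) (PL2 (Euc nu) (Euc nx))))).hasStrictFDerivAt (x := z)
  have h2 := HasStrictFDerivAt.comp z (hg (xuCLM nx nu z)) (xuCLM nx nu).hasStrictFDerivAt
  exact h1.sub h2

theorem continuous_of_strict {A B : Type} [NormedAddCommGroup A] [NormedSpace ℝ A]
    [NormedAddCommGroup B] [NormedSpace ℝ B] {φ : A → B} {φ' : A → A →L[ℝ] B}
    (h : ∀ z, HasStrictFDerivAt φ (φ' z) z) : Continuous φ :=
  continuous_iff_continuousAt.2 fun z => (h z).continuousAt

theorem continuous_phi (hg : ∀ z, HasStrictFDerivAt g (g' z) z) : Continuous (phi E g) := by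
  have h1 : Continuous g := continuous_of_strict hg
  have h2 : Continuous fun z : PL3 (Euc nx) (Euc nu) (Euc nx) => mVL E (pl2snd (pl2snd z)) :=
    (mVL E).continuous.comp (continuous_pl2snd.comp continuous_pl2snd)
  exact h2.sub (h1.comp (continuous_pl2 continuous_pl2fst
    (continuous_pl2fst.comp continuous_pl2snd)))

theorem isClosed_control (hU : IsClosed U) :
    IsClosed {z : PL3 (Euc nx) (Euc nu) (Euc nx) | pl2fst (pl2snd z) ∈ U} :=
  hU.preimage (by fun_prop : Continuous
    fun z : PL3 (Euc nx) (Euc nu) (Euc nx) => pl2fst (pl2snd z))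

theorem Mmap_zero : Mmap E g U 0 =
    {z | z ∈ {z : PL3 (Euc nx) (Euc nu) (Euc nx) | pl2fst (pl2snd z) ∈ U} ∧ phi E g z = 0} := by
  ext z; simp [Mmap, phi]

theorem isClosed_Mmap (hU : IsClosed U) (hg : ∀ z, HasStrictFDerivAt g (g' z) z) :
    IsClosed (Mmap E g U 0) := by
  rw [Mmap_zero]
  exact (isClosed_control hU).inter (isClosed_eq (continuous_phi hg) continuous_const)

/-- `lam` represents the normal `ξ` at `w` as `∇φ(w)ᵀ lam + {0} × N_U(u) × {0}`. -/
def IsMultiplier (E : Matrix (Fin m) (Fin nx) ℝ)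
    (g' : PL2 (Euc nx) (Euc nu) → (PL2 (Euc nx) (Euc nu) →L[ℝ] Euc m)) (U : Set (Euc nu))
    (w ξ : PL3 (Euc nx) (Euc nu) (Euc nx)) (lam : Euc m) : Prop :=
  ∃ η ∈ limitingNC U (pl2fst (pl2snd w)), ∀ z : PL3 (Euc nx) (Euc nu) (Euc nx),
    ⟪ξ, z⟫ = ⟪lam, phi' E g' w z⟫ + ⟪η, pl2fst (pl2snd z)⟫

theorem isMultiplier_of_limitingNC {w ξ : PL3 (Euc nx) (Euc nu) (Euc nx)} {lam : Euc m}
    (h : ξ - ContinuousLinearMap.adjoint (phi' E g' w) lam ∈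
      limitingNC {z : PL3 (Euc nx) (Euc nu) (Euc nx) | pl2fst (pl2snd z) ∈ U} w) :
    IsMultiplier E g' U w ξ lam := by
  obtain ⟨h1, h2, h3⟩ := limitingNC_preimage_fst_snd h
  refine ⟨_, h3, fun z => ?_⟩
  have h4 : ⟪ξ, z⟫ = ⟪lam, phi' E g' w z⟫ +
      ⟪ξ - ContinuousLinearMap.adjoint (phi' E g' w) lam, z⟫ := by
    rw [inner_sub_left, ContinuousLinearMap.adjoint_inner_left]; ring
  rw [h4, inner_pl2 _ z, inner_pl2 _ (pl2snd z), h1, h2]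
  simp

end Dynamics

section Dynamics

variable {nx nu m : ℕ} {E : Matrix (Fin m) (Fin nx) ℝ} {g : PL2 (Euc nx) (Euc nu) → Euc m}
  {g' : PL2 (Euc nx) (Euc nu) → (PL2 (Euc nx) (Euc nu) →L[ℝ] Euc m)} {U : Set (Euc nu)}

/-- Fréchet normals near a point where WBCQ holds and `M_φ` is calm. -/
theorem exists_normal_bound (hU : IsClosed U) (hg : ∀ z, HasStrictFDerivAt g (g' z) z)
    {w0 : PL3 (Euc nx) (Euc nu) (Euc nx)} (hw0 : w0 ∈ Mmap E g U 0)
    (hW : WBCQ E g' U (pl2fst w0) (pl2fst (pl2snd w0)) (pl2snd (pl2snd w0)))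
    (hcalm : Calm (Mmap E g U) 0 w0) :
    ∃ ρ > 0, ∃ k ≥ 0, ∀ w ∈ Mmap E g U 0, ‖w - w0‖ < ρ → ∀ ξ ∈ frechetNC (Mmap E g U 0) w,
      ‖pl2fst ξ‖ ≤ k * ‖pl2snd ξ‖ ∧ ∃ lam, ‖lam‖ ≤ k * ‖pl2snd ξ‖ ∧
        IsMultiplier E g' U w ξ lam := by
  set Ω : Set (PL3 (Euc nx) (Euc nu) (Euc nx)) := {z | pl2fst (pl2snd z) ∈ U}
  have hΩ : IsClosed Ω := isClosed_control hU
  have hφ := hasStrictFDerivAt_phi (E := E) hg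
  have hφc : Continuous (phi E g) := continuous_phi hg
  have hφ0 : phi E g w0 = 0 := by rw [Mmap_zero] at hw0; exact hw0.2
  obtain ⟨μ, hμ, Ux, hUx, Vy, hVy, hc⟩ := hcalm
  have hev : ∀ᶠ y in 𝓝 w0, y ∈ Ω → ∃ z ∈ Ω, phi E g z = 0 ∧ ‖y - z‖ ≤ μ * ‖phi E g y‖ := by
    have h1 : Tendsto (fun y => -phi E g y) (𝓝 w0) (𝓝 0) := by
      have := (hφc.tendsto w0).neg
      rwa [hφ0, neg_zero] at this
    filter_upwards [hVy, h1.eventually_mem hUx] with y hy1 hy2 hy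
    obtain ⟨z, hz, hzy⟩ := hc _ hy2 y ⟨⟨hy, by simp [phi]⟩, hy1⟩
    rw [Mmap_zero] at hz
    exact ⟨z, hz.1, hz.2, by simpa using hzy⟩
  obtain ⟨ρ, hρ, hev⟩ := Metric.eventually_nhds_iff_ball.1 hev
  have hmul : ∀ w ∈ Mmap E g U 0, ‖w - w0‖ < ρ → ∀ ξ ∈ frechetNC (Mmap E g U 0) w,
      ∃ lam, ‖lam‖ ≤ ‖ξ‖ * μ ∧
        ξ - ContinuousLinearMap.adjoint (phi' E g' w) lam ∈ limitingNC Ω w := by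
    intro w hw hww ξ hξ
    rw [Mmap_zero] at hw hξ
    exact exists_multiplier hΩ hφ hw.1 hw.2 hμ (by
      filter_upwards [Metric.isOpen_ball.mem_nhds (mem_ball_iff_norm.2 hww)] with y hy
        using hev y hy) hξ
  have hbound : ∃ n : ℕ, ∀ w ∈ Mmap E g U 0, ‖w - w0‖ < 1 / (n + 1) →
      ∀ ξ ∈ frechetNC (Mmap E g U 0) w, ‖pl2fst ξ‖ ≤ n * ‖pl2snd ξ‖ := by
    by_contra! hcon
    choose w hw hww ξ hξ hlt using hcon
    have hlim := tendsto_one_div_add_atTop_nhds_zero_nat (𝕜 := ℝ)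
    have hpos : ∀ n, 0 < ‖pl2fst (ξ n)‖ := fun n => lt_of_le_of_lt (by positivity) (hlt n)
    have hwt : Tendsto w atTop (𝓝 w0) := tendsto_iff_norm_sub_tendsto_zero.2
      (squeeze_zero (fun _ => norm_nonneg _) (fun n => (hww n).le) hlim)
    obtain ⟨N, hN⟩ := eventually_atTop.1 (hlim.eventually (gt_mem_nhds hρ))
    set ζ : ℕ → PL3 (Euc nx) (Euc nu) (Euc nx) := fun n => ‖pl2fst (ξ (n + N))‖⁻¹ • ξ (n + N)
    have hζ1 : ∀ n, ‖pl2fst (ζ n)‖ = 1 := fun n => by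
      simp only [ζ, pl2fst_smul, norm_smul, norm_inv, norm_norm]
      exact inv_mul_cancel₀ (hpos _).ne'
    have hζ2 : ∀ n : ℕ, 1 ≤ n → ‖pl2snd (ζ n)‖ ≤ 1 / n := fun n hn => by
      have hn' : (0 : ℝ) < n := by exact_mod_cast hn
      simp only [ζ, pl2snd_smul, norm_smul, norm_inv, norm_norm]
      rw [inv_mul_le_iff₀ (hpos _), mul_one_div, le_div_iff₀ hn']
      refine le_trans ?_ (hlt (n + N)).le
      rw [mul_comm]; gcongr; linarith [N.cast_nonneg (α := ℝ)]
    have hζs : Tendsto (fun n => pl2snd (ζ n)) atTop (𝓝 0) := by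
      refine squeeze_zero_norm' ?_ tendsto_one_div_atTop_nhds_zero_nat
      filter_upwards [eventually_ge_atTop 1] with n hn using hζ2 n hn
    have hζF : ∀ n, ζ n ∈ frechetNC (Mmap E g U 0) (w (n + N)) := fun n =>
      frechetNC_smul (hξ _) (inv_pos.2 (hpos _))
    choose lam hlam hlN using fun n => hmul _ (hw (n + N))
      ((hww _).trans (hN _ (by omega))) _ (hζF n)
    have hζb : ∀ᶠ n in atTop, ‖ζ n‖ ≤ 2 := by
      filter_upwards [eventually_ge_atTop 1] with n hn
      have h1 := hζ2 n hn
      have h2 : (1 : ℝ) / n ≤ 1 := by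
        rw [div_le_one (by exact_mod_cast hn)]; exact_mod_cast hn
      linarith [norm_le_pl2 (ζ n), hζ1 n]
    obtain ⟨n1, hn1⟩ := eventually_atTop.1 hζb
    obtain ⟨⟨ζ0, l⟩, _, ψ, hψ, hl⟩ := ((isCompact_closedBall (0 : PL3 (Euc nx) (Euc nu) (Euc nx)) 2).prod
      (isCompact_closedBall (0 : Euc m) (2 * μ))).tendsto_subseq
      (x := fun n => (ζ (n + n1), lam (n + n1))) fun n => by
        have h1 := hn1 (n + n1) (by omega)
        refine ⟨mem_closedBall_zero_iff.2 h1, mem_closedBall_zero_iff.2 ((hlam _).trans ?_)⟩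
        gcongr
    have hψt : Tendsto (fun n => ψ n + n1) atTop atTop :=
      (tendsto_add_atTop_nat n1).comp hψ.tendsto_atTop
    have hl1 : Tendsto (fun n => ζ (ψ n + n1)) atTop (𝓝 ζ0) := (continuous_fst.tendsto _).comp hl
    have hl2 : Tendsto (fun n => lam (ψ n + n1)) atTop (𝓝 l) := (continuous_snd.tendsto _).comp hl
    have hwt' : Tendsto (fun n => w (ψ n + n1 + N)) atTop (𝓝 w0) :=
      hwt.comp ((tendsto_add_atTop_nat N).comp hψt)
    have hadj : Tendsto (fun n => ζ (ψ n + n1) -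
        ContinuousLinearMap.adjoint (phi' E g' (w (ψ n + n1 + N))) (lam (ψ n + n1))) atTop
        (𝓝 (ζ0 - ContinuousLinearMap.adjoint (phi' E g' w0) l)) := by
      have h1 := ((continuous_of_hasStrictFDerivAt hφ).tendsto w0).comp hwt'
      have h2 : Tendsto (fun n => ContinuousLinearMap.adjoint (phi' E g' (w (ψ n + n1 + N))))
          atTop (𝓝 (ContinuousLinearMap.adjoint (phi' E g' w0))) :=
        ((ContinuousLinearMap.adjoint (𝕜 := ℝ) (E := PL3 (Euc nx) (Euc nu) (Euc nx)) (F := Euc m)).continuous.tendsto _).comp h1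
      exact hl1.sub (tendsto_clm_apply h2 hl2)
    have hlimN := limitingNC_closed_graph (fun n => hlN (ψ n + n1)) hwt' hadj
    obtain ⟨η, hη, hh⟩ := isMultiplier_of_limitingNC hlimN
    have hz0 : pl2snd ζ0 = 0 := tendsto_nhds_unique ((continuous_pl2snd.tendsto _).comp hl1)
      (hζs.comp hψt)
    have hz1 : ‖pl2fst ζ0‖ = 1 := tendsto_nhds_unique
      (((continuous_norm.comp continuous_pl2fst).tendsto _).comp hl1)
      (by simp [Function.comp_def, hζ1])
    have := hW l (pl2fst ζ0) ⟨η, hη, fun dx du dv => by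
      have := hh (pl2 dx (pl2 du dv))
      rw [inner_pl2, hz0, phi'_apply] at this
      simpa using this⟩
    rw [this, norm_zero] at hz1
    exact zero_ne_one hz1
  obtain ⟨n, hn⟩ := hbound
  refine ⟨min ρ (1 / (n + 1)), lt_min hρ (by positivity), n + (n + 1) * μ, by positivity,
    fun w hw hww ξ hξ => ?_⟩
  have h1 := hn w hw (hww.trans_le (min_le_right _ _)) ξ hξ
  obtain ⟨lam, hlam, hlN⟩ := hmul w hw (hww.trans_le (min_le_left _ _)) ξ hξ
  have h0 := norm_nonneg (pl2snd ξ)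
  have h2 := norm_le_pl2 ξ
  have h3 : 0 ≤ (n + 1) * μ := by positivity
  have h4 : (0 : ℝ) ≤ n := n.cast_nonneg
  refine ⟨by nlinarith, lam, ?_, isMultiplier_of_limitingNC hlN⟩
  have h5 : ‖ξ‖ ≤ (n + 1) * ‖pl2snd ξ‖ := by linarith
  nlinarith

theorem exists_normal_bound_of_isCompact (hU : IsClosed U)
    (hg : ∀ z, HasStrictFDerivAt g (g' z) z) {K : Set (PL3 (Euc nx) (Euc nu) (Euc nx))}
    (hK : IsCompact K) (hKM : K ⊆ Mmap E g U 0)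
    (hCQ : ∀ w ∈ K, WBCQ E g' U (pl2fst w) (pl2fst (pl2snd w)) (pl2snd (pl2snd w)) ∧
      Calm (Mmap E g U) 0 w) :
    ∃ ρ > 0, ∃ k ≥ 0, ∀ w0 ∈ K, ∀ w ∈ Mmap E g U 0, ‖w - w0‖ < ρ →
      ∀ ξ ∈ frechetNC (Mmap E g U 0) w,
      ‖pl2fst ξ‖ ≤ k * ‖pl2snd ξ‖ ∧ ∃ lam, ‖lam‖ ≤ k * ‖pl2snd ξ‖ ∧
        IsMultiplier E g' U w ξ lam := by
  refine hK.induction_on (p := fun K => ∃ ρ > 0, ∃ k ≥ 0, ∀ w0 ∈ K, ∀ w ∈ Mmap E g U 0,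
    ‖w - w0‖ < ρ → ∀ ξ ∈ frechetNC (Mmap E g U 0) w,
      ‖pl2fst ξ‖ ≤ k * ‖pl2snd ξ‖ ∧ ∃ lam, ‖lam‖ ≤ k * ‖pl2snd ξ‖ ∧
        IsMultiplier E g' U w ξ lam) ⟨1, one_pos, 0, le_rfl, by simp⟩ ?_ ?_ ?_
  · rintro s t hst ⟨ρ, hρ, k, hk, h⟩
    exact ⟨ρ, hρ, k, hk, fun w0 hw0 => h w0 (hst hw0)⟩
  · rintro s t ⟨ρ, hρ, k, hk, h⟩ ⟨ρ', hρ', k', hk', h'⟩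
    refine ⟨min ρ ρ', lt_min hρ hρ', max k k', le_max_of_le_left hk, ?_⟩
    rintro w0 (hw0 | hw0) w hw hww ξ hξ
    · obtain ⟨h1, lam, h2, h3⟩ := h w0 hw0 w hw (hww.trans_le (min_le_left _ _)) ξ hξ
      have : k * ‖pl2snd ξ‖ ≤ max k k' * ‖pl2snd ξ‖ := by gcongr; exact le_max_left _ _
      exact ⟨h1.trans this, lam, h2.trans this, h3⟩
    · obtain ⟨h1, lam, h2, h3⟩ := h' w0 hw0 w hw (hww.trans_le (min_le_right _ _)) ξ hξ
      have : k' * ‖pl2snd ξ‖ ≤ max k k' * ‖pl2snd ξ‖ := by gcongr; exact le_max_right _ _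
      exact ⟨h1.trans this, lam, h2.trans this, h3⟩
  · intro w0 hw0
    obtain ⟨ρ, hρ, k, hk, h⟩ := exists_normal_bound hU hg (hKM hw0) (hCQ w0 hw0).1 (hCQ w0 hw0).2
    refine ⟨Metric.ball w0 (ρ / 2), mem_nhdsWithin_of_mem_nhds (Metric.ball_mem_nhds _ (by positivity)),
      ρ / 2, by positivity, k, hk, fun w1 hw1 w hw hww => h w hw ?_⟩
    rw [mem_ball_iff_norm] at hw1
    linarith [norm_sub_le_norm_sub_add_norm_sub w w1 w0]

end Dynamics

section Following

variable {X Q : Type} [NormedAddCommGroup X] [InnerProductSpace ℝ X] [FiniteDimensional ℝ X]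
  [NormedAddCommGroup Q] [InnerProductSpace ℝ Q] [FiniteDimensional ℝ Q]

/-- If near `(y,q)` all normals `(r,s)` to `M` satisfy `‖r‖ ≤ k‖s‖`, nearby points `y'` can be
completed to points of `M` with a Hölder estimate. -/
theorem exists_mem_near {M : Set (PL2 X Q)} (hM : IsClosed M) {w : PL2 X Q} (hw : w ∈ M)
    {ρ k : ℝ} (hρ : 0 < ρ) (hk : 0 ≤ k)
    (hN : ∀ z ∈ M, ‖z - w‖ < ρ → ∀ ξ ∈ frechetNC M z, ‖pl2fst ξ‖ ≤ k * ‖pl2snd ξ‖)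
    {y : X} (hy1 : ‖y - pl2fst w‖ < ρ / 4) (hy2 : 16 * ‖y - pl2fst w‖ < ρ ^ 2)
    (hy3 : 4 * (k + 1) ^ 2 * ‖y - pl2fst w‖ < 1) :
    ∃ q, pl2 y q ∈ M ∧ ‖q - pl2snd w‖ ^ 2 ≤ ‖y - pl2fst w‖ := by
  have : ProperSpace (PL2 X Q) := FiniteDimensional.proper_real _
  let H : PL2 X Q → ℝ := fun z => ‖pl2fst z - y‖ + ‖pl2snd z - pl2snd w‖ ^ 2
  have hHc : Continuous H := by fun_prop
  obtain ⟨z, ⟨hzM, hzb⟩, hmin⟩ := ((isCompact_closedBall w (3 * ρ / 4)).inter_left hM).exists_isMinOn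
    ⟨w, hw, Metric.mem_closedBall_self (by positivity)⟩ hHc.continuousOn
  have hHw : H w = ‖y - pl2fst w‖ := by simp [H, norm_sub_rev]
  have hHz : H z ≤ ‖y - pl2fst w‖ := hHw ▸ hmin ⟨hw, Metric.mem_closedBall_self (by positivity)⟩
  simp only [H] at hHz
  have hq : ‖pl2snd z - pl2snd w‖ ^ 2 ≤ ‖y - pl2fst w‖ := by
    linarith [norm_nonneg (pl2fst z - y)]
  have hf : ‖pl2fst z - y‖ ≤ ‖y - pl2fst w‖ := by nlinarith
  have hq' : ‖pl2snd z - pl2snd w‖ < ρ / 4 := by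
    by_contra! hge
    nlinarith
  have hzw : ‖z - w‖ < 3 * ρ / 4 := by
    have h1 := norm_le_pl2 (z - w)
    have h2 := norm_sub_le_norm_sub_add_norm_sub (pl2fst z) y (pl2fst w)
    rw [pl2fst_sub, pl2snd_sub] at h1
    linarith
  suffices h : pl2fst z = y by
    refine ⟨pl2snd z, ?_, hq⟩
    rw [← h]; exact hzM
  by_contra hne
  have hpos : 0 < ‖pl2fst z - y‖ := norm_pos_iff.2 (sub_ne_zero.2 hne)
  set a : X := -(‖pl2fst z - y‖⁻¹ • (pl2fst z - y)) with ha
  have han : ‖a‖ = 1 := by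
    rw [ha, norm_neg, norm_smul, norm_inv, norm_norm, inv_mul_cancel₀ hpos.ne']
  have hnormal : pl2 a (-((2 : ℝ) • (pl2snd z - pl2snd w))) ∈ frechetNC M z := by
    have d0 : HasFDerivAt (fun z : PL2 X Q => pl2fst z - y) (fstCLM X Q) z :=
      (fstCLM X Q).hasFDerivAt.sub_const y
    have d1 := (d0.norm_sq).sqrt (by positivity)
    have d2 : HasFDerivAt (fun z : PL2 X Q => pl2snd z - pl2snd w) (sndCLM X Q) z :=
      (sndCLM X Q).hasFDerivAt.sub_const _
    have d3 := d1.add d2.norm_sq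
    refine frechetNC_of_isMin d3 (sub_pos.2 hzw) (fun z' hz' hzz => ?_) fun v => ?_
    · have hmem : z' ∈ M ∩ Metric.closedBall w (3 * ρ / 4) := by
        refine ⟨hz', ?_⟩
        rw [mem_closedBall_iff_norm]
        linarith [norm_sub_le_norm_sub_add_norm_sub z' z w]
      have := hmin hmem
      simpa [H, Real.sqrt_sq] using this
    · rw [inner_pl2]
      simp only [pl2fst_pl2, pl2snd_pl2, ha, inner_neg_left, real_inner_smul_left]
      simp [Real.sqrt_sq, inner_sub_left]
      field_simp
      ring
  have := hN z hzM (by linarith) _ hnormal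
  simp only [pl2fst_pl2, pl2snd_pl2, norm_neg, norm_smul, han, Real.norm_ofNat] at this
  have h3 : 1 ≤ (2 * k * ‖pl2snd z - pl2snd w‖) ^ 2 := by
    have : 1 ≤ 2 * k * ‖pl2snd z - pl2snd w‖ := by linarith
    nlinarith
  have h4 : (2 * k * ‖pl2snd z - pl2snd w‖) ^ 2 ≤ 4 * (k + 1) ^ 2 * ‖y - pl2fst w‖ := by
    rw [mul_pow, mul_pow]
    have : k ^ 2 ≤ (k + 1) ^ 2 := by nlinarith
    have h0 : 0 ≤ ‖pl2snd z - pl2snd w‖ ^ 2 := by positivity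
    nlinarith [sq_nonneg k]
  linarith

end Following

section MeasureLemmas

theorem integrable_cauchy_limit {T F : Type*} [MeasurableSpace T] {μ : Measure T}
    [NormedAddCommGroup F] [CompleteSpace F] {w : ℕ → T → F} (hw : ∀ n, Integrable (w n) μ)
    (hc : ∀ e > 0, ∃ N, ∀ n ≥ N, ∀ k ≥ n, ∫ t, ‖w n t - w k t‖ ∂μ < e) :
    ∃ l : T → F, Integrable l μ ∧ Tendsto (fun n => ∫ t, ‖w n t - l t‖ ∂μ) atTop (𝓝 0) ∧
      ∃ φ : ℕ → ℕ, StrictMono φ ∧ ∀ᵐ t ∂μ, Tendsto (fun n => w (φ n) t) atTop (𝓝 (l t)) := by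
  have hdist : ∀ n k, dist ((hw n).toL1 (w n)) ((hw k).toL1 (w k)) = ∫ t, ‖w n t - w k t‖ ∂μ := by
    intro n k
    rw [dist_eq_norm, ← Integrable.toL1_sub, L1.norm_of_fun_eq_integral_norm]
    rfl
  have hcau : CauchySeq fun n => (hw n).toL1 (w n) := by
    refine Metric.cauchySeq_iff'.2 fun e he => ?_
    obtain ⟨N, hN⟩ := hc e he
    refine ⟨N, fun n hn => ?_⟩
    rw [dist_comm, hdist]; exact hN N le_rfl n hn
  obtain ⟨l, hl⟩ := cauchySeq_tendsto_of_complete hcau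
  have hli : Integrable l μ := L1.integrable_coeFn l
  have hlim : Tendsto (fun n => ∫ t, ‖w n t - l t‖ ∂μ) atTop (𝓝 0) := by
    have h1 := tendsto_iff_dist_tendsto_zero.1 hl
    refine h1.congr fun n => ?_
    rw [dist_eq_norm, L1.norm_eq_integral_norm]
    refine integral_congr_ae ?_
    filter_upwards [Lp.coeFn_sub ((hw n).toL1 (w n)) l, (hw n).coeFn_toL1] with t h2 h3
    rw [h2, Pi.sub_apply, h3]
  refine ⟨l, hli, hlim, ?_⟩
  have hm : TendstoInMeasure μ w atTop l := by
    refine tendstoInMeasure_of_tendsto_eLpNorm one_ne_zero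
      (fun n => (hw n).aestronglyMeasurable) hli.aestronglyMeasurable ?_
    have h1 : ∀ n, eLpNorm (w n - (l : T → F)) 1 μ = ENNReal.ofReal (∫ t, ‖w n t - l t‖ ∂μ) := fun n => by
      rw [eLpNorm_one_eq_lintegral_enorm]
      exact (ofReal_integral_norm_eq_lintegral_enorm ((hw n).sub hli)).symm
    have h2 := ENNReal.tendsto_ofReal hlim
    rw [ENNReal.ofReal_zero] at h2
    exact h2.congr fun n => (h1 n).symm
  exact hm.exists_seq_tendsto_ae

/-- A function with integrals over small subsets of `A` bounded below quadratically is
nonnegative on `A`. -/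
theorem ae_nonneg_of_quadratic {t0 t1 : ℝ} {A : Set ℝ} {ψ : ℝ → ℝ} {K : ℝ}
    (hA : MeasurableSet A) (hψ : Integrable ψ (volume.restrict (Ioc t0 t1)))
    (h : ∀ B, MeasurableSet B → B ⊆ A → B ⊆ Ioc t0 t1 →
      0 ≤ (∫ t in B, ψ t) + K * (volume.real B) ^ 2) :
    ∀ᵐ t ∂(volume.restrict (Ioc t0 t1)), t ∈ A → 0 ≤ ψ t := by
  obtain ⟨ψ', hψ'm, hψ'⟩ := hψ.aestronglyMeasurable
  have key : ∀ n : ℕ, volume ({t | ψ' t < -(1 / (n + 1 : ℝ))} ∩ A ∩ Ioc t0 t1) = 0 := by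
    intro n
    set D := {t | ψ' t < -(1 / (n + 1 : ℝ))} ∩ A ∩ Ioc t0 t1 with hD
    have hDm : MeasurableSet D :=
      ((hψ'm.measurableSet_lt stronglyMeasurable_const).inter hA).inter measurableSet_Ioc
    by_contra hne
    set h0 : ℝ := 1 / ((n + 1) * (|K| + 1) * 2) with hh0
    have hh : 0 < h0 := by positivity
    have hcover : D = ⋃ k : ℤ, D ∩ Ioc (k • h0) ((k + 1) • h0) := by
      rw [← inter_iUnion, iUnion_Ioc_zsmul hh, inter_univ]
    rw [hcover, measure_iUnion_null_iff, not_forall] at hne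
    obtain ⟨k, hk⟩ := hne
    set B := D ∩ Ioc (k • h0) ((k + 1) • h0)
    have hBm : MeasurableSet B := hDm.inter measurableSet_Ioc
    have hBle : volume B ≤ ENNReal.ofReal h0 := by
      refine (measure_mono inter_subset_right).trans ?_
      rw [Real.volume_Ioc, add_smul, one_smul, add_sub_cancel_left]
    have hBtop : volume B ≠ ⊤ := ne_top_of_le_ne_top ENNReal.ofReal_ne_top hBle
    have hBr : volume.real B ≤ h0 := ENNReal.toReal_le_of_le_ofReal hh.le hBle
    have hBpos : 0 < volume.real B := ENNReal.toReal_pos hk hBtop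
    have hsub : B ⊆ Ioc t0 t1 := fun t ht => ht.1.2
    have h1 := h B hBm (fun t ht => ht.1.1.2) hsub
    have h2 : (∫ t in B, ψ t) ≤ ∫ t in B, -(1 / (n + 1 : ℝ)) := by
      refine setIntegral_mono_on_ae (hψ.mono_measure (Measure.restrict_mono hsub le_rfl))
        (integrableOn_const hBtop) hBm ?_
      have h3 := (ae_restrict_iff' measurableSet_Ioc).1 hψ'
      filter_upwards [h3] with t ht htB
      rw [ht (hsub htB)]
      exact le_of_lt htB.1.1.1
    rw [setIntegral_const, smul_eq_mul] at h2
    have h4 : K * volume.real B ^ 2 ≤ |K| * h0 * volume.real B := by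
      have : K * volume.real B ^ 2 ≤ |K| * volume.real B ^ 2 := by gcongr; exact le_abs_self K
      have h5 : |K| * volume.real B ^ 2 ≤ |K| * (h0 * volume.real B) := by
        rw [pow_two]; gcongr
      linarith
    have h6 : |K| * h0 < 1 / (n + 1) := by
      rw [hh0, mul_one_div, div_lt_div_iff₀ (by positivity) (by positivity)]
      have : (0 : ℝ) < n + 1 := by positivity
      nlinarith [abs_nonneg K]
    nlinarith
  have hall := (measure_iUnion_null_iff).2 key
  rw [ae_restrict_iff' measurableSet_Ioc]
  have h3 := (ae_restrict_iff' measurableSet_Ioc).1 hψ'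
  filter_upwards [h3, measure_eq_zero_iff_ae_notMem.1 hall] with t ht hn htI htA
  rw [ht htI]
  by_contra! hlt
  obtain ⟨n, hnn⟩ := exists_nat_one_div_lt (neg_pos.2 hlt)
  exact hn (mem_iUnion.2 ⟨n, ⟨by rw [mem_ofPred_eq]; linarith, htA⟩, htI⟩)

theorem integral_inner_triangle {X : Type*} [NormedAddCommGroup X] [InnerProductSpace ℝ X]
    [CompleteSpace X] {t0 t1 : ℝ} (ht : t0 ≤ t1)
    {h k : ℝ → X} (hh : IntervalIntegrable h volume t0 t1)
    (hk : IntervalIntegrable k volume t0 t1) :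
    ∫ t in t0..t1, ⟪h t, ∫ s in t0..t, k s⟫ = ∫ s in t0..t1, ⟪∫ t in s..t1, h t, k s⟫ := by
  set μ := volume.restrict (Ioc t0 t1)
  have hh' : Integrable h μ := (intervalIntegrable_iff_integrableOn_Ioc_of_le ht).1 hh
  have hk' : Integrable k μ := (intervalIntegrable_iff_integrableOn_Ioc_of_le ht).1 hk
  rw [intervalIntegral.integral_of_le ht, intervalIntegral.integral_of_le ht]
  have hint : Integrable (fun z : ℝ × ℝ => ⟪h z.1, k z.2⟫) (μ.prod μ) := by
    refine (hh'.norm.mul_prod hk'.norm).mono'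
      (hh'.aestronglyMeasurable.comp_fst.inner hk'.aestronglyMeasurable.comp_snd) ?_
    filter_upwards with z using norm_inner_le_norm _ _
  have hset : MeasurableSet {z : ℝ × ℝ | z.2 ≤ z.1} := measurableSet_le measurable_snd measurable_fst
  have hswap := integral_integral_swap (μ := μ) (ν := μ)
    (f := fun t s => {z : ℝ × ℝ | z.2 ≤ z.1}.indicator (fun z => ⟪h z.1, k z.2⟫) (t, s))
    (hint.indicator hset)
  have e1 : ∀ t ∈ Ioc t0 t1, ⟪h t, ∫ s in t0..t, k s⟫ =
      ∫ s, {z : ℝ × ℝ | z.2 ≤ z.1}.indicator (fun z => ⟪h z.1, k z.2⟫) (t, s) ∂μ := by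
    intro t htt
    have : (fun s => {z : ℝ × ℝ | z.2 ≤ z.1}.indicator (fun z => ⟪h z.1, k z.2⟫) (t, s)) =
        (Iic t).indicator fun s => ⟪h t, k s⟫ := by
      ext s; simp [indicator, mem_Iic]
    rw [this, integral_indicator measurableSet_Iic, Measure.restrict_restrict measurableSet_Iic,
      intervalIntegral.integral_of_le htt.1.le, inter_comm, Ioc_inter_Iic, min_eq_right htt.2,
      integral_inner (hk'.mono_measure (Measure.restrict_mono (Ioc_subset_Ioc_right htt.2) le_rfl))]
  have e2 : ∀ s ∈ Ioc t0 t1, ⟪∫ t in s..t1, h t, k s⟫ =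
      ∫ t, {z : ℝ × ℝ | z.2 ≤ z.1}.indicator (fun z => ⟪h z.1, k z.2⟫) (t, s) ∂μ := by
    intro s hss
    have : (fun t => {z : ℝ × ℝ | z.2 ≤ z.1}.indicator (fun z => ⟪h z.1, k z.2⟫) (t, s)) =
        (Ici s).indicator fun t => ⟪k s, h t⟫ := by
      ext t; simp [indicator, mem_Ici, real_inner_comm]
    have h3 : (Ici s ∩ Ioc t0 t1 : Set ℝ) = Icc s t1 := by
      ext t; simp only [mem_inter_iff, mem_Ici, mem_Ioc, mem_Icc]
      exact ⟨fun h => ⟨h.1, h.2.2⟩, fun h => ⟨h.1, hss.1.trans_le h.1, h.2⟩⟩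
    have h4 : Icc s t1 ⊆ Ioc t0 t1 := fun t h => ⟨hss.1.trans_le h.1, h.2⟩
    rw [this, integral_indicator measurableSet_Ici, Measure.restrict_restrict measurableSet_Ici,
      h3, intervalIntegral.integral_of_le hss.2, ← integral_Icc_eq_integral_Ioc,
      integral_inner (hh'.mono_measure (Measure.restrict_mono h4 le_rfl)), real_inner_comm]
  rw [setIntegral_congr_fun measurableSet_Ioc e1, setIntegral_congr_fun measurableSet_Ioc e2]
  exact hswap

end MeasureLemmas

section Penalised

set_option linter.unusedSectionVars false

variable (X Q : Type) [NormedAddCommGroup X] [InnerProductSpace ℝ X] [FiniteDimensional ℝ X]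
  [NormedAddCommGroup Q] [InnerProductSpace ℝ Q] [FiniteDimensional ℝ Q]

/-- A dynamic optimisation problem in the form `x' = V q`, `(x, q) ∈ M`, together with a
reference process that is a local minimum of radius `ϱ`. -/
structure PenData where
  t0 : ℝ
  t1 : ℝ
  ht : t0 < t1
  V : Q →L[ℝ] X
  hV : ∀ q, ‖V q‖ ≤ ‖q‖
  M : Set (PL2 X Q)
  hM : IsClosed M
  S : Set (PL2 X X)
  hS : IsClosed S
  f : PL2 X X → ℝ
  hf : LocallyLipschitz f
  ε : ℝ
  hε : 0 < ε
  δ : ℝ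
  hδ : 0 < δ
  b : ℝ
  ws : ℝ → PL2 X Q
  hws : StronglyMeasurable ws
  hwsb : ∀ t, ‖ws t‖ ≤ b
  ϱ : ℝ → ℝ
  hϱ : Measurable ϱ
  hδϱ : ∀ t, δ ≤ ϱ t
  hϱb : ∀ t, ϱ t ≤ b
  xs0 : X
  hwsM : ∀ᵐ t ∂(volume.restrict (Ioc t0 t1)), ws t ∈ M
  hrel : ∀ᵐ t ∂(volume.restrict (Ioc t0 t1)),
    xs0 + ∫ s in t0..t, V (pl2snd (ws s)) = pl2fst (ws t)
  hS0 : pl2 xs0 (xs0 + ∫ s in t0..t1, V (pl2snd (ws s))) ∈ S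
  hmin : ∀ (x0 : X) (w : ℝ → PL2 X Q), Integrable w (volume.restrict (Ioc t0 t1)) →
    (∀ᵐ t ∂(volume.restrict (Ioc t0 t1)), w t ∈ M ∧ ‖pl2fst (w t) - pl2fst (ws t)‖ ≤ ε ∧
      ‖pl2snd (w t) - pl2snd (ws t)‖ ≤ ϱ t ∧
      x0 + ∫ s in t0..t, V (pl2snd (w s)) = pl2fst (w t)) →
    pl2 x0 (x0 + ∫ s in t0..t1, V (pl2snd (w s))) ∈ S →
    (∫ t in Ioc t0 t1, ‖w t - ws t‖) ≤ ε →
    f (pl2 xs0 (xs0 + ∫ s in t0..t1, V (pl2snd (ws s)))) ≤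
      f (pl2 x0 (x0 + ∫ s in t0..t1, V (pl2snd (w s))))

/-- A state of the penalised problem: initial point, process and two copies of the end points. -/
structure PState where
  x0 : X
  w : ℝ → PL2 X Q
  c : PL2 X X
  d : PL2 X X

variable {X Q}

namespace PenData

variable (D : PenData X Q)

abbrev μ : Measure ℝ := volume.restrict (Ioc D.t0 D.t1)

def tr (z : PState X Q) (t : ℝ) : X := z.x0 + ∫ s in D.t0..t, D.V (pl2snd (z.w s))

def ends (z : PState X Q) : PL2 X X := pl2 z.x0 (D.tr z D.t1)

def gap (z : PState X Q) (t : ℝ) : X := D.tr z t - pl2fst (z.w t)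

def star : PState X Q :=
  ⟨D.xs0, D.ws, pl2 D.xs0 (D.xs0 + ∫ s in D.t0..D.t1, D.V (pl2snd (D.ws s))),
    pl2 D.xs0 (D.xs0 + ∫ s in D.t0..D.t1, D.V (pl2snd (D.ws s)))⟩

def excess (η : ℝ) (d : PL2 X X) : ℝ := max 0 (D.f d - D.f (D.ends D.star) + η)

def sqPen (η : ℝ) (z : PState X Q) : ℝ :=
  D.excess η z.d ^ 2 + ‖D.ends z - z.c‖ ^ 2 + ‖D.ends z - z.d‖ ^ 2 + ∫ t, ‖D.gap z t‖ ^ 2 ∂D.μ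

def barrier (C N : ℝ) (t : ℝ) (q : Q) : ℝ :=
  C * max 0 (1 - N * (D.ϱ t - ‖q - pl2snd (D.ws t)‖))

def cost (η C N : ℝ) (z : PState X Q) : ℝ :=
  √(D.sqPen η z) + ∫ t, D.barrier C N t (pl2snd (z.w t)) ∂D.μ

def dst (z z' : PState X Q) : ℝ :=
  ‖z.x0 - z'.x0‖ + ∫ t, ‖z.w t - z'.w t‖ ∂D.μ + ‖z.c - z'.c‖ + ‖z.d - z'.d‖

def Adm : Set (PState X Q) :=
  {z | z.c ∈ D.S ∧ Integrable z.w D.μ ∧ ∀ᵐ t ∂D.μ, z.w t ∈ D.M ∧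
    ‖pl2fst (z.w t) - pl2fst (D.ws t)‖ ≤ D.ε ∧ ‖pl2snd (z.w t) - pl2snd (D.ws t)‖ ≤ D.ϱ t}

theorem integrable_snd {w : ℝ → PL2 X Q} (hw : Integrable w D.μ) :
    Integrable (fun s => D.V (pl2snd (w s))) D.μ :=
  (D.V.comp (sndCLM X Q)).integrable_comp hw

theorem intervalIntegrable_snd {w : ℝ → PL2 X Q} (hw : Integrable w D.μ) :
    IntervalIntegrable (fun s => D.V (pl2snd (w s))) volume D.t0 D.t1 :=
  (intervalIntegrable_iff_integrableOn_Ioc_of_le D.ht.le).2 (D.integrable_snd hw)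

theorem norm_primitive_le {k : ℝ → X} {l : ℝ → ℝ} (hl : Integrable l D.μ)
    (hkl : ∀ᵐ t ∂D.μ, ‖k t‖ ≤ l t) {t : ℝ} (htt : t ∈ Icc D.t0 D.t1) :
    ‖∫ s in D.t0..t, k s‖ ≤ ∫ s, l s ∂D.μ := by
  have hsub : Ioc D.t0 t ⊆ Ioc D.t0 D.t1 := Ioc_subset_Ioc_right htt.2
  rw [intervalIntegral.integral_of_le htt.1]
  have hres := ae_restrict_of_ae_restrict_of_subset hsub hkl
  refine (norm_integral_le_of_norm_le (hl.mono_measure (Measure.restrict_mono hsub le_rfl))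
    hres).trans ?_
  refine setIntegral_mono_set hl ?_ hsub.eventuallyLE
  filter_upwards [hkl] with s hs using (norm_nonneg _).trans hs

theorem tr_sub {z z' : PState X Q} (hz : Integrable z.w D.μ) (hz' : Integrable z'.w D.μ)
    {t : ℝ} (htt : t ∈ Icc D.t0 D.t1) :
    D.tr z t - D.tr z' t = z.x0 - z'.x0 + ∫ s in D.t0..t, D.V (pl2snd (z.w s - z'.w s)) := by
  have hsub : Ioc D.t0 t ⊆ Ioc D.t0 D.t1 := Ioc_subset_Ioc_right htt.2
  have h1 := (D.integrable_snd hz).mono_measure (Measure.restrict_mono hsub le_rfl)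
  have h2 := (D.integrable_snd hz').mono_measure (Measure.restrict_mono hsub le_rfl)
  simp only [tr, pl2snd_sub, map_sub]
  rw [intervalIntegral.integral_sub
    ((intervalIntegrable_iff_integrableOn_Ioc_of_le htt.1).2 h1)
    ((intervalIntegrable_iff_integrableOn_Ioc_of_le htt.1).2 h2)]
  abel

theorem norm_tr_sub_le {z z' : PState X Q} (hz : Integrable z.w D.μ) (hz' : Integrable z'.w D.μ)
    {t : ℝ} (htt : t ∈ Icc D.t0 D.t1) :
    ‖D.tr z t - D.tr z' t‖ ≤ ‖z.x0 - z'.x0‖ + ∫ s, ‖z.w s - z'.w s‖ ∂D.μ := by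
  rw [D.tr_sub hz hz' htt]
  refine (norm_add_le _ _).trans (add_le_add le_rfl (D.norm_primitive_le (hz.sub hz').norm ?_ htt))
  filter_upwards with s
  exact (D.hV _).trans (norm_pl2snd_le _)

theorem continuousOn_tr {z : PState X Q} (hz : Integrable z.w D.μ) :
    ContinuousOn (D.tr z) (Icc D.t0 D.t1) := by
  have h := intervalIntegral.continuousOn_primitive_interval' (D.intervalIntegrable_snd hz)
    left_mem_uIcc
  rw [uIcc_of_le D.ht.le] at h
  exact continuousOn_const.add h

theorem aesm_tr {z : PState X Q} (hz : Integrable z.w D.μ) :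
    AEStronglyMeasurable (D.tr z) D.μ :=
  ((D.continuousOn_tr hz).mono Ioc_subset_Icc_self).aestronglyMeasurable measurableSet_Ioc

theorem aesm_gap {z : PState X Q} (hz : Integrable z.w D.μ) :
    AEStronglyMeasurable (D.gap z) D.μ :=
  (D.aesm_tr hz).sub (continuous_pl2fst.comp_aestronglyMeasurable hz.aestronglyMeasurable)

theorem exists_gap_bound {z : PState X Q} (hz : z ∈ D.Adm) :
    ∃ K, 0 ≤ K ∧ ∀ᵐ t ∂D.μ, ‖D.gap z t‖ ≤ K := by
  obtain ⟨B, hB⟩ := (isCompact_Icc (a := D.t0) (b := D.t1)).exists_bound_of_continuousOn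
    (D.continuousOn_tr hz.2.1)
  refine ⟨|B| + (D.b + D.ε), ?_, ?_⟩
  · have := (norm_nonneg _).trans (D.hwsb 0)
    have := D.hε
    positivity
  filter_upwards [hz.2.2, ae_restrict_mem measurableSet_Ioc] with t h1 htt
  have h2 := (hB t (Ioc_subset_Icc_self htt)).trans (le_abs_self B)
  have h3 := (norm_pl2fst_le (D.ws t)).trans (D.hwsb t)
  have h4 := norm_le_insert' (pl2fst (z.w t)) (pl2fst (D.ws t))
  refine (norm_sub_le _ _).trans ?_
  linarith [h1.2.1]

theorem integrable_gap_sq {z : PState X Q} (hz : z ∈ D.Adm) :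
    Integrable (fun t => ‖D.gap z t‖ ^ 2) D.μ := by
  obtain ⟨K, -, hK⟩ := D.exists_gap_bound hz
  refine Integrable.of_bound ((D.aesm_gap hz.2.1).norm.pow 2) (K ^ 2) ?_
  filter_upwards [hK] with t h
  rw [Real.norm_of_nonneg (by positivity)]
  gcongr

theorem norm_gap_sub_le {z z' : PState X Q} (hz : Integrable z.w D.μ) (hz' : Integrable z'.w D.μ)
    {t : ℝ} (htt : t ∈ Icc D.t0 D.t1) :
    ‖D.gap z t - D.gap z' t‖ ≤ D.dst z z' + ‖z.w t - z'.w t‖ := by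
  have h1 := D.norm_tr_sub_le hz hz' htt
  have h2 : ‖pl2fst (z.w t) - pl2fst (z'.w t)‖ ≤ ‖z.w t - z'.w t‖ := by
    rw [← pl2fst_sub]; exact norm_pl2fst_le _
  have h3 : D.gap z t - D.gap z' t =
    (D.tr z t - D.tr z' t) - (pl2fst (z.w t) - pl2fst (z'.w t)) := by simp only [gap]; abel
  rw [h3, dst]
  refine (norm_sub_le _ _).trans ?_
  have := norm_nonneg (z.c - z'.c)
  have := norm_nonneg (z.d - z'.d)
  linarith

theorem dst_nonneg (z z' : PState X Q) : 0 ≤ D.dst z z' := by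
  have : 0 ≤ ∫ t, ‖z.w t - z'.w t‖ ∂D.μ := integral_nonneg fun _ => norm_nonneg _
  unfold dst; positivity

theorem dst_self (z : PState X Q) : D.dst z z = 0 := by simp [dst]

theorem dst_triangle {z z' z'' : PState X Q} (hz : Integrable z.w D.μ)
    (hz' : Integrable z'.w D.μ) (hz'' : Integrable z''.w D.μ) :
    D.dst z z'' ≤ D.dst z z' + D.dst z' z'' := by
  have h1 : ∫ t, ‖z.w t - z''.w t‖ ∂D.μ ≤
      ∫ t, ‖z.w t - z'.w t‖ ∂D.μ + ∫ t, ‖z'.w t - z''.w t‖ ∂D.μ := by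
    have h0 := integral_add (hz.sub hz').norm (hz'.sub hz'').norm
    simp only [Pi.sub_apply] at h0
    rw [← h0]
    exact integral_mono (hz.sub hz'').norm ((hz.sub hz').norm.add (hz'.sub hz'').norm)
      fun t => norm_sub_le_norm_sub_add_norm_sub _ _ _
  have h2 := norm_sub_le_norm_sub_add_norm_sub z.x0 z'.x0 z''.x0
  have h3 := norm_sub_le_norm_sub_add_norm_sub z.c z'.c z''.c
  have h4 := norm_sub_le_norm_sub_add_norm_sub z.d z'.d z''.d
  unfold dst; linarith

theorem integral_norm_le_dst (z z' : PState X Q) :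
    ∫ t, ‖z.w t - z'.w t‖ ∂D.μ ≤ D.dst z z' := by
  unfold dst
  have := norm_nonneg (z.c - z'.c)
  have := norm_nonneg (z.d - z'.d)
  have := norm_nonneg (z.x0 - z'.x0)
  linarith

theorem barrier_nonneg {C N : ℝ} (hC : 0 ≤ C) (t : ℝ) (q : Q) : 0 ≤ D.barrier C N t q :=
  mul_nonneg hC (le_max_left _ _)

theorem abs_barrier_sub_le {C N : ℝ} (hC : 0 ≤ C) (hN : 0 ≤ N) (t : ℝ) (q q' : Q) :
    |D.barrier C N t q - D.barrier C N t q'| ≤ C * N * ‖q - q'‖ := by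
  rw [barrier, barrier, ← mul_sub, abs_mul, abs_of_nonneg hC, mul_assoc]
  gcongr
  refine (abs_max_sub_max_le_max _ _ _ _).trans ?_
  rw [sub_self, abs_zero]
  refine max_le (by positivity) ?_
  have : 1 - N * (D.ϱ t - ‖q - pl2snd (D.ws t)‖) - (1 - N * (D.ϱ t - ‖q' - pl2snd (D.ws t)‖))
    = N * (‖q - pl2snd (D.ws t)‖ - ‖q' - pl2snd (D.ws t)‖) := by ring
  rw [this, abs_mul, abs_of_nonneg hN]
  gcongr
  have h := abs_norm_sub_norm_le (q - pl2snd (D.ws t)) (q' - pl2snd (D.ws t))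
  rwa [sub_sub_sub_cancel_right] at h

theorem aesm_barrier (C N : ℝ) {w : ℝ → PL2 X Q} (hw : AEStronglyMeasurable w D.μ) :
    AEStronglyMeasurable (fun t => D.barrier C N t (pl2snd (w t))) D.μ := by
  have h1 : AEStronglyMeasurable (fun t => D.ϱ t) D.μ := D.hϱ.aestronglyMeasurable
  have h2 : AEStronglyMeasurable (fun t => ‖pl2snd (w t) - pl2snd (D.ws t)‖) D.μ :=
    ((continuous_pl2snd.comp_aestronglyMeasurable hw).sub
      (continuous_pl2snd.comp_aestronglyMeasurable D.hws.aestronglyMeasurable)).norm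
  have hc : Continuous fun s : ℝ => C * max 0 (1 - N * s) := by fun_prop
  exact hc.comp_aestronglyMeasurable (h1.sub h2)

theorem integrable_barrier {C N : ℝ} (hC : 0 ≤ C) (hN : 0 ≤ N) {w : ℝ → PL2 X Q}
    (hw : Integrable w D.μ) :
    Integrable (fun t => D.barrier C N t (pl2snd (w t))) D.μ := by
  have hint : Integrable (fun t => C * (1 + N * ‖w t - D.ws t‖)) D.μ := by
    have h0 : Integrable D.ws D.μ := Integrable.of_bound D.hws.aestronglyMeasurable D.b
      (Eventually.of_forall D.hwsb)
    exact ((integrable_const _).add ((hw.sub h0).norm.const_mul N)).const_mul C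
  refine hint.mono' (D.aesm_barrier C N hw.aestronglyMeasurable) ?_
  filter_upwards with t
  rw [Real.norm_of_nonneg (D.barrier_nonneg hC t _), barrier]
  gcongr
  have h1 : ‖pl2snd (w t) - pl2snd (D.ws t)‖ ≤ ‖w t - D.ws t‖ := by
    rw [← pl2snd_sub]; exact norm_pl2snd_le _
  have h2 := D.hδϱ t
  have h3 := D.hδ
  refine max_le (by positivity) ?_
  have : N * ‖pl2snd (w t) - pl2snd (D.ws t)‖ ≤ N * ‖w t - D.ws t‖ := by gcongr
  have : 0 ≤ N * D.ϱ t := mul_nonneg hN (h3.le.trans h2)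
  linarith

end PenData

end Penalised

section Penalised

set_option linter.unusedSectionVars false

variable {X Q : Type} [NormedAddCommGroup X] [InnerProductSpace ℝ X] [FiniteDimensional ℝ X]
  [NormedAddCommGroup Q] [InnerProductSpace ℝ Q] [FiniteDimensional ℝ Q]

namespace PenData

variable (D : PenData X Q)

theorem b_nonneg : 0 ≤ D.b := (norm_nonneg _).trans (D.hwsb 0)

theorem norm_sub_ws_le {z : PState X Q} (hz : z ∈ D.Adm) :
    ∀ᵐ t ∂D.μ, ‖z.w t - D.ws t‖ ≤ D.ε + D.b := by
  filter_upwards [hz.2.2] with t h1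
  refine (norm_le_pl2 _).trans ?_
  rw [pl2fst_sub, pl2snd_sub]
  linarith [h1.2.1, h1.2.2, D.hϱb t]

theorem norm_sub_le_of_adm {z z' : PState X Q} (hz : z ∈ D.Adm) (hz' : z' ∈ D.Adm) :
    ∀ᵐ t ∂D.μ, ‖z.w t - z'.w t‖ ≤ 2 * (D.ε + D.b) := by
  filter_upwards [D.norm_sub_ws_le hz, D.norm_sub_ws_le hz'] with t h1 h2
  have := norm_sub_le_norm_sub_add_norm_sub (z.w t) (D.ws t) (z'.w t)
  rw [norm_sub_rev (z'.w t)] at h2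
  linarith

theorem abs_gap_sq_sub_le {z z' : PState X Q} (hz : z ∈ D.Adm) (hz' : z' ∈ D.Adm) {K : ℝ}
    (hK : ∀ᵐ t ∂D.μ, ‖D.gap z' t‖ ≤ K) :
    |∫ t, ‖D.gap z t‖ ^ 2 ∂D.μ - ∫ t, ‖D.gap z' t‖ ^ 2 ∂D.μ| ≤
      (D.dst z z' + 2 * (D.ε + D.b) + 2 * K) * ((D.t1 - D.t0 + 1) * D.dst z z') := by
  have hint : Integrable (fun t => (D.dst z z' + 2 * (D.ε + D.b) + 2 * K) *
      (D.dst z z' + ‖z.w t - z'.w t‖)) D.μ :=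
    ((integrable_const _).add (hz.2.1.sub hz'.2.1).norm).const_mul _
  have hd := D.dst_nonneg z z'
  rw [← integral_sub (D.integrable_gap_sq hz) (D.integrable_gap_sq hz'), ← Real.norm_eq_abs]
  refine (norm_integral_le_of_norm_le hint ?_).trans ?_
  · filter_upwards [hK, D.norm_sub_le_of_adm hz hz', ae_restrict_mem measurableSet_Ioc]
      with t h1 h2 htt
    have h3 := D.norm_gap_sub_le hz.2.1 hz'.2.1 (Ioc_subset_Icc_self htt)
    have h4 : ‖D.gap z t‖ ^ 2 - ‖D.gap z' t‖ ^ 2 =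
      (‖D.gap z t‖ - ‖D.gap z' t‖) * (‖D.gap z t‖ + ‖D.gap z' t‖) := by ring
    have h5 := abs_norm_sub_norm_le (D.gap z t) (D.gap z' t)
    rw [h4, norm_mul, mul_comm, Real.norm_eq_abs, Real.norm_eq_abs,
      abs_of_nonneg (add_nonneg (norm_nonneg _) (norm_nonneg _))]
    have h6 := le_abs_self (‖D.gap z t‖ - ‖D.gap z' t‖)
    have := norm_nonneg (D.gap z' t)
    have := D.b_nonneg
    have := D.hε
    refine mul_le_mul ?_ (h5.trans h3) (abs_nonneg _) ?_
    · linarith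
    · linarith [(norm_nonneg _).trans h2]
  · have h0 := integral_add (integrable_const (D.dst z z')) (hz.2.1.sub hz'.2.1).norm
    simp only [Pi.sub_apply] at h0
    rw [integral_const_mul, h0, integral_const, measureReal_restrict_apply_univ, Real.volume_real_Ioc_of_le D.ht.le,
      smul_eq_mul]
    have h := D.integral_norm_le_dst z z'
    have hμ : D.μ ≠ 0 := fun h0 => by
      have := congrArg (fun ν : Measure ℝ => ν univ) h0
      simp [Real.volume_Ioc] at this
      exact this.not_gt D.ht
    have hne : (ae D.μ).NeBot := ae_neBot.2 hμ
    obtain ⟨t, hKt⟩ := hK.exists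
    have := (norm_nonneg _).trans hKt
    have := D.b_nonneg
    have := D.hε
    gcongr
    linarith

theorem continuous_excess (η : ℝ) : Continuous (D.excess η) := by
  have := D.hf.continuous
  unfold excess
  fun_prop

theorem ends_sub_le {z z' : PState X Q} (hz : Integrable z.w D.μ) (hz' : Integrable z'.w D.μ) :
    ‖D.ends z - D.ends z'‖ ≤ 2 * D.dst z z' := by
  refine (norm_le_pl2 _).trans ?_
  have h := D.norm_tr_sub_le hz hz' (right_mem_Icc.2 D.ht.le)
  have h1 : ‖z.x0 - z'.x0‖ ≤ D.dst z z' := by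
    have : 0 ≤ ∫ t, ‖z.w t - z'.w t‖ ∂D.μ := integral_nonneg fun _ => norm_nonneg _
    unfold dst
    have := norm_nonneg (z.c - z'.c)
    have := norm_nonneg (z.d - z'.d)
    linarith
  have h2 : ‖z.x0 - z'.x0‖ + ∫ s, ‖z.w s - z'.w s‖ ∂D.μ ≤ D.dst z z' := by
    unfold dst
    have := norm_nonneg (z.c - z'.c)
    have := norm_nonneg (z.d - z'.d)
    linarith
  simp only [ends, pl2fst_sub, pl2snd_sub, pl2fst_pl2, pl2snd_pl2]
  linarith

theorem tendsto_of_dst {z : ℕ → PState X Q} {l : PState X Q} (hz : ∀ n, z n ∈ D.Adm)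
    (hl : l ∈ D.Adm) (h : Tendsto (fun n => D.dst (z n) l) atTop (𝓝 0)) (η : ℝ) {C N : ℝ}
    (hC : 0 ≤ C) (hN : 0 ≤ N) :
    Tendsto (fun n => D.cost η C N (z n)) atTop (𝓝 (D.cost η C N l)) := by
  have hc : Tendsto (fun n => (z n).c) atTop (𝓝 l.c) := by
    refine tendsto_iff_norm_sub_tendsto_zero.2 (squeeze_zero (fun _ => norm_nonneg _) ?_ h)
    intro n
    have : 0 ≤ ∫ t, ‖(z n).w t - l.w t‖ ∂D.μ := integral_nonneg fun _ => norm_nonneg _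
    have := norm_nonneg ((z n).x0 - l.x0)
    have := norm_nonneg ((z n).d - l.d)
    unfold dst; linarith
  have hd : Tendsto (fun n => (z n).d) atTop (𝓝 l.d) := by
    refine tendsto_iff_norm_sub_tendsto_zero.2 (squeeze_zero (fun _ => norm_nonneg _) ?_ h)
    intro n
    have : 0 ≤ ∫ t, ‖(z n).w t - l.w t‖ ∂D.μ := integral_nonneg fun _ => norm_nonneg _
    have := norm_nonneg ((z n).x0 - l.x0)
    have := norm_nonneg ((z n).c - l.c)
    unfold dst; linarith
  have he : Tendsto (fun n => D.ends (z n)) atTop (𝓝 (D.ends l)) := by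
    refine tendsto_iff_norm_sub_tendsto_zero.2 (squeeze_zero (fun _ => norm_nonneg _)
      (fun n => D.ends_sub_le (hz n).2.1 hl.2.1) ?_)
    simpa using h.const_mul 2
  have hg : Tendsto (fun n => ∫ t, ‖D.gap (z n) t‖ ^ 2 ∂D.μ) atTop
      (𝓝 (∫ t, ‖D.gap l t‖ ^ 2 ∂D.μ)) := by
    obtain ⟨K, -, hK⟩ := D.exists_gap_bound hl
    refine tendsto_iff_norm_sub_tendsto_zero.2 (squeeze_zero (fun _ => norm_nonneg _)
      (fun n => D.abs_gap_sq_sub_le (hz n) hl hK) ?_)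
    have := ((h.add_const (2 * (D.ε + D.b))).add_const (2 * K)).mul
      (h.const_mul (D.t1 - D.t0 + 1))
    simpa using this
  have hb : Tendsto (fun n => ∫ t, D.barrier C N t (pl2snd ((z n).w t)) ∂D.μ) atTop
      (𝓝 (∫ t, D.barrier C N t (pl2snd (l.w t)) ∂D.μ)) := by
    refine tendsto_iff_norm_sub_tendsto_zero.2 (squeeze_zero (fun _ => norm_nonneg _)
      (g := fun n => C * N * D.dst (z n) l) (fun n => ?_) ?_)
    · rw [← integral_sub (D.integrable_barrier hC hN (hz n).2.1) (D.integrable_barrier hC hN hl.2.1)]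
      refine (norm_integral_le_of_norm_le (((hz n).2.1.sub hl.2.1).norm.const_mul (C * N)) ?_).trans ?_
      · filter_upwards with t
        refine (D.abs_barrier_sub_le hC hN t _ _).trans ?_
        gcongr
        rw [← pl2snd_sub]; exact norm_pl2snd_le _
      · rw [integral_const_mul]
        gcongr
        exact D.integral_norm_le_dst _ _
    · simpa using h.const_mul (C * N)
  have hx := ((D.continuous_excess η).tendsto l.d).comp hd
  exact ((((hx.pow 2).add ((he.sub hc).norm.pow 2)).add ((he.sub hd).norm.pow 2)).add hg).sqrt.add hb

theorem exists_limit {z : ℕ → PState X Q} (hz : ∀ n, z n ∈ D.Adm)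
    (hc : ∀ e > 0, ∃ N, ∀ n ≥ N, ∀ k ≥ n, D.dst (z n) (z k) < e) :
    ∃ l ∈ D.Adm, Tendsto (fun n => D.dst (z n) l) atTop (𝓝 0) := by
  have hlim : ∀ {Y : Type} [NormedAddCommGroup Y] [CompleteSpace Y] (φ : PState X Q → Y),
      (∀ n k, ‖φ (z n) - φ (z k)‖ ≤ D.dst (z n) (z k)) →
      ∃ y, Tendsto (fun n => φ (z n)) atTop (𝓝 y) := by
    intro Y _ _ φ hφ
    refine cauchySeq_tendsto_of_complete (Metric.cauchySeq_iff'.2 fun e he => ?_)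
    obtain ⟨N, hN⟩ := hc e he
    refine ⟨N, fun n hn => ?_⟩
    rw [dist_comm, dist_eq_norm]
    exact (hφ N n).trans_lt (hN N le_rfl n hn)
  have hi : ∀ n k, 0 ≤ ∫ t, ‖(z n).w t - (z k).w t‖ ∂D.μ :=
    fun n k => integral_nonneg fun _ => norm_nonneg _
  obtain ⟨x0, hx0⟩ := hlim PState.x0 fun n k => by
    have := hi n k
    have := norm_nonneg ((z n).c - (z k).c)
    have := norm_nonneg ((z n).d - (z k).d)
    unfold dst; linarith
  obtain ⟨c, hcc⟩ := hlim PState.c fun n k => by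
    have := hi n k
    have := norm_nonneg ((z n).x0 - (z k).x0)
    have := norm_nonneg ((z n).d - (z k).d)
    unfold dst; linarith
  obtain ⟨d, hd⟩ := hlim PState.d fun n k => by
    have := hi n k
    have := norm_nonneg ((z n).x0 - (z k).x0)
    have := norm_nonneg ((z n).c - (z k).c)
    unfold dst; linarith
  obtain ⟨w, hw, hwt, φ, hφ, hae⟩ := integrable_cauchy_limit (fun n => (hz n).2.1) fun e he => by
    obtain ⟨N, hN⟩ := hc e he
    exact ⟨N, fun n hn k hk => (D.integral_norm_le_dst _ _).trans_lt (hN n hn k hk)⟩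
  refine ⟨⟨x0, w, c, d⟩, ⟨?_, hw, ?_⟩, ?_⟩
  · exact D.hS.mem_of_tendsto hcc (Eventually.of_forall fun n => (hz n).1)
  · filter_upwards [ae_all_iff.2 fun n => (hz n).2.2, hae] with t h1 h2
    have hf := (continuous_pl2fst.tendsto _).comp h2
    have hs := (continuous_pl2snd.tendsto _).comp h2
    exact ⟨D.hM.mem_of_tendsto h2 (Eventually.of_forall fun n => (h1 _).1),
      le_of_tendsto (hf.sub_const _).norm (Eventually.of_forall fun n => (h1 _).2.1),
      le_of_tendsto (hs.sub_const _).norm (Eventually.of_forall fun n => (h1 _).2.2)⟩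
  · have h1 := tendsto_iff_norm_sub_tendsto_zero.1 hx0
    have h2 := tendsto_iff_norm_sub_tendsto_zero.1 hcc
    have h3 := tendsto_iff_norm_sub_tendsto_zero.1 hd
    simpa [dst] using ((h1.add hwt).add h2).add h3

theorem integrable_ws : Integrable D.ws D.μ :=
  Integrable.of_bound D.hws.aestronglyMeasurable D.b (Eventually.of_forall D.hwsb)

theorem star_mem : D.star ∈ D.Adm := by
  refine ⟨D.hS0, D.integrable_ws, ?_⟩
  filter_upwards [D.hwsM] with t h
  refine ⟨h, ?_, ?_⟩
  · simpa [star] using D.hε.le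
  · simpa [star] using D.hδ.le.trans (D.hδϱ t)

theorem cost_star {η C N : ℝ} (hη : 0 ≤ η) (hN : 1 ≤ N * D.δ) : D.cost η C N D.star = η := by
  have hN0 : 0 ≤ N := by
    by_contra! h
    nlinarith [D.hδ]
  have h1 : ∫ t, ‖D.gap D.star t‖ ^ 2 ∂D.μ = 0 := by
    rw [← integral_zero ℝ ℝ (μ := D.μ)]
    refine integral_congr_ae ?_
    filter_upwards [D.hrel] with t h
    have : D.gap D.star t = 0 := sub_eq_zero.2 h
    simp [this]
  have h2 : ∫ t, D.barrier C N t (pl2snd (D.star.w t)) ∂D.μ = 0 := by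
    rw [← integral_zero ℝ ℝ (μ := D.μ)]
    refine integral_congr_ae ?_
    filter_upwards with t
    have : 1 - N * D.ϱ t ≤ 0 := by
      have := mul_le_mul_of_nonneg_left (D.hδϱ t) hN0
      linarith
    simp [barrier, star, this]
  rw [cost, h2, sqPen, h1]
  have h3 : D.ends D.star = D.star.c := rfl
  have h4 : D.ends D.star = D.star.d := rfl
  rw [← h3, ← h4]
  simp [excess, hη, Real.sqrt_sq hη]

theorem sqPen_nonneg (η : ℝ) (z : PState X Q) : 0 ≤ D.sqPen η z := by
  have : 0 ≤ ∫ t, ‖D.gap z t‖ ^ 2 ∂D.μ := integral_nonneg fun _ => by positivity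
  unfold sqPen; positivity

/-- Ekeland's principle for the penalised problem. -/
theorem exists_ekeland {α C N : ℝ} (hα : 0 < α) (hαε : α ≤ D.ε) (hC : 0 ≤ C)
    (hN : 1 ≤ N * D.δ) :
    ∃ z ∈ D.Adm, D.dst D.star z ≤ α ∧ 0 < D.sqPen (α ^ 2) z ∧
      ∀ z' ∈ D.Adm, D.cost (α ^ 2) C N z ≤ D.cost (α ^ 2) C N z' + α * D.dst z z' := by
  have hN0 : 0 ≤ N := by
    by_contra! h
    nlinarith [D.hδ]
  have hF0 : ∀ z, 0 ≤ D.cost (α ^ 2) C N z := fun z =>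
    add_nonneg (Real.sqrt_nonneg _) (integral_nonneg fun t => D.barrier_nonneg hC _ _)
  obtain ⟨⟨z, hz⟩, -, h1, h2⟩ := ekeland (Z := {z // z ∈ D.Adm}) univ (fun z z' => D.dst z.1 z'.1)
    (fun z => D.cost (α ^ 2) C N z.1) (fun _ _ => D.dst_nonneg _ _) (fun _ => D.dst_self _)
    (fun x y z => D.dst_triangle x.2.2.1 y.2.2.1 z.2.2.1) (fun z _ => hF0 z.1)
    (fun z _ hcz => by
      obtain ⟨l, hl, hlt⟩ := D.exists_limit (fun n => (z n).2) hcz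
      exact ⟨⟨l, hl⟩, mem_univ _, hlt, D.tendsto_of_dst (fun n => (z n).2) hl hlt _ hC hN0⟩)
    (z0 := ⟨D.star, D.star_mem⟩) (mem_univ _) hα
  simp only [] at h1
  rw [D.cost_star (by positivity) hN] at h1
  have hdst : D.dst D.star z ≤ α := by
    have := hF0 z
    by_contra! h
    nlinarith
  refine ⟨z, hz, hdst, ?_, fun z' hz' => h2 ⟨z', hz'⟩ (mem_univ _)⟩
  by_contra hpos
  have hG := le_antisymm (not_lt.1 hpos) (D.sqPen_nonneg _ z)
  have hi : 0 ≤ ∫ t, ‖D.gap z t‖ ^ 2 ∂D.μ := integral_nonneg fun _ => by positivity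
  unfold sqPen at hG
  have q1 := sq_nonneg (D.excess (α ^ 2) z.d)
  have q2 := sq_nonneg ‖D.ends z - z.c‖
  have q3 := sq_nonneg ‖D.ends z - z.d‖
  have e1 : D.excess (α ^ 2) z.d = 0 := pow_eq_zero_iff two_ne_zero |>.1 (by linarith)
  have e2 : D.ends z = z.c := sub_eq_zero.1 (norm_eq_zero.1 (pow_eq_zero_iff two_ne_zero |>.1
    (by linarith)))
  have e3 : D.ends z = z.d := sub_eq_zero.1 (norm_eq_zero.1 (pow_eq_zero_iff two_ne_zero |>.1
    (by linarith)))
  have e4 : ∫ t, ‖D.gap z t‖ ^ 2 ∂D.μ = 0 := by linarith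
  rw [integral_eq_zero_iff_of_nonneg (fun _ => by positivity) (D.integrable_gap_sq hz)] at e4
  have h3 : D.f (D.ends D.star) ≤ D.f (D.ends z) := by
    refine D.hmin z.x0 z.w hz.2.1 ?_ ?_ ?_
    · filter_upwards [hz.2.2, e4] with t h5 h6
      refine ⟨h5.1, h5.2.1, h5.2.2, ?_⟩
      have : D.gap z t = 0 := norm_eq_zero.1 (pow_eq_zero_iff two_ne_zero |>.1 h6)
      exact sub_eq_zero.1 this
    · have := hz.1
      rwa [← e2] at this
    · refine le_trans ?_ ((D.integral_norm_le_dst D.star z).trans (hdst.trans hαε))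
      refine le_of_eq (integral_congr_ae (Eventually.of_forall fun t => ?_))
      exact norm_sub_rev _ _
  have h4 : D.f (D.ends z) - D.f (D.ends D.star) + α ^ 2 ≤ 0 := by
    have := le_max_right 0 (D.f z.d - D.f (D.ends D.star) + α ^ 2)
    rw [e3]
    exact this.trans e1.le
  nlinarith

end PenData

end Penalised

section Penalised

set_option linter.unusedSectionVars false

variable {X Q : Type} [NormedAddCommGroup X] [InnerProductSpace ℝ X] [FiniteDimensional ℝ X]
  [NormedAddCommGroup Q] [InnerProductSpace ℝ Q] [FiniteDimensional ℝ Q]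

theorem norm_le_of_forall_inner {Y : Type*} [NormedAddCommGroup Y] [InnerProductSpace ℝ Y]
    {a : Y} {α K : ℝ} (hα : 0 ≤ α) (h : ∀ v, 0 ≤ ⟪a, v⟫ + α * ‖v‖ + K * ‖v‖ ^ 2) : ‖a‖ ≤ α := by
  by_contra! hlt
  have ha : 0 < ‖a‖ := hα.trans_lt hlt
  set s : ℝ := (‖a‖ - α) / (2 * (|K| + 1) * ‖a‖) with hs
  have hs0 : 0 < s := div_pos (by linarith) (by positivity)
  have h1 := h (-s • a)
  rw [inner_smul_right, real_inner_self_eq_norm_sq, norm_smul, norm_neg,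
    Real.norm_of_nonneg hs0.le] at h1
  have h2 : s * (2 * (|K| + 1) * ‖a‖) = ‖a‖ - α := div_mul_cancel₀ _ (by positivity)
  have h3 : K * (s * ‖a‖) ^ 2 ≤ |K| * (s * ‖a‖) ^ 2 := by gcongr; exact le_abs_self K
  have h4 : 0 < s * ‖a‖ := by positivity
  have h5 : 0 ≤ (s * ‖a‖) * (|K| * (s * ‖a‖) - (‖a‖ - α)) := by linarith
  have h6 : 0 ≤ |K| * (s * ‖a‖) - (‖a‖ - α) := by
    by_contra! hneg
    nlinarith
  nlinarith [abs_nonneg K]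

namespace PenData

variable (D : PenData X Q)

/-- The adjoint variable attached to end point multipliers and a density. -/
def adj (a : X) (r : ℝ → X) (s : ℝ) : X := -(a + ∫ t in s..D.t1, r t)

theorem continuousOn_adj (a : X) {r : ℝ → X} (hr : Integrable r D.μ) :
    ContinuousOn (D.adj a r) (Icc D.t0 D.t1) := by
  have h := intervalIntegral.continuousOn_primitive_interval_left (f := r) (μ := volume)
    (a := D.t0) (b := D.t1) (by
      rw [uIcc_of_le D.ht.le, integrableOn_Icc_iff_integrableOn_Ioc]; exact hr)
  rw [uIcc_of_le D.ht.le] at h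
  exact (continuousOn_const.add h).neg

theorem integrable_gap {z : PState X Q} (hz : z ∈ D.Adm) : Integrable (D.gap z) D.μ := by
  obtain ⟨K, -, hK⟩ := D.exists_gap_bound hz
  exact Integrable.of_bound (D.aesm_gap hz.2.1) K hK

theorem basic_inequality {η α C N : ℝ} {z z' : PState X Q} (hpos : 0 < D.sqPen η z)
    (h : D.cost η C N z ≤ D.cost η C N z' + α * D.dst z z') :
    0 ≤ (D.sqPen η z' - D.sqPen η z) / (2 * √(D.sqPen η z)) +
      (∫ t, D.barrier C N t (pl2snd (z'.w t)) ∂D.μ - ∫ t, D.barrier C N t (pl2snd (z.w t)) ∂D.μ) +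
      α * D.dst z z' := by
  have h1 := sqrt_le_add_div (D.sqPen_nonneg η z') hpos
  unfold cost at h
  linarith

section Needle

variable {D} {z : PState X Q} {w0 : PL2 X Q} {B : Set ℝ}

open Classical in
/-- Replace the process by the constant `w0` on `B`. -/
def needle (z : PState X Q) (w0 : PL2 X Q) (B : Set ℝ) : PState X Q :=
  ⟨z.x0, B.piecewise (fun _ => w0) z.w, z.c, z.d⟩

theorem needle_mem (hz : z ∈ D.Adm) (hw0 : w0 ∈ D.M) (hB : MeasurableSet B)
    (hBA : ∀ t ∈ B, ‖pl2fst w0 - pl2fst (D.ws t)‖ ≤ D.ε ∧ ‖pl2snd w0 - pl2snd (D.ws t)‖ ≤ D.ϱ t) :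
    needle z w0 B ∈ D.Adm := by
  classical
  refine ⟨hz.1, ?_, ?_⟩
  · exact Integrable.piecewise hB (integrable_const _).integrableOn hz.2.1.integrableOn
  · filter_upwards [hz.2.2] with t h
    by_cases htB : t ∈ B
    · simp only [needle, piecewise_eq_of_mem _ _ _ htB]
      exact ⟨hw0, hBA t htB⟩
    · simp only [needle, piecewise_eq_of_notMem _ _ _ htB]
      exact h

theorem needle_comp_sub {F : Type*} [AddCommGroup F] (G : ℝ → PL2 X Q → F) (t : ℝ) :
    G t ((needle z w0 B).w t) - G t (z.w t) =
      B.indicator (fun t => G t w0 - G t (z.w t)) t := by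
  classical
  by_cases htB : t ∈ B
  · simp [needle, htB]
  · simp [needle, htB]

theorem integral_indicator_mu {F : Type*} [NormedAddCommGroup F] [NormedSpace ℝ F]
    (hB : MeasurableSet B) (hBs : B ⊆ Ioc D.t0 D.t1) (k : ℝ → F) :
    ∫ t, B.indicator k t ∂D.μ = ∫ t in B, k t := by
  rw [integral_indicator hB, Measure.restrict_restrict hB, inter_eq_left.2 hBs]

theorem needle_sqPen_le (hz : z ∈ D.Adm) (hw0 : w0 ∈ D.M) (hB : MeasurableSet B)
    (hBs : B ⊆ Ioc D.t0 D.t1)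
    (hBA : ∀ t ∈ B, ‖pl2fst w0 - pl2fst (D.ws t)‖ ≤ D.ε ∧ ‖pl2snd w0 - pl2snd (D.ws t)‖ ≤ D.ϱ t)
    {a : X} (ha : a = pl2snd (D.ends z - z.c) + pl2snd (D.ends z - z.d)) (η : ℝ) :
    D.sqPen η (needle z w0 B) - D.sqPen η z ≤
      (∫ t in B, (‖D.tr z t - pl2fst w0‖ ^ 2 - ‖D.gap z t‖ ^ 2) -
        2 * ⟪D.adj a (D.gap z) t, D.V (pl2snd w0 - pl2snd (z.w t))⟫) +
      ((2 + (D.t1 - D.t0)) * (2 * (D.ε + D.b)) ^ 2 + 4 * D.ε * (2 * (D.ε + D.b))) *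
        volume.real B ^ 2 := by
  have hz' := needle_mem hz hw0 hB hBA
  set z' := needle z w0 B with hz'def
  set k : ℝ → X := fun s => D.V (pl2snd (z'.w s - z.w s)) with hk
  set Δ : ℝ → X := fun t => ∫ s in D.t0..t, k s with hΔ
  set I : ℝ := ∫ t, ‖z'.w t - z.w t‖ ∂D.μ with hI
  have hkB : ∀ s, k s = B.indicator (fun t => D.V (pl2snd w0 - pl2snd (z.w t))) s := fun s => by
    have h := needle_comp_sub (z := z) (w0 := w0) (B := B) (fun _ w => D.V (pl2snd w)) s
    simp only [hk, pl2snd_sub, map_sub] at h ⊢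
    exact h
  have hsB : ∀ s, ‖z'.w s - z.w s‖ = B.indicator (fun t => ‖w0 - z.w t‖) s := fun s => by
    have h := needle_comp_sub (z := z) (w0 := w0) (B := B) (fun _ w => w) s
    rw [h]
    by_cases hs : s ∈ B <;> simp [hs]
  have hε := D.hε
  have hb := D.b_nonneg
  have hT : 0 < D.t1 - D.t0 := sub_pos.2 D.ht
  have hB0 : 0 ≤ volume.real B := measureReal_nonneg
  have hI0 : 0 ≤ I := integral_nonneg fun _ => norm_nonneg _
  have hBtop : volume B ≠ ⊤ := ne_top_of_le_ne_top (by simp [Real.volume_Ioc]) (measure_mono hBs)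
  have hIB : I ≤ 2 * (D.ε + D.b) * volume.real B := by
    have h1 : I = ∫ t in B, ‖w0 - z.w t‖ := by
      rw [hI, ← integral_indicator_mu (D := D) hB hBs]
      exact integral_congr_ae (Eventually.of_forall hsB)
    have h2 : ‖∫ t in B, ‖w0 - z.w t‖‖ ≤ 2 * (D.ε + D.b) * volume.real B := by
      refine norm_setIntegral_le_of_norm_le_const_ae (lt_top_iff_ne_top.2 hBtop) ?_
      have h3 := ae_restrict_of_ae_restrict_of_subset hBs (D.norm_sub_le_of_adm hz' hz)
      filter_upwards [h3, ae_restrict_mem hB] with t ht htB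
      rw [hsB, indicator_of_mem htB] at ht
      rwa [norm_norm]
    rw [h1]
    exact (le_abs_self _).trans h2
  have hΔI : ∀ t ∈ Icc D.t0 D.t1, ‖Δ t‖ ≤ I := fun t htt =>
    D.norm_primitive_le (hz'.2.1.sub hz.2.1).norm
      (Eventually.of_forall fun s => (D.hV _).trans (norm_pl2snd_le _)) htt
  have htr : ∀ t ∈ Icc D.t0 D.t1, D.tr z' t = D.tr z t + Δ t := fun t htt => by
    have h := D.tr_sub hz'.2.1 hz.2.1 htt
    have h0 : z'.x0 = z.x0 := rfl
    rw [h0, sub_self, zero_add] at h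
    exact sub_eq_iff_eq_add'.1 h
  have hkint : Integrable k D.μ := D.integrable_snd (hz'.2.1.sub hz.2.1)
  have hkI : IntervalIntegrable k volume D.t0 D.t1 :=
    (intervalIntegrable_iff_integrableOn_Ioc_of_le D.ht.le).2 hkint
  have hgI : IntervalIntegrable (D.gap z) volume D.t0 D.t1 :=
    (intervalIntegrable_iff_integrableOn_Ioc_of_le D.ht.le).2 (D.integrable_gap hz)
  have hΔc : ContinuousOn Δ (Icc D.t0 D.t1) := by
    have h := intervalIntegral.continuousOn_primitive_interval' hkI left_mem_uIcc
    rwa [uIcc_of_le D.ht.le] at h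
  have hΔm : AEStronglyMeasurable Δ D.μ :=
    (hΔc.mono Ioc_subset_Icc_self).aestronglyMeasurable measurableSet_Ioc
  have hgΔ : Integrable (fun t => ⟪D.gap z t, Δ t⟫) D.μ := by
    refine ((D.integrable_gap hz).norm.mul_const I).mono'
      ((D.aesm_gap hz.2.1).inner hΔm) ?_
    filter_upwards [ae_restrict_mem measurableSet_Ioc] with t htt
    refine (norm_inner_le_norm _ _).trans ?_
    gcongr
    exact hΔI t (Ioc_subset_Icc_self htt)
  have htry : Integrable (fun t => ‖D.tr z t - pl2fst w0‖ ^ 2) D.μ := by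
    obtain ⟨K, hK⟩ := (isCompact_Icc (a := D.t0) (b := D.t1)).exists_bound_of_continuousOn
      (((D.continuousOn_tr hz.2.1).sub (continuousOn_const (c := pl2fst w0))).norm.pow 2)
    refine Integrable.of_bound (((D.aesm_tr hz.2.1).sub aestronglyMeasurable_const).norm.pow 2) K ?_
    filter_upwards [ae_restrict_mem measurableSet_Ioc] with t htt using
      hK t (Ioc_subset_Icc_self htt)
  have hsq : Integrable (fun t => ‖D.tr z t - pl2fst w0‖ ^ 2 - ‖D.gap z t‖ ^ 2) D.μ :=
    htry.sub (D.integrable_gap_sq hz)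
  have hgap : ∫ t, ‖D.gap z' t‖ ^ 2 ∂D.μ ≤ ∫ t, ‖D.gap z t‖ ^ 2 ∂D.μ +
      2 * ∫ t, ⟪D.gap z t, Δ t⟫ ∂D.μ + (D.t1 - D.t0) * I ^ 2 +
      ((∫ t in B, (‖D.tr z t - pl2fst w0‖ ^ 2 - ‖D.gap z t‖ ^ 2)) +
        4 * D.ε * I * volume.real B) := by
    have hind : Integrable (B.indicator
        (fun t => (‖D.tr z t - pl2fst w0‖ ^ 2 - ‖D.gap z t‖ ^ 2) + 4 * D.ε * I)) D.μ :=
      (hsq.add (integrable_const _)).indicator hB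
    have h1 : ∫ t, ‖D.gap z' t‖ ^ 2 ∂D.μ ≤ ∫ t, ((‖D.gap z t‖ ^ 2 + 2 * ⟪D.gap z t, Δ t⟫ + I ^ 2) +
        B.indicator (fun t => (‖D.tr z t - pl2fst w0‖ ^ 2 - ‖D.gap z t‖ ^ 2) + 4 * D.ε * I) t)
        ∂D.μ := by
      refine integral_mono_ae (D.integrable_gap_sq hz') ((((D.integrable_gap_sq hz).add
        (hgΔ.const_mul 2)).add (integrable_const _)).add hind) ?_
      filter_upwards [ae_restrict_mem measurableSet_Ioc, hz.2.2] with t htt hzt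
      have ht' := Ioc_subset_Icc_self htt
      have h2 : ‖Δ t‖ ^ 2 ≤ I ^ 2 := by gcongr; exact hΔI t ht'
      by_cases htB : t ∈ B
      · have e1 : D.gap z' t = (D.tr z t - pl2fst w0) + Δ t := by
          rw [gap, htr t ht']
          have : z'.w t = w0 := by classical simp [hz'def, needle, htB]
          rw [this]; abel
        have e2 : ⟪D.tr z t - pl2fst w0, Δ t⟫ =
            ⟪D.gap z t, Δ t⟫ + ⟪pl2fst (z.w t) - pl2fst w0, Δ t⟫ := by
          rw [← inner_add_left, gap]; congr 1; abel
        have e3 : ‖pl2fst (z.w t) - pl2fst w0‖ ≤ 2 * D.ε := by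
          have h4 := norm_sub_le_norm_sub_add_norm_sub (pl2fst (z.w t)) (pl2fst (D.ws t))
            (pl2fst w0)
          have h5 := (hBA t htB).1
          rw [norm_sub_rev] at h5
          linarith [hzt.2.1]
        have e4 : ⟪pl2fst (z.w t) - pl2fst w0, Δ t⟫ ≤ 2 * D.ε * I :=
          (real_inner_le_norm _ _).trans (mul_le_mul e3 (hΔI t ht') (norm_nonneg _) (by positivity))
        rw [e1, norm_add_sq_real, e2, indicator_of_mem htB]
        linarith
      · have e1 : D.gap z' t = D.gap z t + Δ t := by
          rw [gap, htr t ht']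
          have : z'.w t = z.w t := by classical simp [hz'def, needle, htB]
          rw [this, gap]; abel
        rw [e1, norm_add_sq_real, indicator_of_notMem htB]
        linarith
    refine h1.trans (le_of_eq ?_)
    have i2 : Integrable (fun t => ‖D.gap z t‖ ^ 2 + 2 * ⟪D.gap z t, Δ t⟫) D.μ :=
      (D.integrable_gap_sq hz).add (hgΔ.const_mul 2)
    have i3 : Integrable (fun t => ‖D.gap z t‖ ^ 2 + 2 * ⟪D.gap z t, Δ t⟫ + I ^ 2) D.μ :=
      i2.add (integrable_const _)
    rw [integral_add i3 hind, integral_add i2 (integrable_const _),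
      integral_add (D.integrable_gap_sq hz) (hgΔ.const_mul 2), integral_const_mul, integral_const,
      integral_indicator_mu hB hBs, integral_add
        (hsq.mono_measure (Measure.restrict_mono hBs le_rfl)) (integrableOn_const hBtop),
      setIntegral_const, measureReal_restrict_apply_univ, Real.volume_real_Ioc_of_le D.ht.le,
      smul_eq_mul, smul_eq_mul]
    ring
  have hends : D.ends z' = D.ends z + pl2 0 (Δ D.t1) := by
    rw [ends, ends, htr _ (right_mem_Icc.2 D.ht.le)]
    have : (z'.x0 : X) = z.x0 + 0 := (add_zero _).symm
    rw [this]; rfl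
  have hΔ1 : ‖pl2 (0 : X) (Δ D.t1)‖ ^ 2 ≤ I ^ 2 := by
    rw [norm_pl2_zero_left]
    gcongr
    exact hΔI _ (right_mem_Icc.2 D.ht.le)
  have hend : ∀ y : PL2 X X, ‖D.ends z' - y‖ ^ 2 ≤
      ‖D.ends z - y‖ ^ 2 + 2 * ⟪pl2snd (D.ends z - y), Δ D.t1⟫ + I ^ 2 := fun y => by
    have e1 : D.ends z' - y = (D.ends z - y) + pl2 0 (Δ D.t1) := by rw [hends]; abel
    have e2 : ⟪D.ends z - y, pl2 0 (Δ D.t1)⟫ = ⟪pl2snd (D.ends z - y), Δ D.t1⟫ := by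
      rw [inner_pl2, pl2fst_pl2, pl2snd_pl2, inner_zero_right, zero_add]
    rw [e1, norm_add_sq_real, e2]
    linarith
  have htri : ∫ t, ⟪D.gap z t, Δ t⟫ ∂D.μ =
      ∫ s in D.t0..D.t1, ⟪∫ t in s..D.t1, D.gap z t, k s⟫ := by
    rw [← integral_inner_triangle D.ht.le hgI hkI, intervalIntegral.integral_of_le D.ht.le]
  have hadjc := D.continuousOn_adj a (D.integrable_gap hz)
  have hadj : ⟪a, Δ D.t1⟫ + ∫ t, ⟪D.gap z t, Δ t⟫ ∂D.μ =
      -∫ t in B, ⟪D.adj a (D.gap z) t, D.V (pl2snd w0 - pl2snd (z.w t))⟫ := by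
    have hk2 : Integrable (fun s => ⟪∫ t in s..D.t1, D.gap z t, k s⟫) D.μ := by
      have hc := D.continuousOn_adj 0 (D.integrable_gap hz)
      obtain ⟨K, hK⟩ := (isCompact_Icc (a := D.t0) (b := D.t1)).exists_bound_of_continuousOn hc
      have : (fun s => ∫ t in s..D.t1, D.gap z t) = fun s => -D.adj 0 (D.gap z) s := by
        ext s; simp [adj]
      refine (hkint.norm.const_mul K).mono' (AEStronglyMeasurable.inner ?_
        hkint.aestronglyMeasurable) ?_
      · rw [this]
        exact ((hc.neg).mono Ioc_subset_Icc_self).aestronglyMeasurable measurableSet_Ioc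
      · filter_upwards [ae_restrict_mem measurableSet_Ioc] with s hs
        have h1 := hK s (Ioc_subset_Icc_self hs)
        refine (norm_inner_le_norm _ _).trans ?_
        gcongr
        have h2 : ∫ t in s..D.t1, D.gap z t = -D.adj 0 (D.gap z) s := congrFun this s
        rw [h2, norm_neg]; exact h1
    have h1 : ⟪a, Δ D.t1⟫ = ∫ s, ⟪a, k s⟫ ∂D.μ := by
      rw [integral_inner hkint]
      simp only [hΔ]
      rw [intervalIntegral.integral_of_le D.ht.le]
    rw [htri, intervalIntegral.integral_of_le D.ht.le, h1,
      ← integral_add (hkint.const_inner a) hk2, ← integral_neg,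
      ← integral_indicator_mu (D := D) hB hBs]
    refine integral_congr_ae (Eventually.of_forall fun s => ?_)
    simp only []
    rw [← inner_add_left, hkB]
    by_cases hs : s ∈ B
    · rw [indicator_of_mem hs, indicator_of_mem hs, adj, inner_neg_left, neg_neg]
    · rw [indicator_of_notMem hs, indicator_of_notMem hs, inner_zero_right]
  have hadjint : IntegrableOn
      (fun t => ⟪D.adj a (D.gap z) t, D.V (pl2snd w0 - pl2snd (z.w t))⟫) B := by
    obtain ⟨K, hK⟩ := (isCompact_Icc (a := D.t0) (b := D.t1)).exists_bound_of_continuousOn hadjc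
    have hint : Integrable (fun t => D.V (pl2snd w0 - pl2snd (z.w t))) D.μ :=
      D.integrable_snd (w := fun t => w0 - z.w t) ((integrable_const w0).sub hz.2.1)
    have : Integrable (fun t => ⟪D.adj a (D.gap z) t, D.V (pl2snd w0 - pl2snd (z.w t))⟫) D.μ := by
      refine (hint.norm.const_mul K).mono' (AEStronglyMeasurable.inner
        ((hadjc.mono Ioc_subset_Icc_self).aestronglyMeasurable measurableSet_Ioc)
        hint.aestronglyMeasurable) ?_
      filter_upwards [ae_restrict_mem measurableSet_Ioc] with s hs
      refine (norm_inner_le_norm _ _).trans ?_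
      gcongr
      exact hK s (Ioc_subset_Icc_self hs)
    exact this.mono_measure (Measure.restrict_mono hBs le_rfl)
  rw [integral_sub (hsq.mono_measure (Measure.restrict_mono hBs le_rfl)) (hadjint.const_mul 2),
    integral_const_mul]
  have hc := hend z.c
  have hd := hend z.d
  have hsum : ⟪pl2snd (D.ends z - z.c), Δ D.t1⟫ + ⟪pl2snd (D.ends z - z.d), Δ D.t1⟫ =
      ⟪a, Δ D.t1⟫ := by rw [ha, inner_add_left]
  have hI2 : I ^ 2 ≤ (2 * (D.ε + D.b)) ^ 2 * volume.real B ^ 2 := by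
    rw [← mul_pow]; gcongr
  have hI3 : (2 + (D.t1 - D.t0)) * I ^ 2 ≤
      (2 + (D.t1 - D.t0)) * ((2 * (D.ε + D.b)) ^ 2 * volume.real B ^ 2) := by gcongr
  have hI4 : 4 * D.ε * I * volume.real B ≤
      4 * D.ε * (2 * (D.ε + D.b) * volume.real B) * volume.real B := by gcongr
  have hc' : z'.c = z.c := rfl
  have hd' : z'.d = z.d := rfl
  unfold sqPen
  rw [hc', hd']
  nlinarith

end Needle

end PenData

end Penalised

section Penalised

set_option linter.unusedSectionVars false

variable {X Q : Type} [NormedAddCommGroup X] [InnerProductSpace ℝ X] [FiniteDimensional ℝ X]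
  [NormedAddCommGroup Q] [InnerProductSpace ℝ Q] [FiniteDimensional ℝ Q]

namespace PenData

variable (D : PenData X Q)

/-- The stationarity conditions satisfied by an approximate minimiser of the penalised problem. -/
structure PenSol (α C N : ℝ) where
  x0 : X
  w : ℝ → PL2 X Q
  c : PL2 X X
  d : PL2 X X
  G : ℝ
  ec : PL2 X X
  ed : PL2 X X
  lam : ℝ
  r : ℝ → X
  integrable_w : Integrable w D.μ
  mem : ∀ᵐ t ∂D.μ, w t ∈ D.M ∧
    ‖pl2fst (w t) - pl2fst (D.ws t)‖ ≤ D.ε ∧ ‖pl2snd (w t) - pl2snd (D.ws t)‖ ≤ D.ϱ t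
  dist_w : ∫ t, ‖w t - D.ws t‖ ∂D.μ ≤ α
  dist_x0 : ‖x0 - D.xs0‖ ≤ α
  dist_c : ‖c - D.ends D.star‖ ≤ α
  dist_d : ‖d - D.ends D.star‖ ≤ α
  c_mem : c ∈ D.S
  G_pos : 0 < G
  lam_nonneg : 0 ≤ lam
  lam_eq : G * lam = D.excess (α ^ 2) d
  integrable_r : Integrable r D.μ
  integrable_r_sq : Integrable (fun t => ‖r t‖ ^ 2) D.μ
  r_eq : ∀ t, G • r t = D.tr ⟨x0, w, c, d⟩ t - pl2fst (w t)
  normalised : lam ^ 2 + ‖ec‖ ^ 2 + ‖ed‖ ^ 2 + ∫ t, ‖r t‖ ^ 2 ∂D.μ = 1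
  var_x0 : ‖D.adj (pl2snd ec + pl2snd ed) r D.t0 - (pl2fst ec + pl2fst ed)‖ ≤ α
  var_c : ∀ c' ∈ D.S, ⟪ec, c' - c⟫ ≤ α * ‖c' - c‖ + ‖c' - c‖ ^ 2 / (2 * G)
  var_d : ∀ d', ⟪ed, d' - d⟫ ≤ lam * (D.excess (α ^ 2) d' - D.excess (α ^ 2) d) +
    ((D.excess (α ^ 2) d' - D.excess (α ^ 2) d) ^ 2 + ‖d' - d‖ ^ 2) / (2 * G) + α * ‖d' - d‖
  var_w : ∀ᵐ t ∂D.μ, ∀ v ∈ D.M, ‖pl2fst v - pl2fst (D.ws t)‖ < D.ε →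
    ‖pl2snd v - pl2snd (D.ws t)‖ < D.ϱ t →
    0 ≤ (‖D.tr ⟨x0, w, c, d⟩ t - pl2fst v‖ ^ 2 -
        ‖D.tr ⟨x0, w, c, d⟩ t - pl2fst (w t)‖ ^ 2) / (2 * G) -
      ⟪D.adj (pl2snd ec + pl2snd ed) r t, D.V (pl2snd v - pl2snd (w t))⟫ +
      (D.barrier C N t (pl2snd v) - D.barrier C N t (pl2snd (w t))) + α * ‖v - w t‖

variable {D}

theorem needle_ineq {η α C N : ℝ} (hC : 0 ≤ C) (hN : 0 ≤ N) {z : PState X Q} (hz : z ∈ D.Adm)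
    (hpos : 0 < D.sqPen η z)
    (hek : ∀ z' ∈ D.Adm, D.cost η C N z ≤ D.cost η C N z' + α * D.dst z z')
    {a : X} (ha : a = pl2snd (D.ends z - z.c) + pl2snd (D.ends z - z.d)) :
    ∀ᵐ t ∂D.μ, ∀ v ∈ D.M, ‖pl2fst v - pl2fst (D.ws t)‖ < D.ε →
      ‖pl2snd v - pl2snd (D.ws t)‖ < D.ϱ t →
      0 ≤ ((‖D.tr z t - pl2fst v‖ ^ 2 - ‖D.gap z t‖ ^ 2) -
        2 * ⟪D.adj a (D.gap z) t, D.V (pl2snd v - pl2snd (z.w t))⟫) / (2 * √(D.sqPen η z)) +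
        (D.barrier C N t (pl2snd v) - D.barrier C N t (pl2snd (z.w t))) + α * ‖v - z.w t‖ := by
  set G := √(D.sqPen η z) with hG
  have hGpos : 0 < G := Real.sqrt_pos.2 hpos
  set ψ : PL2 X Q → ℝ → ℝ := fun v t => ((‖D.tr z t - pl2fst v‖ ^ 2 - ‖D.gap z t‖ ^ 2) -
        2 * ⟪D.adj a (D.gap z) t, D.V (pl2snd v - pl2snd (z.w t))⟫) / (2 * G) +
        (D.barrier C N t (pl2snd v) - D.barrier C N t (pl2snd (z.w t))) + α * ‖v - z.w t‖ with hψ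
  have hmain : ∀ w0 ∈ D.M, ∀ᵐ t ∂D.μ, ‖pl2fst w0 - pl2fst (D.ws t)‖ ≤ D.ε →
      ‖pl2snd w0 - pl2snd (D.ws t)‖ ≤ D.ϱ t → 0 ≤ ψ w0 t := by
    intro w0 hw0
    have hadjc := D.continuousOn_adj a (D.integrable_gap hz)
    have htry : Integrable (fun t => ‖D.tr z t - pl2fst w0‖ ^ 2) D.μ := by
      obtain ⟨K, hK⟩ := (isCompact_Icc (a := D.t0) (b := D.t1)).exists_bound_of_continuousOn
        (((D.continuousOn_tr hz.2.1).sub (continuousOn_const (c := pl2fst w0))).norm.pow 2)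
      refine Integrable.of_bound
        (((D.aesm_tr hz.2.1).sub aestronglyMeasurable_const).norm.pow 2) K ?_
      filter_upwards [ae_restrict_mem measurableSet_Ioc] with t htt using
        hK t (Ioc_subset_Icc_self htt)
    have hadjint : Integrable
        (fun t => ⟪D.adj a (D.gap z) t, D.V (pl2snd w0 - pl2snd (z.w t))⟫) D.μ := by
      obtain ⟨K, hK⟩ := (isCompact_Icc (a := D.t0) (b := D.t1)).exists_bound_of_continuousOn hadjc
      have hint : Integrable (fun t => D.V (pl2snd w0 - pl2snd (z.w t))) D.μ :=
        D.integrable_snd (w := fun t => w0 - z.w t) ((integrable_const w0).sub hz.2.1)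
      refine (hint.norm.const_mul K).mono' (AEStronglyMeasurable.inner
        ((hadjc.mono Ioc_subset_Icc_self).aestronglyMeasurable measurableSet_Ioc)
        hint.aestronglyMeasurable) ?_
      filter_upwards [ae_restrict_mem measurableSet_Ioc] with s hs
      refine (norm_inner_le_norm _ _).trans ?_
      gcongr
      exact hK s (Ioc_subset_Icc_self hs)
    have j1 : Integrable (fun t => (‖D.tr z t - pl2fst w0‖ ^ 2 - ‖D.gap z t‖ ^ 2) -
        2 * ⟪D.adj a (D.gap z) t, D.V (pl2snd w0 - pl2snd (z.w t))⟫) D.μ :=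
      (htry.sub (D.integrable_gap_sq hz)).sub (hadjint.const_mul 2)
    have j2 : Integrable (fun t => D.barrier C N t (pl2snd w0) - D.barrier C N t (pl2snd (z.w t)))
        D.μ := (D.integrable_barrier hC hN (integrable_const w0)).sub
          (D.integrable_barrier hC hN hz.2.1)
    have j3 : Integrable (fun t => ‖w0 - z.w t‖) D.μ := ((integrable_const w0).sub hz.2.1).norm
    have j12 : Integrable (fun t => ((‖D.tr z t - pl2fst w0‖ ^ 2 - ‖D.gap z t‖ ^ 2) -
        2 * ⟪D.adj a (D.gap z) t, D.V (pl2snd w0 - pl2snd (z.w t))⟫) / (2 * G) +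
        (D.barrier C N t (pl2snd w0) - D.barrier C N t (pl2snd (z.w t)))) D.μ :=
      (j1.div_const _).add j2
    have hψi : Integrable (ψ w0) D.μ := j12.add (j3.const_mul α)
    have hA : MeasurableSet {t | ‖pl2fst w0 - pl2fst (D.ws t)‖ ≤ D.ε ∧
        ‖pl2snd w0 - pl2snd (D.ws t)‖ ≤ D.ϱ t} := by
      have m1 : Measurable fun t => ‖pl2fst w0 - pl2fst (D.ws t)‖ :=
        (stronglyMeasurable_const.sub (continuous_pl2fst.comp_stronglyMeasurable D.hws)).norm.measurable
      have m2 : Measurable fun t => ‖pl2snd w0 - pl2snd (D.ws t)‖ :=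
        (stronglyMeasurable_const.sub (continuous_pl2snd.comp_stronglyMeasurable D.hws)).norm.measurable
      exact (measurableSet_le m1 measurable_const).inter (measurableSet_le m2 D.hϱ)
    refine (ae_nonneg_of_quadratic hA hψi (K := ((2 + (D.t1 - D.t0)) * (2 * (D.ε + D.b)) ^ 2 +
      4 * D.ε * (2 * (D.ε + D.b))) / (2 * G)) ?_).mono fun t ht h1 h2 => ht ⟨h1, h2⟩
    intro B hB hBA hBs
    have hBA' : ∀ t ∈ B, ‖pl2fst w0 - pl2fst (D.ws t)‖ ≤ D.ε ∧
      ‖pl2snd w0 - pl2snd (D.ws t)‖ ≤ D.ϱ t := fun t ht => hBA ht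
    have hz' := needle_mem hz hw0 hB hBA'
    have hb := D.basic_inequality hpos (hek _ hz')
    have hs := needle_sqPen_le hz hw0 hB hBs hBA' ha η
    have hle := Measure.restrict_mono hBs (le_refl (volume : Measure ℝ))
    have hbar : ∫ t, D.barrier C N t (pl2snd ((needle z w0 B).w t)) ∂D.μ -
        ∫ t, D.barrier C N t (pl2snd (z.w t)) ∂D.μ =
        ∫ t in B, D.barrier C N t (pl2snd w0) - D.barrier C N t (pl2snd (z.w t)) := by
      rw [← integral_sub (D.integrable_barrier hC hN hz'.2.1) (D.integrable_barrier hC hN hz.2.1),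
        ← integral_indicator_mu (D := D) hB hBs]
      exact integral_congr_ae (Eventually.of_forall fun t =>
        needle_comp_sub (fun t w => D.barrier C N t (pl2snd w)) t)
    have hdst : D.dst z (needle z w0 B) = ∫ t in B, ‖w0 - z.w t‖ := by
      have h1 : ∫ t, ‖z.w t - (needle z w0 B).w t‖ ∂D.μ = ∫ t in B, ‖w0 - z.w t‖ := by
        rw [← integral_indicator_mu (D := D) hB hBs]
        refine integral_congr_ae (Eventually.of_forall fun t => ?_)
        simp only []
        rw [norm_sub_rev, needle_comp_sub (fun _ w => w) t]
        by_cases ht : t ∈ B <;> simp [ht]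
      rw [dst, h1]
      simp [needle]
    rw [hbar, hdst] at hb
    have hsum : ∫ t in B, ψ w0 t = (∫ t in B, ((‖D.tr z t - pl2fst w0‖ ^ 2 - ‖D.gap z t‖ ^ 2) -
        2 * ⟪D.adj a (D.gap z) t, D.V (pl2snd w0 - pl2snd (z.w t))⟫)) / (2 * G) +
        (∫ t in B, D.barrier C N t (pl2snd w0) - D.barrier C N t (pl2snd (z.w t))) +
        α * ∫ t in B, ‖w0 - z.w t‖ := by
      rw [hψ]
      simp only []
      rw [integral_add (j12.mono_measure hle) ((j3.const_mul α).mono_measure hle),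
        integral_add ((j1.div_const _).mono_measure hle) (j2.mono_measure hle),
        integral_const_mul, integral_div]
    have h1 := div_le_div_of_nonneg_right hs (by positivity : 0 ≤ 2 * G)
    rw [add_div] at h1
    rw [hsum, div_mul_eq_mul_div]
    linarith
  obtain ⟨Dn, hDc, hDd⟩ := TopologicalSpace.exists_countable_dense D.M
  have hall := (ae_ball_iff hDc).2 fun w0 (_ : w0 ∈ Dn) => hmain w0.1 w0.2
  filter_upwards [hall] with t ht v hv h1 h2
  obtain ⟨s, hs, hsl⟩ := mem_closure_iff_seq_limit.1 (hDd ⟨v, hv⟩)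
  have hsl' : Tendsto (fun n => (s n).1) atTop (𝓝 v) := (continuous_subtype_val.tendsto _).comp hsl
  have hbc : Continuous fun q => D.barrier C N t q := by unfold barrier; fun_prop
  have hψc : Continuous fun v => ψ v t := by
    have := D.V.continuous
    simp only [hψ]
    fun_prop
  have e1 : ∀ᶠ n in atTop, ‖pl2fst (s n).1 - pl2fst (D.ws t)‖ < D.ε :=
    (((continuous_pl2fst.tendsto _).comp hsl').sub_const _).norm.eventually_lt_const h1
  have e2 : ∀ᶠ n in atTop, ‖pl2snd (s n).1 - pl2snd (D.ws t)‖ < D.ϱ t :=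
    (((continuous_pl2snd.tendsto _).comp hsl').sub_const _).norm.eventually_lt_const h2
  refine ge_of_tendsto ((hψc.tendsto v).comp hsl') ?_
  filter_upwards [e1, e2] with n h3 h4 using ht _ (hs n) h3.le h4.le

theorem adj_smul (c : ℝ) (a : X) (r : ℝ → X) (s : ℝ) :
    D.adj (c • a) (fun t => c • r t) s = c • D.adj a r s := by
  rw [adj, adj, intervalIntegral.integral_smul, smul_neg, smul_add]

variable (D)

theorem exists_penSol {α C N : ℝ} (hα : 0 < α) (hαε : α ≤ D.ε) (hC : 0 ≤ C)
    (hN : 1 ≤ N * D.δ) : Nonempty (D.PenSol α C N) := by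
  have hN0 : 0 ≤ N := by
    by_contra! h
    nlinarith [D.hδ]
  obtain ⟨z, hz, hdst, hpos, hek⟩ := D.exists_ekeland hα hαε hC hN
  set G := √(D.sqPen (α ^ 2) z) with hG
  have hGpos : 0 < G := Real.sqrt_pos.2 hpos
  have hGsq : G ^ 2 = D.sqPen (α ^ 2) z := Real.sq_sqrt hpos.le
  have hT : 0 < D.t1 - D.t0 := sub_pos.2 D.ht
  set a := pl2snd (D.ends z - z.c) + pl2snd (D.ends z - z.d) with ha
  have hi : 0 ≤ ∫ t, ‖D.star.w t - z.w t‖ ∂D.μ := integral_nonneg fun _ => norm_nonneg _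
  have n1 := norm_nonneg (D.star.x0 - z.x0)
  have n2 := norm_nonneg (D.star.c - z.c)
  have n3 := norm_nonneg (D.star.d - z.d)
  have hdst' := hdst
  unfold dst at hdst'
  have hnorm : ∀ t, ‖G⁻¹ • D.gap z t‖ ^ 2 = (G ^ 2)⁻¹ * ‖D.gap z t‖ ^ 2 := fun t => by
    rw [norm_smul, mul_pow, Real.norm_of_nonneg (by positivity), inv_pow]
  have hadj : ∀ s, D.adj (pl2snd (G⁻¹ • (D.ends z - z.c)) + pl2snd (G⁻¹ • (D.ends z - z.d)))
      (fun t => G⁻¹ • D.gap z t) s = G⁻¹ • D.adj a (D.gap z) s := fun s => by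
    rw [← adj_smul, ha, smul_add, pl2snd_smul, pl2snd_smul]
  refine ⟨{ x0 := z.x0, w := z.w, c := z.c, d := z.d, G := G, ec := G⁻¹ • (D.ends z - z.c),
            ed := G⁻¹ • (D.ends z - z.d), lam := G⁻¹ * D.excess (α ^ 2) z.d,
            r := fun t => G⁻¹ • D.gap z t, integrable_w := hz.2.1, mem := hz.2.2,
            dist_w := ?_, dist_x0 := ?_, dist_c := ?_, dist_d := ?_, c_mem := hz.1,
            G_pos := hGpos, lam_nonneg := ?_, lam_eq := ?_,
            integrable_r := (D.integrable_gap hz).smul _, integrable_r_sq := ?_,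
            r_eq := ?_, normalised := ?_, var_x0 := ?_, var_c := ?_, var_d := ?_,
            var_w := ?_ }⟩
  · have : ∫ t, ‖z.w t - D.ws t‖ ∂D.μ = ∫ t, ‖D.star.w t - z.w t‖ ∂D.μ :=
      integral_congr_ae (Eventually.of_forall fun t => norm_sub_rev _ _)
    rw [this]; linarith
  · rw [norm_sub_rev]; exact le_trans (by linarith : ‖D.star.x0 - z.x0‖ ≤ _) hdst'
  · rw [norm_sub_rev]; exact le_trans (by linarith : ‖D.star.c - z.c‖ ≤ _) hdst'
  · rw [norm_sub_rev]; exact le_trans (by linarith : ‖D.star.d - z.d‖ ≤ _) hdst'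
  · have := le_max_left 0 (D.f z.d - D.f (D.ends D.star) + α ^ 2)
    exact mul_nonneg (by positivity) this
  · field_simp
  · simp_rw [hnorm]
    exact (D.integrable_gap_sq hz).const_mul _
  · intro t
    rw [smul_inv_smul₀ hGpos.ne']
    rfl
  · simp_rw [hnorm]
    rw [integral_const_mul, norm_smul, norm_smul, mul_pow, mul_pow, mul_pow,
      Real.norm_of_nonneg (by positivity : 0 ≤ G⁻¹)]
    have h1 : D.sqPen (α ^ 2) z = D.excess (α ^ 2) z.d ^ 2 + ‖D.ends z - z.c‖ ^ 2 +
      ‖D.ends z - z.d‖ ^ 2 + ∫ t, ‖D.gap z t‖ ^ 2 ∂D.μ := rfl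
    rw [inv_pow, ← mul_add, ← mul_add, ← mul_add, ← h1, ← hGsq]
    exact inv_mul_cancel₀ (by positivity)
  · rw [hadj, norm_sub_rev]
    refine norm_le_of_forall_inner (K := (4 + (D.t1 - D.t0)) / (2 * G)) hα.le fun v => ?_
    set z' : PState X Q := ⟨z.x0 + v, z.w, z.c, z.d⟩ with hz'
    have hzm : z' ∈ D.Adm := hz
    have hb := D.basic_inequality hpos (hek z' hzm)
    have etr : ∀ t, D.tr z' t = D.tr z t + v := fun t => by
      simp only [tr, hz']; abel
    have egap : ∀ t, D.gap z' t = D.gap z t + v := fun t => by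
      rw [gap, etr, gap]; abel
    have eend : ∀ y, D.ends z' - y = (D.ends z - y) + pl2 v v := fun y => by
      have : D.ends z' = D.ends z + pl2 v v := by
        rw [ends, etr]; rfl
      rw [this]; abel
    have edst : D.dst z z' = ‖v‖ := by simp [dst, hz']
    have hsq : D.sqPen (α ^ 2) z' - D.sqPen (α ^ 2) z =
        2 * ⟪D.ends z - z.c, pl2 v v⟫ + 2 * ⟪D.ends z - z.d, pl2 v v⟫ +
        2 * ⟪∫ t, D.gap z t ∂D.μ, v⟫ + (4 + (D.t1 - D.t0)) * ‖v‖ ^ 2 := by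
      have hI : ∫ t, ‖D.gap z' t‖ ^ 2 ∂D.μ = ∫ t, ‖D.gap z t‖ ^ 2 ∂D.μ +
          2 * ⟪∫ t, D.gap z t ∂D.μ, v⟫ + (D.t1 - D.t0) * ‖v‖ ^ 2 := by
        simp_rw [egap, norm_add_sq_real]
        have i1 : Integrable (fun t => ⟪D.gap z t, v⟫) D.μ := (D.integrable_gap hz).inner_const v
        have i2 : Integrable (fun t => ‖D.gap z t‖ ^ 2 + 2 * ⟪D.gap z t, v⟫) D.μ :=
          (D.integrable_gap_sq hz).add (i1.const_mul 2)
        have i3 : ∫ t, ⟪D.gap z t, v⟫ ∂D.μ = ⟪∫ t, D.gap z t ∂D.μ, v⟫ := by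
          rw [real_inner_comm, ← integral_inner (D.integrable_gap hz)]
          simp_rw [real_inner_comm]
        rw [integral_add i2 (integrable_const _), integral_add (D.integrable_gap_sq hz)
          (i1.const_mul 2), integral_const_mul, i3, integral_const, measureReal_restrict_apply_univ,
          Real.volume_real_Ioc_of_le D.ht.le, smul_eq_mul]
      have hv : ‖pl2 v v‖ ^ 2 = 2 * ‖v‖ ^ 2 := by
        rw [norm_pl2_sq, pl2fst_pl2, pl2snd_pl2]; ring
      have hc' : z'.c = z.c := rfl
      have hd' : z'.d = z.d := rfl
      unfold sqPen
      rw [hI, hc', hd', eend, eend, norm_add_sq_real, norm_add_sq_real, hv]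
      ring
    rw [hsq, edst] at hb
    have hbar : ∫ t, D.barrier C N t (pl2snd (z'.w t)) ∂D.μ =
      ∫ t, D.barrier C N t (pl2snd (z.w t)) ∂D.μ := rfl
    rw [hbar, sub_self, add_zero] at hb
    have hA : D.adj a (D.gap z) D.t0 = -(a + ∫ t, D.gap z t ∂D.μ) := by
      rw [adj, intervalIntegral.integral_of_le D.ht.le]
    have hfin : ⟪pl2fst (G⁻¹ • (D.ends z - z.c)) + pl2fst (G⁻¹ • (D.ends z - z.d)) -
        G⁻¹ • D.adj a (D.gap z) D.t0, v⟫ = (2 * ⟪D.ends z - z.c, pl2 v v⟫ +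
        2 * ⟪D.ends z - z.d, pl2 v v⟫ + 2 * ⟪∫ t, D.gap z t ∂D.μ, v⟫) / (2 * G) := by
      rw [hA, ha, inner_pl2, inner_pl2]
      simp only [pl2fst_smul, pl2fst_pl2, pl2snd_pl2, smul_neg, smul_add, inner_sub_left,
        inner_add_left, inner_neg_left, inner_smul_left]
      simp only [conj_trivial]
      field_simp
      ring
    rw [hfin]
    have : (2 * ⟪D.ends z - z.c, pl2 v v⟫ + 2 * ⟪D.ends z - z.d, pl2 v v⟫ +
      2 * ⟪∫ t, D.gap z t ∂D.μ, v⟫) / (2 * G) + α * ‖v‖ + (4 + (D.t1 - D.t0)) / (2 * G) * ‖v‖ ^ 2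
      = (2 * ⟪D.ends z - z.c, pl2 v v⟫ + 2 * ⟪D.ends z - z.d, pl2 v v⟫ +
        2 * ⟪∫ t, D.gap z t ∂D.μ, v⟫ + (4 + (D.t1 - D.t0)) * ‖v‖ ^ 2) / (2 * G) + α * ‖v‖ := by
      ring
    rw [this]
    exact hb
  · intro c' hc'
    set z' : PState X Q := ⟨z.x0, z.w, c', z.d⟩ with hz'
    have hzm : z' ∈ D.Adm := ⟨hc', hz.2⟩
    have hb := D.basic_inequality hpos (hek z' hzm)
    have edst : D.dst z z' = ‖c' - z.c‖ := by simp [dst, hz', norm_sub_rev]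
    have hsq : D.sqPen (α ^ 2) z' - D.sqPen (α ^ 2) z =
        -2 * ⟪D.ends z - z.c, c' - z.c⟫ + ‖c' - z.c‖ ^ 2 := by
      have e1 : D.ends z - c' = (D.ends z - z.c) - (c' - z.c) := by abel
      have e2 : D.sqPen (α ^ 2) z' = D.excess (α ^ 2) z.d ^ 2 + ‖D.ends z - c'‖ ^ 2 +
        ‖D.ends z - z.d‖ ^ 2 + ∫ t, ‖D.gap z t‖ ^ 2 ∂D.μ := rfl
      rw [e2, e1, norm_sub_sq_real, sqPen]
      ring
    have hbar : ∫ t, D.barrier C N t (pl2snd (z'.w t)) ∂D.μ =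
      ∫ t, D.barrier C N t (pl2snd (z.w t)) ∂D.μ := rfl
    rw [hsq, edst, hbar, sub_self, add_zero] at hb
    rw [inner_smul_left, conj_trivial]
    have : (-2 * ⟪D.ends z - z.c, c' - z.c⟫ + ‖c' - z.c‖ ^ 2) / (2 * G) =
      -(G⁻¹ * ⟪D.ends z - z.c, c' - z.c⟫) + ‖c' - z.c‖ ^ 2 / (2 * G) := by field_simp
    rw [this] at hb
    linarith
  · intro d'
    set z' : PState X Q := ⟨z.x0, z.w, z.c, d'⟩ with hz'
    have hzm : z' ∈ D.Adm := hz
    have hb := D.basic_inequality hpos (hek z' hzm)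
    have edst : D.dst z z' = ‖d' - z.d‖ := by simp [dst, hz', norm_sub_rev]
    have hsq : D.sqPen (α ^ 2) z' - D.sqPen (α ^ 2) z =
        2 * D.excess (α ^ 2) z.d * (D.excess (α ^ 2) d' - D.excess (α ^ 2) z.d) +
        (D.excess (α ^ 2) d' - D.excess (α ^ 2) z.d) ^ 2
        -2 * ⟪D.ends z - z.d, d' - z.d⟫ + ‖d' - z.d‖ ^ 2 := by
      have e1 : D.ends z - d' = (D.ends z - z.d) - (d' - z.d) := by abel
      have e2 : D.sqPen (α ^ 2) z' = D.excess (α ^ 2) d' ^ 2 + ‖D.ends z - z.c‖ ^ 2 +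
        ‖D.ends z - d'‖ ^ 2 + ∫ t, ‖D.gap z t‖ ^ 2 ∂D.μ := rfl
      rw [e2, e1, norm_sub_sq_real (D.ends z - z.d), sqPen]
      ring
    have hbar : ∫ t, D.barrier C N t (pl2snd (z'.w t)) ∂D.μ =
      ∫ t, D.barrier C N t (pl2snd (z.w t)) ∂D.μ := rfl
    rw [hsq, edst, hbar, sub_self, add_zero] at hb
    rw [inner_smul_left, conj_trivial]
    set e := D.excess (α ^ 2) z.d
    set e' := D.excess (α ^ 2) d'
    have : (2 * e * (e' - e) + (e' - e) ^ 2 - 2 * ⟪D.ends z - z.d, d' - z.d⟫ + ‖d' - z.d‖ ^ 2) /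
      (2 * G) = G⁻¹ * e * (e' - e) - G⁻¹ * ⟪D.ends z - z.d, d' - z.d⟫ +
        ((e' - e) ^ 2 + ‖d' - z.d‖ ^ 2) / (2 * G) := by field_simp; ring
    rw [this] at hb
    linarith
  · filter_upwards [needle_ineq hC hN0 hz hpos hek ha] with t ht v hv h1 h2
    have h3 := ht v hv h1 h2
    rw [hadj, inner_smul_left, conj_trivial]
    have h4 : D.tr ⟨z.x0, z.w, z.c, z.d⟩ t - pl2fst (z.w t) = D.gap z t := rfl
    have h5 : D.tr ⟨z.x0, z.w, z.c, z.d⟩ t = D.tr z t := rfl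
    rw [h4, h5]
    have : ((‖D.tr z t - pl2fst v‖ ^ 2 - ‖D.gap z t‖ ^ 2) -
        2 * ⟪D.adj a (D.gap z) t, D.V (pl2snd v - pl2snd (z.w t))⟫) / (2 * G) =
      (‖D.tr z t - pl2fst v‖ ^ 2 - ‖D.gap z t‖ ^ 2) / (2 * G) -
        G⁻¹ * ⟪D.adj a (D.gap z) t, D.V (pl2snd v - pl2snd (z.w t))⟫ := by field_simp
    rw [← hG, this] at h3
    linarith

end PenData

end Penalised

section WeakCompactness

/-- A bounded sequence in a Hilbert space has a point lying in the closed convex hull of every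
tail. -/
theorem exists_mem_closure_convexHull_tails {H : Type*} [NormedAddCommGroup H]
    [InnerProductSpace ℝ H] [CompleteSpace H] {x : ℕ → H} {K : ℝ} (hx : ∀ n, ‖x n‖ ≤ K) :
    ∃ y, ∀ n, y ∈ closure (convexHull ℝ (x '' Ici n)) := by
  set A : ℕ → Set H := fun n => closure (convexHull ℝ (x '' Ici n)) with hA
  have hmono : ∀ {n k}, n ≤ k → A k ⊆ A n := fun h =>
    closure_mono (convexHull_mono (image_mono (Ici_subset_Ici.2 h)))
  have hmem : ∀ n, x n ∈ A n := fun n =>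
    subset_closure (subset_convexHull ℝ _ ⟨n, mem_Ici.2 le_rfl, rfl⟩)
  have hconv : ∀ n, Convex ℝ (A n) := fun n => (convex_convexHull ℝ _).closure
  have hmin : ∀ n, ∃ y ∈ A n, ∀ w ∈ A n, ‖y‖ ≤ ‖w‖ := fun n => by
    obtain ⟨y, hy, he⟩ := exists_norm_eq_iInf_of_complete_convex ⟨x n, hmem n⟩
      isClosed_closure.isComplete (hconv n) 0
    refine ⟨y, hy, fun w hw => ?_⟩
    have : ‖(0 : H) - y‖ ≤ ‖(0 : H) - w‖ := by
      rw [he]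
      exact ciInf_le ⟨0, by rintro _ ⟨_, rfl⟩; exact norm_nonneg _⟩ (⟨w, hw⟩ : A n)
    simpa using this
  choose y hyA hymin using hmin
  have hmon : Monotone fun n => ‖y n‖ ^ 2 := fun n k h => by
    have := hymin n _ (hmono h (hyA k))
    dsimp only
    gcongr
  have hbdd : BddAbove (range fun n => ‖y n‖ ^ 2) := by
    refine ⟨K ^ 2, ?_⟩
    rintro _ ⟨n, rfl⟩
    have := (hymin n _ (hmem n)).trans (hx n)
    dsimp only
    gcongr
  have hlim := tendsto_atTop_ciSup hmon hbdd
  set L := ⨆ n, ‖y n‖ ^ 2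
  have hcau : ∀ n k, n ≤ k → ‖y k - y n‖ ^ 2 ≤ 4 * (‖y k‖ ^ 2 - ‖y n‖ ^ 2) := fun n k h => by
    have h1 : (2⁻¹ : ℝ) • y n + (2⁻¹ : ℝ) • y k ∈ A n :=
      hconv n (hyA n) (hmono h (hyA k)) (by norm_num) (by norm_num) (by norm_num)
    have h2 := hymin n _ h1
    rw [← smul_add, norm_smul, Real.norm_of_nonneg (by norm_num)] at h2
    have h3 := parallelogram_law_with_norm ℝ (y n) (y k)
    rw [norm_sub_rev (y n)] at h3
    have h4 := norm_nonneg (y n)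
    have h5 := norm_nonneg (y k)
    have h6 := hmon h
    dsimp only at h6
    nlinarith
  have hC : CauchySeq y := by
    rw [Metric.cauchySeq_iff']
    intro e he
    obtain ⟨n0, hn0⟩ := (Metric.tendsto_atTop.1 hlim) (e ^ 2 / 8) (by positivity)
    refine ⟨n0, fun n hn => ?_⟩
    have h1 := hcau n0 n hn
    have h2 := abs_lt.1 (hn0 n0 le_rfl)
    have h3 : ‖y n‖ ^ 2 ≤ L := le_ciSup hbdd n
    rw [dist_eq_norm]
    refine lt_of_pow_lt_pow_left₀ 2 he.le ?_
    nlinarith [h2.1, sq_pos_of_pos he]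
  obtain ⟨z, hz⟩ := cauchySeq_tendsto_of_complete hC
  refine ⟨z, fun n => isClosed_closure.mem_of_tendsto hz ?_⟩
  filter_upwards [eventually_ge_atTop n] with k hk using hmono hk (hyA k)

/-- A continuous linear functional takes at such a point the limit of its values along the
sequence. -/
theorem apply_eq_of_mem_closure_convexHull_tails {H : Type*} [NormedAddCommGroup H]
    [InnerProductSpace ℝ H] {x : ℕ → H} {y : H}
    (hy : ∀ n, y ∈ closure (convexHull ℝ (x '' Ici n))) (l : H →L[ℝ] ℝ) {L : ℝ}
    (hl : Tendsto (fun n => l (x n)) atTop (𝓝 L)) : l y = L := by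
  refine eq_of_forall_dist_le fun e he => ?_
  obtain ⟨n, hn⟩ := (Metric.tendsto_atTop.1 hl) e he
  have hcl : IsClosed (l ⁻¹' Metric.closedBall L e) := Metric.isClosed_closedBall.preimage l.continuous
  have hco : Convex ℝ (l ⁻¹' Metric.closedBall L e) :=
    (convex_closedBall L e).linear_preimage l.toLinearMap
  have : closure (convexHull ℝ (x '' Ici n)) ⊆ l ⁻¹' Metric.closedBall L e := by
    refine closure_minimal (convexHull_min ?_ hco) hcl
    rintro _ ⟨k, hk, rfl⟩
    exact (hn k hk).le
  exact this (hy n)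

theorem exists_weak_limit {Y : Type*} [NormedAddCommGroup Y] [InnerProductSpace ℝ Y]
    [CompleteSpace Y] [MeasurableSpace Y] [BorelSpace Y] {T : Type*} [MeasurableSpace T]
    {μ : Measure T} [IsFiniteMeasure μ] {l : ℕ → T → Y} {K : ℝ}
    (hl : ∀ n, AEStronglyMeasurable (l n) μ) (hK : ∀ n, ∀ᵐ t ∂μ, ‖l n t‖ ≤ K) :
    ∃ y : T → Y, StronglyMeasurable y ∧
      (∀ᵐ t ∂μ, ∀ n, y t ∈ closure (convexHull ℝ ((fun k => l k t) '' Ici n))) ∧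
      ∀ (h : T → Y), MemLp h 2 μ → ∀ L : ℝ,
        Tendsto (fun n => ∫ t, ⟪h t, l n t⟫ ∂μ) atTop (𝓝 L) → ∫ t, ⟪h t, y t⟫ ∂μ = L := by
  have hm : ∀ n, MemLp (l n) 2 μ := fun n => MemLp.of_bound (hl n) K (hK n)
  set x : ℕ → Lp Y 2 μ := fun n => (hm n).toLp (l n) with hx
  have hxb : ∀ n, ‖x n‖ ≤ μ.real univ ^ ((2 : ℝ≥0∞).toReal)⁻¹ * max K 0 := fun n => by
    refine Lp.norm_le_of_ae_bound (le_max_right _ _) ?_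
    filter_upwards [(hm n).coeFn_toLp, hK n] with t h1 h2
    rw [h1]
    exact h2.trans (le_max_left _ _)
  obtain ⟨z, hz⟩ := exists_mem_closure_convexHull_tails hxb
  refine ⟨z, Lp.stronglyMeasurable z, ?_, ?_⟩
  · rw [ae_all_iff]
    intro n
    obtain ⟨w, hw, hwz⟩ := mem_closure_iff_seq_limit.1 (hz n)
    have hconv : Convex ℝ {v : Lp Y 2 μ |
        ∀ᵐ t ∂μ, v t ∈ convexHull ℝ ((fun k => l k t) '' Ici n)} := by
      intro v hv v' hv' a b ha hb hab
      filter_upwards [hv, hv', Lp.coeFn_add (a • v) (b • v'), Lp.coeFn_smul a v,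
        Lp.coeFn_smul b v'] with t h1 h2 h3 h4 h5
      rw [h3, Pi.add_apply, h4, h5]
      exact convex_convexHull ℝ _ h1 h2 ha hb hab
    have hsub : convexHull ℝ (x '' Ici n) ⊆ {v : Lp Y 2 μ |
        ∀ᵐ t ∂μ, v t ∈ convexHull ℝ ((fun k => l k t) '' Ici n)} := by
      refine convexHull_min ?_ hconv
      rintro _ ⟨k, hk, rfl⟩
      filter_upwards [(hm k).coeFn_toLp] with t h1
      rw [h1]
      exact subset_convexHull ℝ _ ⟨k, hk, rfl⟩
    obtain ⟨φ, -, hφ⟩ := (tendstoInMeasure_of_tendsto_Lp hwz).exists_seq_tendsto_ae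
    have hall : ∀ᵐ t ∂μ, ∀ j, w j t ∈ convexHull ℝ ((fun k => l k t) '' Ici n) :=
      ae_all_iff.2 fun j => hsub (hw j)
    filter_upwards [hφ, hall] with t h1 h2
    exact mem_closure_of_tendsto h1 (Eventually.of_forall fun j => h2 _)
  · intro h hh L hL
    have hin : ∀ (v : Lp Y 2 μ) (v' : T → Y), v =ᵐ[μ] v' →
        innerSL ℝ (hh.toLp h) v = ∫ t, ⟪h t, v' t⟫ ∂μ := fun v v' hv => by
      rw [innerSL_apply_apply, L2.inner_def]
      refine integral_congr_ae ?_
      filter_upwards [hh.coeFn_toLp, hv] with t h1 h2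
      rw [h1, h2]
    rw [← hin z z (ae_eq_refl _)]
    refine apply_eq_of_mem_closure_convexHull_tails hz _ (hL.congr fun n => ?_)
    exact (hin _ _ (hm n).coeFn_toLp).symm

end WeakCompactness

/-- Sequential compactness of uniformly bounded, uniformly Lipschitz functions on an interval. -/
theorem exists_subseq_tendsto_of_lipschitz {Y : Type*} [NormedAddCommGroup Y] [NormedSpace ℝ Y]
    [FiniteDimensional ℝ Y] {a b B K : ℝ} (hab : a ≤ b) {q : ℕ → ℝ → Y}
    (hB : ∀ n, ∀ t ∈ Icc a b, ‖q n t‖ ≤ B)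
    (hK : ∀ n, ∀ s ∈ Icc a b, ∀ t ∈ Icc a b, ‖q n s - q n t‖ ≤ K * |s - t|) :
    ∃ (q' : ℝ → Y) (φ : ℕ → ℕ), StrictMono φ ∧
      ∀ t ∈ Icc a b, Tendsto (fun n => q (φ n) t) atTop (𝓝 (q' t)) := by
  have hprop : ProperSpace Y := FiniteDimensional.proper ℝ Y
  have hlip : ∀ n, LipschitzWith K.toNNReal (fun t : Icc a b => q n t) := fun n =>
    LipschitzWith.of_dist_le_mul fun s t => by
      rw [dist_eq_norm, Subtype.dist_eq, Real.dist_eq]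
      refine (hK n s s.2 t t.2).trans ?_
      gcongr
      exact Real.le_coe_toNNReal K
  set F : ℕ → BoundedContinuousFunction (Icc a b) Y := fun n =>
    BoundedContinuousFunction.mkOfCompact ⟨_, (hlip n).continuous⟩ with hF
  set A : Set (BoundedContinuousFunction (Icc a b) Y) :=
    {f | (∀ t, f t ∈ Metric.closedBall (0 : Y) B) ∧
      ∀ s t, dist (f s) (f t) ≤ K.toNNReal * dist s t} with hA
  have hcont : ∀ t, Continuous fun f : BoundedContinuousFunction (Icc a b) Y => f t := fun t =>
    continuous_eval_const t
  have hAc : IsClosed A := by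
    have e : A = (⋂ t, {f | f t ∈ Metric.closedBall (0 : Y) B}) ∩
        ⋂ s, ⋂ t, {f | dist (f s) (f t) ≤ K.toNNReal * dist s t} := by
      ext f
      simp only [hA, mem_ofPred_eq, mem_inter_iff, mem_iInter]
    rw [e]
    refine IsClosed.inter ?_ ?_
    · exact isClosed_iInter fun t => Metric.isClosed_closedBall.preimage (hcont t)
    · exact isClosed_iInter fun s => isClosed_iInter fun t =>
        isClosed_le ((hcont s).dist (hcont t)) continuous_const
  have hcpt : IsCompact A := by
    refine BoundedContinuousFunction.arzela_ascoli₂ _ (isCompact_closedBall (0 : Y) B) A hAc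
      (fun f t hf => hf.1 t) ?_
    have : UniformEquicontinuous (fun f : A => (f.1 : Icc a b → Y)) :=
      LipschitzWith.uniformEquicontinuous _ K.toNNReal fun f => LipschitzWith.of_dist_le_mul f.2.2
    exact this.equicontinuous
  have hFA : ∀ n, F n ∈ A := fun n =>
    ⟨fun t => by simpa [hF] using hB n t t.2, fun s t => (hlip n).dist_le_mul s t⟩
  obtain ⟨f, -, φ, hφ, hlim⟩ := hcpt.tendsto_subseq hFA
  refine ⟨fun t => f (projIcc a b hab t), φ, hφ, fun t ht => ?_⟩
  have := ((hcont ⟨t, ht⟩).tendsto f).comp hlim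
  simp only [projIcc_of_mem hab ht]
  exact this

theorem exists_measurable_selection {H L T : Type*} [TopologicalSpace H]
    [TopologicalSpace.PseudoMetrizableSpace H] [MeasurableSpace H] [BorelSpace H]
    [TopologicalSpace L] [TopologicalSpace.SeparableSpace L] [MeasurableSpace L] [Zero L]
    [MeasurableSpace T] {μ : Measure T} {O : Set (H × L)} (hO : IsOpen O) {h : T → H}
    (hh : AEStronglyMeasurable h μ) :
    ∃ l : T → L, Measurable l ∧
      ∀ᵐ t ∂μ, (h t, l t) ∈ O ∨ ((∀ d, (h t, d) ∉ O) ∧ l t = 0) := by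
  classical
  have : Nonempty L := ⟨0⟩
  obtain ⟨s, hs⟩ := TopologicalSpace.exists_dense_seq L
  set h' := hh.mk h with hh'
  have hm : Measurable h' := hh.stronglyMeasurable_mk.measurable
  have hsec : ∀ d, MeasurableSet {t | (h' t, d) ∈ O} := fun d =>
    hm (hO.preimage (Continuous.prodMk_left d)).measurableSet
  set p : ℕ → T → Prop := fun n t => (h' t, s n) ∈ O ∨ ∀ k, (h' t, s k) ∉ O with hp
  have hpm : ∀ n, MeasurableSet {t | p n t} := fun n => by
    have : MeasurableSet {t | ∀ k, (h' t, s k) ∉ O} := by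
      simp only [ofPred_forall]
      exact MeasurableSet.iInter fun k => (hsec (s k)).compl
    exact (hsec (s n)).union this
  have hex : ∀ t, ∃ n, p n t := fun t => by
    by_cases hc : ∃ n, (h' t, s n) ∈ O
    · exact hc.imp fun n hn => Or.inl hn
    · exact ⟨0, Or.inr fun k hk => hc ⟨k, hk⟩⟩
  set f : ℕ → T → L := fun n t => if (h' t, s n) ∈ O then s n else 0 with hf
  have hfm : ∀ n, Measurable (f n) := fun n =>
    Measurable.ite (hsec (s n)) measurable_const measurable_const
  refine ⟨fun t => f (Nat.find (hex t)) t, Measurable.find hfm hpm hex, ?_⟩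
  filter_upwards [hh.ae_eq_mk] with t ht
  rw [ht]
  have hfd := Nat.find_spec (hex t)
  by_cases hc : (h' t, s (Nat.find (hex t))) ∈ O
  · left
    simp only [hf, if_pos hc]
    exact hc
  · right
    refine ⟨fun d hd => ?_, by simp only [hf, if_neg hc]⟩
    have hopen : IsOpen {d | (h' t, d) ∈ O} := hO.preimage (Continuous.prodMk_right _)
    obtain ⟨_, hd', ⟨k, rfl⟩⟩ := hs.inter_open_nonempty _ hopen ⟨d, hd⟩
    exact (hfd.resolve_left hc) k hd'

/-- Backward Gronwall inequality. -/
theorem gronwall_integral {u : ℝ → ℝ} {a b A k τ : ℝ} (hA : 0 ≤ A) (hk : 0 ≤ k)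
    (hτ : τ ∈ Icc a b) (hu : ContinuousOn u (Icc a b)) (hu0 : ∀ t ∈ Icc a b, 0 ≤ u t)
    (h : ∀ t ∈ Icc a b, u t ≤ A + k * |∫ s in τ..t, u s|) :
    ∀ t ∈ Icc a b, u t ≤ 2 * A * Real.exp (2 * k * (b - a)) := by
  set w : ℝ → ℝ := fun s => Real.exp (2 * k * |s - τ|) with hw
  have hwc : Continuous w := by fun_prop
  have hwpos : ∀ s, 0 < w s := fun s => Real.exp_pos _
  have hwint : ∀ t, 2 * k * |∫ s in τ..t, w s| = w t - 1 := fun t => by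
    rcases le_total τ t with htt | htt
    · have hd : ∀ s ∈ uIcc τ t, HasDerivAt (fun s => Real.exp (2 * k * (s - τ)))
          (2 * k * w s) s := fun s hs => by
        rw [uIcc_of_le htt] at hs
        have := (((hasDerivAt_id' s).sub_const τ).const_mul (2 * k)).exp
        rw [hw]
        simp only []
        rw [abs_of_nonneg (sub_nonneg.2 hs.1)]
        convert this using 1
        ring
      have h1 := intervalIntegral.integral_eq_sub_of_hasDerivAt hd
        ((hwc.const_mul (2 * k)).intervalIntegrable _ _)
      rw [intervalIntegral.integral_const_mul] at h1
      rw [abs_of_nonneg (intervalIntegral.integral_nonneg htt fun s _ => (hwpos s).le), h1]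
      simp only [hw]
      rw [abs_of_nonneg (sub_nonneg.2 htt)]
      simp
    · have hd : ∀ s ∈ uIcc t τ, HasDerivAt (fun s => -Real.exp (2 * k * (τ - s)))
          (2 * k * w s) s := fun s hs => by
        rw [uIcc_of_le htt] at hs
        have := ((((hasDerivAt_id' s).const_sub τ).const_mul (2 * k)).exp).neg
        rw [hw]
        simp only []
        rw [abs_of_nonpos (sub_nonpos.2 hs.2), neg_sub]
        refine this.congr_deriv ?_
        ring
      have h1 := intervalIntegral.integral_eq_sub_of_hasDerivAt hd
        ((hwc.const_mul (2 * k)).intervalIntegrable _ _)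
      rw [intervalIntegral.integral_const_mul] at h1
      rw [intervalIntegral.integral_symm, abs_neg,
        abs_of_nonneg (intervalIntegral.integral_nonneg htt fun s _ => (hwpos s).le), h1]
      simp only [hw]
      rw [abs_of_nonpos (sub_nonpos.2 htt), sub_self, mul_zero, Real.exp_zero, neg_sub]
      ring
  have hvc : ContinuousOn (fun t => u t / w t) (Icc a b) :=
    hu.div hwc.continuousOn fun t _ => (hwpos t).ne'
  obtain ⟨t', ht', hmax⟩ := isCompact_Icc.exists_isMaxOn ⟨τ, hτ⟩ hvc
  set Q := u t' / w t' with hQ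
  have hQu : ∀ s ∈ Icc a b, u s ≤ Q * w s := fun s hs => (div_le_iff₀ (hwpos s)).1 (hmax hs)
  have hQ0 : 0 ≤ Q := div_nonneg (hu0 _ ht') (hwpos _).le
  have hsub : uIcc τ t' ⊆ Icc a b := OrdConnected.uIcc_subset ordConnected_Icc hτ ht'
  have hI : |∫ s in τ..t', u s| ≤ Q * |∫ s in τ..t', w s| := by
    calc _ ≤ |∫ s in τ..t', Q * w s| := by
          rw [← Real.norm_eq_abs]
          refine intervalIntegral.norm_integral_le_abs_of_norm_le ?_
            ((hwc.const_mul Q).intervalIntegrable _ _)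
          filter_upwards [ae_restrict_mem measurableSet_uIoc] with s hs
          have hs' := hsub (uIoc_subset_uIcc hs)
          rw [Real.norm_of_nonneg (hu0 s hs')]
          exact hQu s hs'
      _ = _ := by rw [intervalIntegral.integral_const_mul, abs_mul, abs_of_nonneg hQ0]
  have hQA : Q ≤ 2 * A := by
    have h1 := h t' ht'
    have h2 := hwint t'
    have h3 : u t' = Q * w t' := (div_mul_cancel₀ _ (hwpos t').ne').symm
    have h4 : k * |∫ s in τ..t', u s| ≤ Q * (w t' - 1) / 2 := by
      rw [← h2]
      calc _ ≤ k * (Q * |∫ s in τ..t', w s|) := by gcongr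
        _ = _ := by ring
    have h5 : 1 ≤ w t' := Real.one_le_exp (by positivity)
    rw [h3] at h1
    nlinarith
  intro t htt
  refine (hQu t htt).trans ?_
  have h1 : w t ≤ Real.exp (2 * k * (b - a)) := by
    refine Real.exp_le_exp.2 (mul_le_mul_of_nonneg_left ?_ (by positivity))
    exact abs_sub_le_of_le_of_le htt.1 htt.2 hτ.1 hτ.2
  have h2 := (hwpos t).le
  gcongr

section Penalised

set_option linter.unusedSectionVars false

variable {X Q : Type} [NormedAddCommGroup X] [InnerProductSpace ℝ X] [FiniteDimensional ℝ X]
  [NormedAddCommGroup Q] [InnerProductSpace ℝ Q] [FiniteDimensional ℝ Q]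

namespace PenData

variable (D : PenData X Q)

/-- Fréchet normals to `M` near the reference tube have first component controlled by the second. -/
def NormalBound (ρ k : ℝ) : Prop :=
  ∀ᵐ t ∂D.μ, ∀ w ∈ D.M, ‖pl2fst w - pl2fst (D.ws t)‖ ≤ D.ε →
    ‖pl2snd w - pl2snd (D.ws t)‖ ≤ D.ϱ t → ∀ z ∈ D.M, ‖z - w‖ < ρ →
    ∀ ξ ∈ frechetNC D.M z, ‖pl2fst ξ‖ ≤ k * ‖pl2snd ξ‖

/-- A bound for the decrease of the penalised cost under a unit spike. -/
def spikeBound : ℝ := (4 + (D.t1 - D.t0)) * (2 * D.b) + 2 * D.ε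

theorem δ_le_b : D.δ ≤ D.b := (D.hδϱ 0).trans (D.hϱb 0)

theorem spikeBound_pos : 0 < D.spikeBound := by
  have h1 := D.hδ.trans_le D.δ_le_b
  have h2 := sub_pos.2 D.ht
  have h3 := D.hε
  unfold spikeBound
  positivity

variable {D}

namespace PenSol

variable {α C N : ℝ} (Z : D.PenSol α C N)

/-- The adjoint arc. -/
def p (t : ℝ) : X := D.adj (pl2snd Z.ec + pl2snd Z.ed) Z.r t

/-- The primal arc. -/
def x (t : ℝ) : X := D.tr ⟨Z.x0, Z.w, Z.c, Z.d⟩ t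

theorem continuousOn_p : ContinuousOn Z.p (Icc D.t0 D.t1) :=
  D.continuousOn_adj _ Z.integrable_r

theorem integral_r_sq_nonneg : 0 ≤ ∫ t, ‖Z.r t‖ ^ 2 ∂D.μ :=
  integral_nonneg fun _ => by positivity

theorem norm_ec_le : ‖Z.ec‖ ≤ 1 := by
  have := Z.normalised
  have := Z.integral_r_sq_nonneg
  nlinarith [sq_nonneg Z.lam, sq_nonneg ‖Z.ed‖, norm_nonneg Z.ec]

theorem norm_ed_le : ‖Z.ed‖ ≤ 1 := by
  have := Z.normalised
  have := Z.integral_r_sq_nonneg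
  nlinarith [sq_nonneg Z.lam, sq_nonneg ‖Z.ec‖, norm_nonneg Z.ed]

theorem lam_le : Z.lam ≤ 1 := by
  have := Z.normalised
  have := Z.integral_r_sq_nonneg
  nlinarith [sq_nonneg ‖Z.ed‖, sq_nonneg ‖Z.ec‖, Z.lam_nonneg]

theorem integral_norm_r_le : ∫ t, ‖Z.r t‖ ∂D.μ ≤ D.t1 - D.t0 + 1 := by
  have hT := sub_pos.2 D.ht
  have h1 : ∫ t, ‖Z.r t‖ ∂D.μ ≤ ∫ t, (1 + ‖Z.r t‖ ^ 2) ∂D.μ := by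
    refine integral_mono Z.integrable_r.norm ((integrable_const _).add Z.integrable_r_sq) fun t => ?_
    dsimp only
    nlinarith [sq_nonneg (‖Z.r t‖ - 1)]
  rw [integral_add (integrable_const _) Z.integrable_r_sq, integral_const,
    measureReal_restrict_apply_univ, Real.volume_real_Ioc_of_le D.ht.le, smul_eq_mul, mul_one] at h1
  have := Z.normalised
  nlinarith [sq_nonneg Z.lam, sq_nonneg ‖Z.ed‖, sq_nonneg ‖Z.ec‖]

theorem norm_p_le {t : ℝ} (htt : t ∈ Icc D.t0 D.t1) : ‖Z.p t‖ ≤ 3 + (D.t1 - D.t0) := by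
  have h1 : ‖∫ s in t..D.t1, Z.r s‖ ≤ ∫ t, ‖Z.r t‖ ∂D.μ := by
    rw [intervalIntegral.integral_of_le htt.2]
    refine (norm_integral_le_integral_norm _).trans ?_
    exact setIntegral_mono_set Z.integrable_r.norm (Eventually.of_forall fun _ => norm_nonneg _)
      (Ioc_subset_Ioc_left htt.1).eventuallyLE
  have h2 := Z.integral_norm_r_le
  have h3 := (norm_pl2snd_le Z.ec).trans Z.norm_ec_le
  have h4 := (norm_pl2snd_le Z.ed).trans Z.norm_ed_le
  rw [p, adj, norm_neg]
  linarith [norm_add_le (pl2snd Z.ec + pl2snd Z.ed) (∫ s in t..D.t1, Z.r s),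
    norm_add_le (pl2snd Z.ec) (pl2snd Z.ed)]

theorem ae_norm_x_sub_le : ∀ᵐ t ∂D.μ, ‖Z.x t - pl2fst (D.ws t)‖ ≤ 2 * α := by
  filter_upwards [D.hrel, ae_restrict_mem measurableSet_Ioc] with t h1 h2
  have h3 := D.norm_tr_sub_le (z := ⟨Z.x0, Z.w, Z.c, Z.d⟩) (z' := D.star) Z.integrable_w
    D.integrable_ws (Ioc_subset_Icc_self h2)
  have h4 : D.tr D.star t = pl2fst (D.ws t) := h1
  rw [h4] at h3
  refine h3.trans ?_
  have h5 := Z.dist_w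
  have h6 := Z.dist_x0
  simp only [star]
  linarith

theorem barrier_eq_zero (hN0 : 0 ≤ N) (hN : 2 ≤ N * D.δ) {t : ℝ} {q : Q}
    (hq : ‖q - pl2snd (D.ws t)‖ ≤ D.δ / 2) : D.barrier C N t q = 0 := by
  have h1 := D.hδϱ t
  have h2 : 1 ≤ N * (D.ϱ t - ‖q - pl2snd (D.ws t)‖) := by
    calc 1 ≤ N * (D.δ / 2) := by linarith
      _ ≤ _ := by gcongr; linarith
  rw [barrier, max_eq_left (by linarith), mul_zero]

theorem ae_spike_le {ρ k : ℝ} (hNB : D.NormalBound ρ k) (hρ : 0 < ρ) (hk : 0 ≤ k) (hα : 0 < α)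
    (hα1 : α ≤ 1) (hαε : 2 * α < D.ε) (hαρ : 2 * α < ρ / 4) (hαρ' : 16 * (2 * α) < ρ ^ 2)
    (hαk : 4 * (k + 1) ^ 2 * (2 * α) < 1) (hαδ : 2 * α < (D.δ / 2) ^ 2)
    (hN0 : 0 ≤ N) (hN : 2 ≤ N * D.δ) :
    ∀ᵐ t ∂D.μ, ‖Z.x t - pl2fst (Z.w t)‖ ^ 2 / (2 * Z.G) + D.barrier C N t (pl2snd (Z.w t)) ≤
      D.spikeBound := by
  have hb := D.hδ.trans_le D.δ_le_b
  have hδb := D.δ_le_b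
  have hT := sub_pos.2 D.ht
  filter_upwards [hNB, Z.ae_norm_x_sub_le, Z.var_w, Z.mem, D.hwsM,
    ae_restrict_mem measurableSet_Ioc] with t h1 h2 h3 h4 h5 htt
  obtain ⟨q, hqM, hq⟩ := exists_mem_near D.hM h5 hρ hk
    (h1 _ h5 (by simpa using D.hε.le) (by simpa using D.hδ.le.trans (D.hδϱ t)))
    (h2.trans_lt hαρ) (by linarith)
    (lt_of_le_of_lt (mul_le_mul_of_nonneg_left h2 (by positivity)) hαk)
  have hqδ : ‖q - pl2snd (D.ws t)‖ < D.δ / 2 :=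
    lt_of_pow_lt_pow_left₀ 2 (by linarith [D.hδ]) ((hq.trans h2).trans_lt hαδ)
  have h6 := h3 _ hqM (by rw [pl2fst_pl2]; exact h2.trans_lt hαε)
    (by rw [pl2snd_pl2]; linarith [D.hδϱ t, D.hδ])
  have hx : D.tr ⟨Z.x0, Z.w, Z.c, Z.d⟩ t = Z.x t := rfl
  have hp : D.adj (pl2snd Z.ec + pl2snd Z.ed) Z.r t = Z.p t := rfl
  rw [hx, hp, pl2fst_pl2, pl2snd_pl2, barrier_eq_zero hN0 hN hqδ.le, sub_self, norm_zero] at h6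
  have hqq : ‖q - pl2snd (Z.w t)‖ ≤ 2 * D.b := by
    have := norm_sub_le_norm_sub_add_norm_sub q (pl2snd (D.ws t)) (pl2snd (Z.w t))
    rw [norm_sub_rev (pl2snd (D.ws t))] at this
    linarith [h4.2.2, D.hϱb t]
  have hxx : ‖Z.x t - pl2fst (Z.w t)‖ ≤ 2 * D.ε := by
    have := norm_sub_le_norm_sub_add_norm_sub (Z.x t) (pl2fst (D.ws t)) (pl2fst (Z.w t))
    rw [norm_sub_rev (pl2fst (D.ws t)) (pl2fst (Z.w t))] at this
    linarith [h4.2.1]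
  have hv : ‖pl2 (Z.x t) q - Z.w t‖ ≤ 2 * D.ε + 2 * D.b := by
    refine (norm_le_pl2 _).trans ?_
    rw [pl2fst_sub, pl2snd_sub, pl2fst_pl2, pl2snd_pl2]
    exact add_le_add hxx hqq
  have hin : -⟪Z.p t, D.V (q - pl2snd (Z.w t))⟫ ≤ (3 + (D.t1 - D.t0)) * (2 * D.b) := by
    refine (neg_le_abs _).trans ((abs_real_inner_le_norm _ _).trans ?_)
    have := Z.norm_p_le (Ioc_subset_Icc_self htt)
    gcongr
    exact (D.hV _).trans hqq
  have hvα : α * ‖pl2 (Z.x t) q - Z.w t‖ ≤ 2 * D.ε + 2 * D.b := by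
    have := norm_nonneg (pl2 (Z.x t) q - Z.w t)
    nlinarith
  have e : (0 ^ 2 - ‖Z.x t - pl2fst (Z.w t)‖ ^ 2) / (2 * Z.G) =
    -(‖Z.x t - pl2fst (Z.w t)‖ ^ 2 / (2 * Z.G)) := by ring
  rw [e] at h6
  unfold spikeBound
  linarith

/-- First-order form of the spike inequality. -/
theorem ae_inner_le : ∀ᵐ t ∂D.μ, ∀ v ∈ D.M, ‖pl2fst v - pl2fst (D.ws t)‖ < D.ε →
    ‖pl2snd v - pl2snd (D.ws t)‖ < D.ϱ t →
    ⟪pl2 (Z.r t) (ContinuousLinearMap.adjoint D.V (Z.p t)), v - Z.w t⟫ ≤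
      ‖v - Z.w t‖ ^ 2 / (2 * Z.G) +
      (D.barrier C N t (pl2snd v) - D.barrier C N t (pl2snd (Z.w t))) + α * ‖v - Z.w t‖ := by
  filter_upwards [Z.var_w] with t h v hv h1 h2
  have h3 := h v hv h1 h2
  have hp : D.adj (pl2snd Z.ec + pl2snd Z.ed) Z.r t = Z.p t := rfl
  rw [hp, ← Z.r_eq] at h3
  have hr := Z.r_eq t
  have hG := Z.G_pos
  have e1 : D.tr ⟨Z.x0, Z.w, Z.c, Z.d⟩ t - pl2fst v =
      Z.G • Z.r t - (pl2fst v - pl2fst (Z.w t)) := by rw [hr]; abel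
  rw [e1, norm_sub_sq_real, inner_smul_left, conj_trivial] at h3
  rw [inner_pl2, pl2fst_pl2, pl2snd_pl2, ContinuousLinearMap.adjoint_inner_left, pl2fst_sub,
    pl2snd_sub]
  have h4 : ‖pl2fst v - pl2fst (Z.w t)‖ ^ 2 / (2 * Z.G) ≤ ‖v - Z.w t‖ ^ 2 / (2 * Z.G) := by
    rw [← pl2fst_sub]
    gcongr
    exact norm_pl2fst_le _
  have e2 : (‖Z.G • Z.r t‖ ^ 2 - 2 * (Z.G * ⟪Z.r t, pl2fst v - pl2fst (Z.w t)⟫) +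
      ‖pl2fst v - pl2fst (Z.w t)‖ ^ 2 - ‖Z.G • Z.r t‖ ^ 2) / (2 * Z.G) =
      ‖pl2fst v - pl2fst (Z.w t)‖ ^ 2 / (2 * Z.G) - ⟪Z.r t, pl2fst v - pl2fst (Z.w t)⟫ := by
    field_simp
    ring
  rw [e2] at h3
  linarith

theorem ae_near {κ : ℝ} (hκε : κ ≤ D.ε) (hκδ : κ ≤ D.δ / 2) (hα : 0 ≤ α)
    (hN0 : 0 ≤ N) (hN : 2 ≤ N * D.δ) :
    ∀ᵐ t ∂D.μ, ‖Z.w t - D.ws t‖ < κ → ∀ σ > 0, ∃ z ∈ D.M, ‖z - Z.w t‖ < σ ∧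
      ∃ ξ ∈ frechetNC D.M z,
        ‖ξ - pl2 (Z.r t) (ContinuousLinearMap.adjoint D.V (Z.p t))‖ ≤ 4 * α := by
  filter_upwards [Z.ae_inner_le, Z.mem] with t h1 h2 hlt σ hσ
  have hG := Z.G_pos
  suffices h : ∀ v ∈ D.M, ‖v - Z.w t‖ < min σ (κ - ‖Z.w t - D.ws t‖) →
      ⟪pl2 (Z.r t) (ContinuousLinearMap.adjoint D.V (Z.p t)), v - Z.w t⟫ ≤
        α * ‖v - Z.w t‖ + 1 / (2 * Z.G) * ‖v - Z.w t‖ ^ 2 by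
    obtain ⟨z, hz, ξ, hξ, h3, h4⟩ := exists_frechet_near D.hM h2.1 hα (by positivity)
      (lt_min hσ (by linarith)) h
    exact ⟨z, hz, h3.trans_le (min_le_left _ _), ξ, hξ, h4⟩
  intro v hv hvl
  have h5 : ‖v - D.ws t‖ < κ := by
    have := hvl.trans_le (min_le_right _ _)
    linarith [norm_sub_le_norm_sub_add_norm_sub v (Z.w t) (D.ws t)]
  have h6 : ‖pl2fst v - pl2fst (D.ws t)‖ < D.ε := by
    rw [← pl2fst_sub]; linarith [norm_pl2fst_le (v - D.ws t)]
  have h7 : ‖pl2snd v - pl2snd (D.ws t)‖ < D.δ / 2 := by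
    rw [← pl2snd_sub]; linarith [norm_pl2snd_le (v - D.ws t)]
  have h8 : ‖pl2snd (Z.w t) - pl2snd (D.ws t)‖ < D.δ / 2 := by
    rw [← pl2snd_sub]; linarith [norm_pl2snd_le (Z.w t - D.ws t)]
  have h9 := h1 v hv h6 (by linarith [D.hδϱ t, D.hδ])
  rw [barrier_eq_zero hN0 hN h7.le, barrier_eq_zero hN0 hN h8.le] at h9
  have e : 1 / (2 * Z.G) * ‖v - Z.w t‖ ^ 2 = ‖v - Z.w t‖ ^ 2 / (2 * Z.G) := by ring
  rw [e]
  linarith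

theorem ae_far {ρ k : ℝ} (hNB : D.NormalBound ρ k) (hρ : 0 < ρ) (hk : 0 ≤ k) (hα : 0 < α)
    (hα1 : α ≤ 1) (hαε : 2 * α < D.ε / 4) (hαρ : 2 * α < ρ / 4) (hαρ' : 16 * (2 * α) < ρ ^ 2)
    (hαk : 4 * (k + 1) ^ 2 * (2 * α) < 1) (hαδ : 2 * α < (D.δ / 2) ^ 2)
    (hN1 : 1 ≤ N) (hN : 2 ≤ N * D.δ) (hC : C = D.spikeBound + 1) :
    ∀ᵐ t ∂D.μ, ‖Z.r t‖ ≤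
      (8 * D.spikeBound / D.ε + (4 * (1 + C) + k * (3 + (D.t1 - D.t0) + 4 * (1 + C)))) * N := by
  have hT := sub_pos.2 D.ht
  have hs := D.spikeBound_pos
  have hε := D.hε
  have hN0 : 0 ≤ N := by linarith
  have hC0 : 0 ≤ C := by linarith
  filter_upwards [Z.ae_spike_le hNB hρ hk hα hα1 (by linarith) hαρ hαρ' hαk hαδ hN0 hN, hNB,
    Z.ae_norm_x_sub_le, Z.ae_inner_le, Z.mem, ae_restrict_mem measurableSet_Ioc]
    with t h1 h2 h3 h4 h5 htt
  have hG := Z.G_pos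
  have hβ := D.barrier_nonneg (N := N) hC0 t (pl2snd (Z.w t))
  have hr : ‖Z.x t - pl2fst (Z.w t)‖ = Z.G * ‖Z.r t‖ := by
    have := congrArg norm (Z.r_eq t)
    rw [norm_smul, Real.norm_of_nonneg hG.le] at this
    exact this.symm
  by_cases hfar : D.ε / 4 ≤ ‖Z.x t - pl2fst (Z.w t)‖
  · have h6 : ‖Z.x t - pl2fst (Z.w t)‖ ^ 2 / (2 * Z.G) =
        ‖Z.x t - pl2fst (Z.w t)‖ * ‖Z.r t‖ / 2 := by
      nth_rewrite 1 [sq, hr]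
      rw [hr]
      field_simp
    have h7 : D.ε / 4 * ‖Z.r t‖ ≤ 2 * D.spikeBound := by
      have : D.ε / 4 * ‖Z.r t‖ ≤ ‖Z.x t - pl2fst (Z.w t)‖ * ‖Z.r t‖ := by gcongr
      linarith
    have h8 : ‖Z.r t‖ ≤ 8 * D.spikeBound / D.ε := by
      rw [le_div_iff₀ hε]; linarith
    have h9 : 0 ≤ 8 * D.spikeBound / D.ε := by positivity
    have h10 : 0 ≤ 4 * (1 + C) + k * (3 + (D.t1 - D.t0) + 4 * (1 + C)) := by positivity
    nlinarith
  · push Not at hfar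
    have hy : ‖pl2fst (Z.w t) - pl2fst (D.ws t)‖ < D.ε := by
      have := norm_sub_le_norm_sub_add_norm_sub (pl2fst (Z.w t)) (Z.x t) (pl2fst (D.ws t))
      rw [norm_sub_rev (pl2fst (Z.w t)) (Z.x t)] at this
      linarith
    have hq : ‖pl2snd (Z.w t) - pl2snd (D.ws t)‖ < D.ϱ t := by
      refine lt_of_le_of_ne h5.2.2 fun he => ?_
      have : D.barrier C N t (pl2snd (Z.w t)) = C := by
        rw [barrier, he, sub_self, mul_zero, sub_zero, max_eq_right zero_le_one, mul_one]
      have h0 : 0 ≤ ‖Z.x t - pl2fst (Z.w t)‖ ^ 2 / (2 * Z.G) := by positivity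
      linarith
    obtain ⟨z, hz, ξ, hξ, h6, h7⟩ := exists_frechet_near D.hM h5.1 (a := α + C * N)
      (K := 1 / (2 * Z.G)) (v := pl2 (Z.r t) (ContinuousLinearMap.adjoint D.V (Z.p t)))
      (ρ := min ρ (min (D.ε - ‖pl2fst (Z.w t) - pl2fst (D.ws t)‖)
        (D.ϱ t - ‖pl2snd (Z.w t) - pl2snd (D.ws t)‖))) (by positivity) (by positivity)
      (lt_min hρ (lt_min (by linarith) (by linarith))) (by
        intro v hv hvl
        have h8 := hvl.trans_le ((min_le_right _ _).trans (min_le_left _ _))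
        have h9 := hvl.trans_le ((min_le_right _ _).trans (min_le_right _ _))
        have h10 : ‖pl2fst v - pl2fst (D.ws t)‖ < D.ε := by
          have := norm_sub_le_norm_sub_add_norm_sub (pl2fst v) (pl2fst (Z.w t)) (pl2fst (D.ws t))
          have h := norm_pl2fst_le (v - Z.w t)
          rw [pl2fst_sub] at h
          linarith
        have h11 : ‖pl2snd v - pl2snd (D.ws t)‖ < D.ϱ t := by
          have := norm_sub_le_norm_sub_add_norm_sub (pl2snd v) (pl2snd (Z.w t)) (pl2snd (D.ws t))
          have h := norm_pl2snd_le (v - Z.w t)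
          rw [pl2snd_sub] at h
          linarith
        have h12 := h4 v hv h10 h11
        have h13 := (le_abs_self _).trans
          (D.abs_barrier_sub_le hC0 hN0 t (pl2snd v) (pl2snd (Z.w t)))
        have h14 : C * N * ‖pl2snd v - pl2snd (Z.w t)‖ ≤ C * N * ‖v - Z.w t‖ := by
          have h := norm_pl2snd_le (v - Z.w t)
          rw [pl2snd_sub] at h
          gcongr
        have e : 1 / (2 * Z.G) * ‖v - Z.w t‖ ^ 2 = ‖v - Z.w t‖ ^ 2 / (2 * Z.G) := by ring
        rw [e, add_mul]
        linarith)
    have h8 := h2 _ h5.1 hy.le hq.le z hz (h6.trans_le (min_le_left _ _)) ξ hξ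
    have h9 := norm_pl2fst_le (ξ - pl2 (Z.r t) (ContinuousLinearMap.adjoint D.V (Z.p t)))
    have h10 := norm_pl2snd_le (ξ - pl2 (Z.r t) (ContinuousLinearMap.adjoint D.V (Z.p t)))
    rw [pl2fst_sub, pl2fst_pl2] at h9
    rw [pl2snd_sub, pl2snd_pl2] at h10
    have h11 : ‖ContinuousLinearMap.adjoint D.V (Z.p t)‖ ≤ 3 + (D.t1 - D.t0) := by
      refine le_trans ?_ (Z.norm_p_le (Ioc_subset_Icc_self htt))
      refine (ContinuousLinearMap.le_opNorm _ _).trans ?_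
      have : ‖ContinuousLinearMap.adjoint D.V‖ ≤ 1 := by
        rw [LinearIsometryEquiv.norm_map]
        exact ContinuousLinearMap.opNorm_le_bound _ zero_le_one fun q => by
          rw [one_mul]; exact D.hV q
      nlinarith [norm_nonneg (Z.p t)]
    have h12 : ‖Z.r t‖ ≤ ‖pl2fst ξ‖ + 4 * (α + C * N) := by
      have := norm_sub_norm_le (Z.r t) (pl2fst ξ)
      rw [norm_sub_rev] at this
      linarith
    have h13 : ‖pl2snd ξ‖ ≤ 3 + (D.t1 - D.t0) + 4 * (α + C * N) := by
      have := norm_sub_norm_le (pl2snd ξ) (ContinuousLinearMap.adjoint D.V (Z.p t))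
      linarith
    have h14 : α + C * N ≤ (1 + C) * N := by linarith [add_mul 1 C N]
    have h15 : 0 ≤ 8 * D.spikeBound / D.ε * N := by positivity
    have h16 : 3 + (D.t1 - D.t0) ≤ (3 + (D.t1 - D.t0)) * N :=
      le_mul_of_one_le_right (by linarith) hN1
    calc ‖Z.r t‖ ≤ k * (3 + (D.t1 - D.t0) + 4 * (α + C * N)) + 4 * (α + C * N) := by
          refine h12.trans (add_le_add_left ?_ _)
          exact h8.trans (mul_le_mul_of_nonneg_left h13 hk)
      _ ≤ k * ((3 + (D.t1 - D.t0)) * N + 4 * ((1 + C) * N)) + 4 * ((1 + C) * N) :=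
          add_le_add (mul_le_mul_of_nonneg_left (by linarith) hk) (by linarith)
      _ = (4 * (1 + C) + k * (3 + (D.t1 - D.t0) + 4 * (1 + C))) * N := by ring
      _ ≤ _ := by rw [add_mul (8 * D.spikeBound / D.ε)]; linarith

end PenSol

end PenData

end Penalised

section Penalised

set_option linter.unusedSectionVars false

variable {X Q : Type} [NormedAddCommGroup X] [InnerProductSpace ℝ X] [FiniteDimensional ℝ X]
  [NormedAddCommGroup Q] [InnerProductSpace ℝ Q] [FiniteDimensional ℝ Q]

namespace PenData

variable {D : PenData X Q}

namespace PenSol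

variable {α C N : ℝ} (Z : D.PenSol α C N)

/-- The residual multiplier, cut off where the process is far from the reference process. -/
def cut (κ : ℝ) : ℝ → X := {t | ‖Z.w t - D.ws t‖ < κ}.indicator Z.r

theorem integrable_dist : Integrable (fun t => ‖Z.w t - D.ws t‖) D.μ :=
  (Z.integrable_w.sub D.integrable_ws).norm

theorem integrable_cut (κ : ℝ) : Integrable (Z.cut κ) D.μ :=
  Z.integrable_r.indicator₀ (nullMeasurableSet_lt
    Z.integrable_dist.aestronglyMeasurable.aemeasurable aemeasurable_const)

theorem ae_near_le {ρ k κ : ℝ} (hNB : D.NormalBound ρ k) (hρ : 0 < ρ) (hk : 0 ≤ k)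
    (hκε : κ ≤ D.ε) (hκδ : κ ≤ D.δ / 2) (hα : 0 ≤ α) (hN0 : 0 ≤ N) (hN : 2 ≤ N * D.δ) :
    ∀ᵐ t ∂D.μ, ‖Z.w t - D.ws t‖ < κ → ‖Z.r t‖ ≤ k * ‖Z.p t‖ + 4 * (k + 1) * α := by
  filter_upwards [Z.ae_near hκε hκδ hα hN0 hN, hNB, Z.mem] with t h1 h2 h3 hlt
  obtain ⟨z, hz, h4, ξ, hξ, h5⟩ := h1 hlt ρ hρ
  have h6 := h2 _ h3.1 h3.2.1 h3.2.2 z hz h4 ξ hξ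
  have h9 := norm_pl2fst_le (ξ - pl2 (Z.r t) (ContinuousLinearMap.adjoint D.V (Z.p t)))
  have h10 := norm_pl2snd_le (ξ - pl2 (Z.r t) (ContinuousLinearMap.adjoint D.V (Z.p t)))
  rw [pl2fst_sub, pl2fst_pl2] at h9
  rw [pl2snd_sub, pl2snd_pl2] at h10
  have h11 : ‖ContinuousLinearMap.adjoint D.V (Z.p t)‖ ≤ ‖Z.p t‖ := by
    have : ‖ContinuousLinearMap.adjoint D.V‖ ≤ 1 := by
      rw [LinearIsometryEquiv.norm_map]
      exact ContinuousLinearMap.opNorm_le_bound _ zero_le_one fun q => by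
        rw [one_mul]; exact D.hV q
    exact (ContinuousLinearMap.le_of_opNorm_le _ this _).trans_eq (one_mul _)
  have h12 : ‖Z.r t‖ ≤ ‖pl2fst ξ‖ + 4 * α := by
    have := norm_sub_norm_le (Z.r t) (pl2fst ξ)
    rw [norm_sub_rev] at this
    linarith
  have h13 : ‖pl2snd ξ‖ ≤ ‖Z.p t‖ + 4 * α := by
    have := norm_sub_norm_le (pl2snd ξ) (ContinuousLinearMap.adjoint D.V (Z.p t))
    linarith
  have := mul_le_mul_of_nonneg_left h13 hk
  linarith

theorem integral_sub_cut_le {κ B : ℝ} (hκ : 0 < κ) (hB0 : 0 ≤ B)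
    (hB : ∀ᵐ t ∂D.μ, ‖Z.r t‖ ≤ B) :
    ∫ t, ‖Z.r t - Z.cut κ t‖ ∂D.μ ≤ B / κ * α := by
  have h1 : ∫ t, ‖Z.r t - Z.cut κ t‖ ∂D.μ ≤ ∫ t, B / κ * ‖Z.w t - D.ws t‖ ∂D.μ := by
    refine integral_mono_ae (Z.integrable_r.sub (Z.integrable_cut κ)).norm
      (Z.integrable_dist.const_mul _) ?_
    filter_upwards [hB] with t ht
    by_cases hlt : ‖Z.w t - D.ws t‖ < κ
    · rw [cut, indicator_of_mem (by exact hlt), sub_self, norm_zero]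
      positivity
    · rw [cut, indicator_of_notMem (by exact hlt), sub_zero]
      push Not at hlt
      refine ht.trans ?_
      rw [div_mul_eq_mul_div, le_div_iff₀ hκ]
      exact mul_le_mul_of_nonneg_left hlt hB0
  refine h1.trans ?_
  rw [integral_const_mul]
  exact mul_le_mul_of_nonneg_left Z.dist_w (by positivity)

theorem integral_sq_le {κ B k P : ℝ} (hκ : 0 < κ) (hk : 0 ≤ k)
    (hB : ∀ᵐ t ∂D.μ, ‖Z.r t‖ ≤ B)
    (hnear : ∀ᵐ t ∂D.μ, ‖Z.w t - D.ws t‖ < κ → ‖Z.r t‖ ≤ k * ‖Z.p t‖ + 4 * (k + 1) * α)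
    (hP : ∀ t ∈ Icc D.t0 D.t1, ‖Z.p t‖ ≤ P) :
    ∫ t, ‖Z.r t‖ ^ 2 ∂D.μ ≤
      (D.t1 - D.t0) * (k * P + 4 * (k + 1) * α) ^ 2 + B ^ 2 / κ * α := by
  have h1 : ∫ t, ‖Z.r t‖ ^ 2 ∂D.μ ≤
      ∫ t, ((k * P + 4 * (k + 1) * α) ^ 2 + B ^ 2 / κ * ‖Z.w t - D.ws t‖) ∂D.μ := by
    refine integral_mono_ae Z.integrable_r_sq
      ((integrable_const _).add (Z.integrable_dist.const_mul _)) ?_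
    filter_upwards [hB, hnear, ae_restrict_mem measurableSet_Ioc] with t h1 h2 htt
    by_cases hlt : ‖Z.w t - D.ws t‖ < κ
    · have h3 : ‖Z.r t‖ ≤ k * P + 4 * (k + 1) * α := (h2 hlt).trans
        (add_le_add_left (mul_le_mul_of_nonneg_left (hP t (Ioc_subset_Icc_self htt)) hk) _)
      have h4 : 0 ≤ B ^ 2 / κ * ‖Z.w t - D.ws t‖ := by positivity
      have := pow_le_pow_left₀ (norm_nonneg _) h3 2
      linarith
    · push Not at hlt
      have h3 : ‖Z.r t‖ ^ 2 ≤ B ^ 2 := pow_le_pow_left₀ (norm_nonneg _) h1 2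
      have h4 : B ^ 2 ≤ B ^ 2 / κ * ‖Z.w t - D.ws t‖ := by
        rw [div_mul_eq_mul_div, le_div_iff₀ hκ]
        exact mul_le_mul_of_nonneg_left hlt (sq_nonneg _)
      have := sq_nonneg (k * P + 4 * (k + 1) * α)
      linarith
  refine h1.trans ?_
  rw [integral_add (integrable_const _) (Z.integrable_dist.const_mul _), integral_const,
    measureReal_restrict_apply_univ, Real.volume_real_Ioc_of_le D.ht.le, smul_eq_mul,
    integral_const_mul]
  have := mul_le_mul_of_nonneg_left Z.dist_w (show 0 ≤ B ^ 2 / κ by positivity)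
  linarith

end PenSol

/-- A sequence of solutions of penalised problems with vanishing penalisation error. -/
structure PenSeq (D : PenData X Q) (k κ : ℝ) where
  α : ℕ → ℝ
  N : ℕ → ℝ
  e : ℕ → ℝ
  C : ℝ
  Z : ∀ n, D.PenSol (α n) C (N n)
  C_nonneg : 0 ≤ C
  α_pos : ∀ n, 0 < α n
  α_le_one : ∀ n, α n ≤ 1
  α_tendsto : Tendsto α atTop (𝓝 0)
  e_tendsto : Tendsto e atTop (𝓝 0)
  N_nonneg : ∀ n, 0 ≤ N n
  N_tendsto : Tendsto N atTop atTop
  N_δ : ∀ n, 2 ≤ N n * D.δ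
  near_le : ∀ n, ∀ᵐ t ∂D.μ, ‖(Z n).w t - D.ws t‖ < κ →
    ‖(Z n).r t‖ ≤ k * ‖(Z n).p t‖ + 4 * (k + 1) * α n
  sub_cut_le : ∀ n, ∫ t, ‖(Z n).r t - (Z n).cut κ t‖ ∂D.μ ≤ e n
  sq_le : ∀ n, ∀ P, (∀ t ∈ Icc D.t0 D.t1, ‖(Z n).p t‖ ≤ P) →
    ∫ t, ‖(Z n).r t‖ ^ 2 ∂D.μ ≤ (D.t1 - D.t0) * (k * P + 4 * (k + 1) * α n) ^ 2 + e n

theorem exists_penSeq {ρ k κ : ℝ} (hNB : D.NormalBound ρ k) (hρ : 0 < ρ) (hk : 0 ≤ k)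
    (hκ : 0 < κ) (hκε : κ ≤ D.ε) (hκδ : κ ≤ D.δ / 2) : Nonempty (D.PenSeq k κ) := by
  have hδ := D.hδ
  have hε := D.hε
  have hs := D.spikeBound_pos
  have hT := sub_pos.2 D.ht
  have hk1 : 0 < 16 * (k + 1) ^ 2 := by positivity
  set C := D.spikeBound + 1 with hC
  have hC0 : 0 ≤ C := by linarith
  set B := 8 * D.spikeBound / D.ε + (4 * (1 + C) + k * (3 + (D.t1 - D.t0) + 4 * (1 + C))) with hB
  have hB0 : 0 ≤ B := by positivity
  obtain ⟨c, hc, hc1, hc2, hc3, hc4, hc5, hc6⟩ : ∃ c > 0, c ≤ 1 ∧ c ≤ D.ε / 16 ∧ c ≤ ρ / 16 ∧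
      c ≤ ρ ^ 2 / 64 ∧ c ≤ 1 / (16 * (k + 1) ^ 2) ∧ c ≤ (D.δ / 2) ^ 2 / 4 := by
    refine ⟨min 1 (min (D.ε / 16) (min (ρ / 16) (min (ρ ^ 2 / 64)
      (min (1 / (16 * (k + 1) ^ 2)) ((D.δ / 2) ^ 2 / 4))))), ?_, ?_⟩
    · refine lt_min one_pos (lt_min ?_ (lt_min ?_ (lt_min ?_ (lt_min ?_ ?_)))) <;> positivity
    · simp only [min_le_iff, le_refl, true_or, or_true, and_self]
  set N : ℕ → ℝ := fun n => n + max 1 (2 / D.δ) with hNdef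
  have hN1 : ∀ n, 1 ≤ N n := fun n => by
    have := le_max_left 1 (2 / D.δ)
    have : (0 : ℝ) ≤ n := n.cast_nonneg
    simp only [hNdef]; linarith
  have hNδ : ∀ n, 2 ≤ N n * D.δ := fun n => by
    have := le_max_right 1 (2 / D.δ)
    have : (0 : ℝ) ≤ n := n.cast_nonneg
    rw [← div_le_iff₀ hδ]
    simp only [hNdef]; linarith
  have hNt : Tendsto N atTop atTop :=
    tendsto_atTop_add_const_right _ _ tendsto_natCast_atTop_atTop
  have hNp : ∀ n, 0 < N n := fun n => one_pos.trans_le (hN1 n)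
  set α : ℕ → ℝ := fun n => c / N n ^ 3 with hαdef
  have hαp : ∀ n, 0 < α n := fun n => div_pos hc (pow_pos (hNp n) 3)
  have hαc : ∀ n, α n ≤ c := fun n => div_le_self hc.le (one_le_pow₀ (hN1 n))
  have hαN1 : ∀ n, N n * α n ≤ c / N n := fun n => by
    simp only [hαdef]
    rw [mul_div_assoc', div_le_div_iff₀ (pow_pos (hNp n) 3) (hNp n)]
    have h1 : N n ^ 2 ≤ N n ^ 3 := pow_le_pow_right₀ (hN1 n) (by norm_num)
    nlinarith [mul_le_mul_of_nonneg_left h1 hc.le]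
  have hαN2 : ∀ n, N n ^ 2 * α n = c / N n := fun n => by
    have := (hNp n).ne'
    simp only [hαdef]
    field_simp
  have hαt : Tendsto α atTop (𝓝 0) := by
    refine squeeze_zero (fun n => (hαp n).le) (fun n => ?_) (hNt.const_div_atTop c)
    exact div_le_div_of_nonneg_left hc.le (hNp n) (le_self_pow₀ (hN1 n) (by norm_num))
  have hS : ∀ n, Nonempty (D.PenSol (α n) C (N n)) := fun n =>
    D.exists_penSol (hαp n) (by linarith [hαc n]) hC0 (by linarith [hNδ n])
  have Z : ∀ n, D.PenSol (α n) C (N n) := fun n => (hS n).some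
  have hk5 : ∀ n, 4 * (k + 1) ^ 2 * (2 * α n) < 1 := fun n => by
    have := (hαc n).trans hc5
    rw [le_div_iff₀ hk1] at this
    nlinarith [hαp n]
  have hδ6 : ∀ n, 2 * α n < (D.δ / 2) ^ 2 := fun n => by
    have := hαc n
    have : 0 < (D.δ / 2) ^ 2 := by positivity
    linarith
  have hρ4 : ∀ n, 16 * (2 * α n) < ρ ^ 2 := fun n => by
    have := hαc n
    have : 0 < ρ ^ 2 := by positivity
    linarith
  have hfar : ∀ n, ∀ᵐ t ∂D.μ, ‖(Z n).r t‖ ≤ B * N n := fun n =>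
    (Z n).ae_far hNB hρ hk (hαp n) ((hαc n).trans hc1) (by linarith [hαc n])
      (by linarith [hαc n]) (hρ4 n) (hk5 n) (hδ6 n) (hN1 n) (hNδ n) hC
  have hnear := fun n => (Z n).ae_near_le hNB hρ hk hκε hκδ (hαp n).le (hNp n).le (hNδ n)
  refine ⟨⟨α, N, fun n => (B + B ^ 2) / κ * (c / N n), C, Z, hC0, hαp,
    fun n => (hαc n).trans hc1, hαt, ?_, fun n => (hNp n).le, hNt, hNδ, hnear, ?_, ?_⟩⟩
  · simpa using (hNt.const_div_atTop c).const_mul ((B + B ^ 2) / κ)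
  · intro n
    have h0 : 0 ≤ c / N n := div_nonneg hc.le (hNp n).le
    refine ((Z n).integral_sub_cut_le hκ (mul_nonneg hB0 (hNp n).le) (hfar n)).trans ?_
    calc B * N n / κ * α n = B / κ * (N n * α n) := by ring
      _ ≤ B / κ * (c / N n) := mul_le_mul_of_nonneg_left (hαN1 n) (by positivity)
      _ ≤ (B + B ^ 2) / κ * (c / N n) := by
        have : 0 ≤ B ^ 2 := sq_nonneg B
        gcongr
        linarith
  · intro n P hP
    have h0 : 0 ≤ c / N n := div_nonneg hc.le (hNp n).le
    refine ((Z n).integral_sq_le hκ hk (hfar n) (hnear n) hP).trans ?_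
    refine add_le_add_right ?_ _
    calc (B * N n) ^ 2 / κ * α n = B ^ 2 / κ * (N n ^ 2 * α n) := by ring
      _ = B ^ 2 / κ * (c / N n) := by rw [hαN2]
      _ ≤ (B + B ^ 2) / κ * (c / N n) := by
        gcongr
        linarith

namespace PenSeq

variable {k κ : ℝ}

/-- A subsequence of a sequence of penalised solutions. -/
def subseq (s : D.PenSeq k κ) {φ : ℕ → ℕ} (hφ : StrictMono φ) : D.PenSeq k κ where
  α n := s.α (φ n)
  N n := s.N (φ n)
  e n := s.e (φ n)
  C := s.C
  Z n := s.Z (φ n)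
  C_nonneg := s.C_nonneg
  α_pos n := s.α_pos (φ n)
  α_le_one n := s.α_le_one (φ n)
  α_tendsto := s.α_tendsto.comp hφ.tendsto_atTop
  e_tendsto := s.e_tendsto.comp hφ.tendsto_atTop
  N_nonneg n := s.N_nonneg (φ n)
  N_tendsto := s.N_tendsto.comp hφ.tendsto_atTop
  N_δ n := s.N_δ (φ n)
  near_le n := s.near_le (φ n)
  sub_cut_le n := s.sub_cut_le (φ n)
  sq_le n := s.sq_le (φ n)

variable (s : D.PenSeq k κ)

theorem exists_subseq_ends : ∃ (φ : ℕ → ℕ) (ec ed : PL2 X X) (lam : ℝ), StrictMono φ ∧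
    Tendsto (fun n => (s.Z (φ n)).ec) atTop (𝓝 ec) ∧
    Tendsto (fun n => (s.Z (φ n)).ed) atTop (𝓝 ed) ∧
    Tendsto (fun n => (s.Z (φ n)).lam) atTop (𝓝 lam) := by
  have hK : IsCompact (Metric.closedBall (0 : PL2 X X × PL2 X X × ℝ) 1) :=
    isCompact_closedBall _ _
  obtain ⟨⟨ec, ed, lam⟩, -, φ, hφ, h⟩ := hK.tendsto_subseq
    (x := fun n => ((s.Z n).ec, (s.Z n).ed, (s.Z n).lam)) fun n => by
      rw [mem_closedBall_zero_iff, Prod.norm_def, Prod.norm_def]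
      refine max_le (s.Z n).norm_ec_le (max_le (s.Z n).norm_ed_le ?_)
      rw [Real.norm_of_nonneg (s.Z n).lam_nonneg]
      exact (s.Z n).lam_le
  rw [nhds_prod_eq, nhds_prod_eq] at h
  exact ⟨φ, ec, ed, lam, hφ, h.fst, h.snd.fst, h.snd.snd⟩

theorem exists_subseq_ae : ∃ φ : ℕ → ℕ, StrictMono φ ∧
    ∀ᵐ t ∂D.μ, Tendsto (fun n => (s.Z (φ n)).w t) atTop (𝓝 (D.ws t)) := by
  have hm : ∀ n, AEStronglyMeasurable (s.Z n).w D.μ :=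
    fun n => (s.Z n).integrable_w.aestronglyMeasurable
  refine (tendstoInMeasure_of_tendsto_eLpNorm (p := 1) one_ne_zero hm
    D.hws.aestronglyMeasurable ?_).exists_seq_tendsto_ae
  have h1 : ∀ n, eLpNorm ((s.Z n).w - D.ws) 1 D.μ ≤ ENNReal.ofReal (s.α n) := fun n => by
    rw [eLpNorm_one_eq_lintegral_enorm,
      ← ofReal_integral_norm_eq_lintegral_enorm ((s.Z n).integrable_w.sub D.integrable_ws)]
    exact ENNReal.ofReal_le_ofReal (s.Z n).dist_w
  refine tendsto_of_tendsto_of_tendsto_of_le_of_le tendsto_const_nhds ?_ (fun _ => zero_le) h1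
  simpa using ENNReal.tendsto_ofReal s.α_tendsto

theorem norm_integral_le {t t' : ℝ} (ht : t ∈ Icc D.t0 D.t1) (ht' : t' ∈ Icc D.t0 D.t1)
    {h : ℝ → X} (hh : Integrable h D.μ) : ‖∫ s in t..t', h s‖ ≤ ∫ s, ‖h s‖ ∂D.μ := by
  refine intervalIntegral.norm_integral_le_integral_norm_uIoc.trans ?_
  refine setIntegral_mono_set hh.norm (Eventually.of_forall fun _ => norm_nonneg _) ?_
  rw [uIoc]
  exact (Ioc_subset_Ioc (le_min ht.1 ht'.1) (max_le ht.2 ht'.2)).eventuallyLE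

theorem ae_norm_cut_le (hk : 0 ≤ k) (n : ℕ) :
    ∀ᵐ t ∂D.μ, ‖(s.Z n).cut κ t‖ ≤ k * (3 + (D.t1 - D.t0)) + 4 * (k + 1) := by
  have hT := sub_pos.2 D.ht
  filter_upwards [s.near_le n, ae_restrict_mem measurableSet_Ioc] with t h1 htt
  by_cases hlt : ‖(s.Z n).w t - D.ws t‖ < κ
  · rw [PenSol.cut, indicator_of_mem (by exact hlt)]
    refine (h1 hlt).trans (add_le_add ?_ ?_)
    · exact mul_le_mul_of_nonneg_left ((s.Z n).norm_p_le (Ioc_subset_Icc_self htt)) hk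
    · exact mul_le_of_le_one_right (by positivity) (s.α_le_one n)
  · rw [PenSol.cut, indicator_of_notMem (by exact hlt), norm_zero]
    positivity

theorem intervalIntegrable {h : ℝ → X} (hh : Integrable h D.μ) {t t' : ℝ}
    (ht : t ∈ Icc D.t0 D.t1) (ht' : t' ∈ Icc D.t0 D.t1) : IntervalIntegrable h volume t t' := by
  have h1 : IntervalIntegrable h volume D.t0 D.t1 :=
    (intervalIntegrable_iff_integrableOn_Ioc_of_le D.ht.le).2 hh
  refine h1.mono_set ?_
  rw [uIcc_of_le D.ht.le]
  exact uIcc_subset_Icc ht ht'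

theorem exists_subseq_p (hk : 0 ≤ k) : ∃ (φ : ℕ → ℕ) (p : ℝ → X), StrictMono φ ∧
    ∀ t ∈ Icc D.t0 D.t1, Tendsto (fun n => (s.Z (φ n)).p t) atTop (𝓝 (p t)) := by
  have hT := sub_pos.2 D.ht
  have h1m : D.t1 ∈ Icc D.t0 D.t1 := right_mem_Icc.2 D.ht.le
  set K := k * (3 + (D.t1 - D.t0)) + 4 * (k + 1) with hK
  have hint : ∀ n, ∀ t ∈ Icc D.t0 D.t1, ∀ t' ∈ Icc D.t0 D.t1,
      ‖∫ τ in t..t', (s.Z n).cut κ τ‖ ≤ K * |t' - t| := fun n t ht t' ht' => by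
    refine intervalIntegral.norm_integral_le_of_norm_le_const_ae ?_
    have := (ae_restrict_iff' measurableSet_Ioc).1 (s.ae_norm_cut_le hk n)
    filter_upwards [this] with τ h hτ
    refine h ?_
    rw [uIoc] at hτ
    exact Ioc_subset_Ioc (le_min ht.1 ht'.1) (max_le ht.2 ht'.2) hτ
  have hii : ∀ n, ∀ t ∈ Icc D.t0 D.t1, ∀ t' ∈ Icc D.t0 D.t1,
      IntervalIntegrable ((s.Z n).cut κ) volume t t' := fun n t ht t' ht' =>
    intervalIntegrable ((s.Z n).integrable_cut κ) ht ht'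
  obtain ⟨p, φ, hφ, hp⟩ := exists_subseq_tendsto_of_lipschitz (a := D.t0) (b := D.t1)
    (B := 2 + K * (D.t1 - D.t0)) (K := K) D.ht.le
    (q := fun n t => -(pl2snd (s.Z n).ec + pl2snd (s.Z n).ed + ∫ τ in t..D.t1, (s.Z n).cut κ τ))
    (fun n t ht => by
      have h3 := (norm_pl2snd_le (s.Z n).ec).trans (s.Z n).norm_ec_le
      have h4 := (norm_pl2snd_le (s.Z n).ed).trans (s.Z n).norm_ed_le
      have h5 := hint n t ht D.t1 h1m
      have h6 : K * |D.t1 - t| ≤ K * (D.t1 - D.t0) := by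
        rw [abs_of_nonneg (by linarith [ht.2])]
        refine mul_le_mul_of_nonneg_left (by linarith [ht.1]) (by positivity)
      rw [norm_neg]
      linarith [norm_add_le (pl2snd (s.Z n).ec + pl2snd (s.Z n).ed)
        (∫ τ in t..D.t1, (s.Z n).cut κ τ), norm_add_le (pl2snd (s.Z n).ec) (pl2snd (s.Z n).ed)])
    (fun n t ht t' ht' => by
      have h5 := hint n t ht t' ht'
      have h6 := intervalIntegral.integral_add_adjacent_intervals (hii n t ht t' ht')
        (hii n t' ht' D.t1 h1m)
      rw [← h6, abs_sub_comm, neg_sub_neg, ← norm_neg]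
      refine le_of_eq_of_le ?_ h5
      congr 1
      abel)
  refine ⟨φ, p, hφ, fun t ht => ?_⟩
  refine (hp t ht).congr_dist (squeeze_zero (fun _ => dist_nonneg) (fun n => ?_)
    (s.e_tendsto.comp hφ.tendsto_atTop))
  rw [dist_eq_norm, PenSol.p, adj, neg_sub_neg, add_sub_add_left_eq_sub,
    ← intervalIntegral.integral_sub (intervalIntegrable (s.Z (φ n)).integrable_r ht h1m)
      (hii _ t ht D.t1 h1m)]
  exact (norm_integral_le ht h1m
    ((s.Z (φ n)).integrable_r.sub ((s.Z (φ n)).integrable_cut κ))).trans (s.sub_cut_le (φ n))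

/-- Convergence of a sequence of penalised solutions. -/
structure Converges (ec ed : PL2 X X) (lam : ℝ) (p : ℝ → X) : Prop where
  ec : Tendsto (fun n => (s.Z n).ec) atTop (𝓝 ec)
  ed : Tendsto (fun n => (s.Z n).ed) atTop (𝓝 ed)
  lam : Tendsto (fun n => (s.Z n).lam) atTop (𝓝 lam)
  w : ∀ᵐ t ∂D.μ, Tendsto (fun n => (s.Z n).w t) atTop (𝓝 (D.ws t))
  p : ∀ t ∈ Icc D.t0 D.t1, Tendsto (fun n => (s.Z n).p t) atTop (𝓝 (p t))

theorem exists_converges (s : D.PenSeq k κ) (hk : 0 ≤ k) : ∃ (s' : D.PenSeq k κ) (ec ed : PL2 X X) (lam : ℝ)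
    (p : ℝ → X), s'.Converges ec ed lam p := by
  obtain ⟨φ, ec, ed, lam, hφ, h1, h2, h3⟩ := s.exists_subseq_ends
  obtain ⟨ψ, hψ, h4⟩ := (s.subseq hφ).exists_subseq_ae
  obtain ⟨χ, p, hχ, h5⟩ := ((s.subseq hφ).subseq hψ).exists_subseq_p hk
  have h6 := (hψ.comp hχ).tendsto_atTop
  refine ⟨((s.subseq hφ).subseq hψ).subseq hχ, ec, ed, lam, p, h1.comp h6, h2.comp h6,
    h3.comp h6, ?_, h5⟩
  filter_upwards [h4] with t h
  exact h.comp hχ.tendsto_atTop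

end PenSeq

end PenData

end Penalised

section Penalised

set_option linter.unusedSectionVars false

variable {X Q : Type} [NormedAddCommGroup X] [InnerProductSpace ℝ X] [FiniteDimensional ℝ X]
  [NormedAddCommGroup Q] [InnerProductSpace ℝ Q] [FiniteDimensional ℝ Q]

namespace PenData.PenSeq.Converges

variable {D : PenData X Q} {k κ : ℝ} {s : D.PenSeq k κ} {ec ed : PL2 X X} {lam : ℝ} {p : ℝ → X}

theorem tendsto_c : Tendsto (fun n => (s.Z n).c) atTop (𝓝 (D.ends D.star)) :=
  tendsto_iff_norm_sub_tendsto_zero.2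
    (squeeze_zero (fun _ => norm_nonneg _) (fun n => (s.Z n).dist_c) s.α_tendsto)

theorem tendsto_d : Tendsto (fun n => (s.Z n).d) atTop (𝓝 (D.ends D.star)) :=
  tendsto_iff_norm_sub_tendsto_zero.2
    (squeeze_zero (fun _ => norm_nonneg _) (fun n => (s.Z n).dist_d) s.α_tendsto)

theorem ec_mem (hs : s.Converges ec ed lam p) : ec ∈ limitingNC D.S (D.ends D.star) := by
  refine mem_limitingNC_of_tendsto D.hS (fun n => (s.α_pos n).le) tendsto_c hs.ec s.α_tendsto
    (fun n => (s.Z n).c_mem) fun n => ⟨1 / (2 * (s.Z n).G), ?_, 1, one_pos, fun y hy _ => ?_⟩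
  · have := (s.Z n).G_pos
    positivity
  · refine ((s.Z n).var_c y hy).trans_eq ?_
    ring

theorem lam_nonneg (hs : s.Converges ec ed lam p) : 0 ≤ lam :=
  ge_of_tendsto' hs.lam fun n => (s.Z n).lam_nonneg

theorem p_right (hs : s.Converges ec ed lam p) : p D.t1 = -(pl2snd ec + pl2snd ed) := by
  refine tendsto_nhds_unique (hs.p D.t1 (right_mem_Icc.2 D.ht.le)) ?_
  have h : ∀ n, (s.Z n).p D.t1 = -(pl2snd (s.Z n).ec + pl2snd (s.Z n).ed) := fun n => by
    rw [PenSol.p, adj, intervalIntegral.integral_same, add_zero]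
  simp only [h]
  exact (((continuous_pl2snd.tendsto _).comp hs.ec).add
    ((continuous_pl2snd.tendsto _).comp hs.ed)).neg

theorem p_left (hs : s.Converges ec ed lam p) : p D.t0 = pl2fst ec + pl2fst ed := by
  have h1 := ((continuous_pl2fst.tendsto _).comp hs.ec).add
    ((continuous_pl2fst.tendsto _).comp hs.ed)
  have h2 := (hs.p D.t0 (left_mem_Icc.2 D.ht.le)).sub h1
  have h3 : Tendsto (fun n => (s.Z n).p D.t0 - (pl2fst (s.Z n).ec + pl2fst (s.Z n).ed))
      atTop (𝓝 0) := squeeze_zero_norm (fun n => (s.Z n).var_x0) s.α_tendsto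
  exact sub_eq_zero.1 (tendsto_nhds_unique h2 h3)

theorem abs_excess_sub_le (η : ℝ) (d d' : PL2 X X) :
    |D.excess η d' - D.excess η d| ≤ |D.f d' - D.f d| := by
  have h := abs_max_sub_max_le_abs (D.f d' - D.f (D.ends D.star) + η)
    (D.f d - D.f (D.ends D.star) + η) 0
  simp only [excess]
  rw [max_comm 0, max_comm 0]
  refine h.trans_eq ?_
  congr 1
  ring

theorem exists_lipschitz : ∃ K > 0, ∃ ϱ > 0, ∀ y ∈ Metric.ball (D.ends D.star) ϱ,
    ∀ z ∈ Metric.ball (D.ends D.star) ϱ, |D.f y - D.f z| ≤ K * ‖y - z‖ := by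
  obtain ⟨K, u, hu, hK⟩ := D.hf (D.ends D.star)
  obtain ⟨ϱ, hϱ, hb⟩ := Metric.mem_nhds_iff.1 hu
  refine ⟨K + 1, by positivity, ϱ, hϱ, fun y hy z hz => ?_⟩
  have := hK.dist_le_mul y (hb hy) z (hb hz)
  rw [Real.dist_eq, dist_eq_norm] at this
  linarith [norm_nonneg (y - z)]

theorem eventually_var_d : ∃ K > 0, ∀ᶠ n in atTop, ∃ ϱ > 0, ∀ y, ‖y - (s.Z n).d‖ < ϱ →
    |D.f y - D.f (s.Z n).d| ≤ K * ‖y - (s.Z n).d‖ := by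
  obtain ⟨K, hK, ϱ, hϱ, h⟩ := exists_lipschitz (D := D)
  refine ⟨K, hK, ?_⟩
  filter_upwards [(tendsto_d (s := s)).eventually (Metric.ball_mem_nhds _ (half_pos hϱ))]
    with n hn
  refine ⟨ϱ / 2, half_pos hϱ, fun y hy => h y ?_ _ ?_⟩
  · rw [Metric.mem_ball]
    rw [← dist_eq_norm] at hy
    linarith [dist_triangle y (s.Z n).d (D.ends D.star)]
  · exact Metric.mem_ball.2 (by linarith)

theorem norm_le_of_inner_le {E : Type} [NormedAddCommGroup E] [InnerProductSpace ℝ E]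
    [FiniteDimensional ℝ E] {x v : E} {a K ρ : ℝ} (ha : 0 ≤ a) (hK : 0 ≤ K) (hρ : 0 < ρ)
    (h : ∀ y, ‖y - x‖ < ρ → ⟪v, y - x⟫ ≤ a * ‖y - x‖ + K * ‖y - x‖ ^ 2) : ‖v‖ ≤ 4 * a := by
  obtain ⟨y, hy, w, hw, -, h2⟩ := exists_frechet_near isClosed_univ (mem_univ x) ha hK hρ
    fun y _ => h y
  rw [limitingNC_univ (frechetNC_subset_limitingNC hy hw), zero_sub, norm_neg] at h2
  exact h2

theorem ed_eq_zero (hs : s.Converges ec ed lam p) (hlam : lam = 0) : ed = 0 := by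
  obtain ⟨K, hK, hev⟩ := eventually_var_d (s := s)
  have h1 : ∀ᶠ n in atTop, ‖(s.Z n).ed‖ ≤ 4 * ((s.Z n).lam * K + s.α n) := by
    filter_upwards [hev] with n ⟨ϱ, hϱ, hn⟩
    have hG := (s.Z n).G_pos
    have hl := (s.Z n).lam_nonneg
    have hα := (s.α_pos n).le
    refine norm_le_of_inner_le (x := (s.Z n).d) (K := (K ^ 2 + 1) / (2 * (s.Z n).G))
      (by positivity) (by positivity) hϱ fun y hy => ?_
    have h2 := (abs_excess_sub_le (s.α n ^ 2) (s.Z n).d y).trans (hn y hy)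
    have h3 := (s.Z n).var_d y
    have h4 := mul_le_mul_of_nonneg_left ((le_abs_self _).trans h2) hl
    have h5 := sq_le_sq' (by linarith [neg_abs_le (D.excess (s.α n ^ 2) y -
      D.excess (s.α n ^ 2) (s.Z n).d)]) ((le_abs_self _).trans h2)
    have h6 : ((D.excess (s.α n ^ 2) y - D.excess (s.α n ^ 2) (s.Z n).d) ^ 2 +
        ‖y - (s.Z n).d‖ ^ 2) / (2 * (s.Z n).G) ≤
        (K ^ 2 + 1) / (2 * (s.Z n).G) * ‖y - (s.Z n).d‖ ^ 2 := by
      rw [div_mul_eq_mul_div]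
      gcongr
      linarith
    linarith
  have h2 : Tendsto (fun n => 4 * ((s.Z n).lam * K + s.α n)) atTop (𝓝 0) := by
    simpa [hlam] using ((hs.lam.mul_const K).add s.α_tendsto).const_mul 4
  exact norm_le_zero_iff.1 (le_of_tendsto_of_tendsto hs.ed.norm h2 h1)

theorem inv_smul_ed_mem (hs : s.Converges ec ed lam p) (hlam : 0 < lam) :
    lam⁻¹ • ed ∈ limSubdiff D.f (D.ends D.star) := by
  obtain ⟨K, hK, hev⟩ := eventually_var_d (s := s)
  have hcf : Continuous D.f := D.hf.continuous
  have hli : Tendsto (fun n => (s.Z n).lam⁻¹) atTop (𝓝 lam⁻¹) := hs.lam.inv₀ hlam.ne'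
  refine mem_limSubdiff_of_tendsto hcf (a := fun n => (s.Z n).lam⁻¹ * s.α n)
    (fun n => mul_nonneg (inv_nonneg.2 (s.Z n).lam_nonneg) (s.α_pos n).le)
    (tendsto_d (s := s)) (hli.smul hs.ed) (by simpa using hli.mul s.α_tendsto) ?_
  filter_upwards [hev, hs.lam.eventually (lt_mem_nhds hlam)] with n ⟨ϱ, hϱ, hn⟩ hl
  have hG := (s.Z n).G_pos
  have hex : 0 < D.excess (s.α n ^ 2) (s.Z n).d := by
    rw [← (s.Z n).lam_eq]
    exact mul_pos hG hl
  have hval : D.excess (s.α n ^ 2) (s.Z n).d =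
      D.f (s.Z n).d - D.f (D.ends D.star) + s.α n ^ 2 := by
    rw [excess] at hex ⊢
    exact max_eq_right (lt_max_iff.1 hex |>.resolve_left (lt_irrefl _)).le
  obtain ⟨σ, hσ, hball⟩ := Metric.eventually_nhds_iff.1
    (((D.continuous_excess (s.α n ^ 2)).tendsto (s.Z n).d).eventually (lt_mem_nhds hex))
  refine ⟨(s.Z n).lam⁻¹ * ((K ^ 2 + 1) / (2 * (s.Z n).G)), by positivity, min ϱ σ,
    lt_min hϱ hσ, fun y hy => ?_⟩
  have hy1 := hn y (hy.trans_le (min_le_left _ _))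
  have hy2 := hball (y := y) (by rw [dist_eq_norm]; exact hy.trans_le (min_le_right _ _))
  have hval2 : D.excess (s.α n ^ 2) y = D.f y - D.f (D.ends D.star) + s.α n ^ 2 := by
    rw [excess] at hy2 ⊢
    exact max_eq_right (lt_max_iff.1 hy2 |>.resolve_left (lt_irrefl _)).le
  have h3 := (s.Z n).var_d y
  have hsub : D.excess (s.α n ^ 2) y - D.excess (s.α n ^ 2) (s.Z n).d =
      D.f y - D.f (s.Z n).d := by rw [hval, hval2]; ring
  rw [hsub] at h3
  have h5 := sq_le_sq' (by linarith [neg_abs_le (D.f y - D.f (s.Z n).d)])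
    ((le_abs_self _).trans hy1)
  have h6 : ((D.f y - D.f (s.Z n).d) ^ 2 + ‖y - (s.Z n).d‖ ^ 2) / (2 * (s.Z n).G) ≤
      (K ^ 2 + 1) / (2 * (s.Z n).G) * ‖y - (s.Z n).d‖ ^ 2 := by
    rw [div_mul_eq_mul_div]
    gcongr
    linarith
  have h7 : ⟪(s.Z n).ed, y - (s.Z n).d⟫ ≤ (s.Z n).lam * (D.f y - D.f (s.Z n).d) +
      ((K ^ 2 + 1) / (2 * (s.Z n).G) * ‖y - (s.Z n).d‖ ^ 2 + s.α n * ‖y - (s.Z n).d‖) := by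
    linarith
  have h8 := mul_le_mul_of_nonneg_left h7 (inv_nonneg.2 hl.le)
  rw [mul_add, inv_mul_cancel_left₀ hl.ne', ← real_inner_smul_left] at h8
  linarith

theorem exists_ed_eq (hs : s.Converges ec ed lam p) :
    ∃ a ∈ limSubdiff D.f (D.ends D.star), ed = lam • a := by
  rcases hs.lam_nonneg.eq_or_lt with h | h
  · obtain ⟨a, ha⟩ := limSubdiff_nonempty D.hf (D.ends D.star)
    exact ⟨a, ha, by rw [← h, zero_smul, hs.ed_eq_zero h.symm]⟩
  · exact ⟨_, hs.inv_smul_ed_mem h, by rw [smul_inv_smul₀ h.ne']⟩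

theorem norm_p_le_gronwall (s : D.PenSeq k κ) (hk : 0 ≤ k) (n : ℕ) {τ : ℝ}
    (hτ : τ ∈ Icc D.t0 D.t1) :
    ∀ t ∈ Icc D.t0 D.t1, ‖(s.Z n).p t‖ ≤
      2 * (‖(s.Z n).p τ‖ + s.e n + 4 * (k + 1) * s.α n * (D.t1 - D.t0)) *
        Real.exp (2 * k * (D.t1 - D.t0)) := by
  have hT := sub_pos.2 D.ht
  have he : 0 ≤ s.e n := (integral_nonneg fun _ => norm_nonneg _).trans (s.sub_cut_le n)
  have hα := (s.α_pos n).le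
  have hcp := (s.Z n).continuousOn_p
  refine gronwall_integral (u := fun t => ‖(s.Z n).p t‖) (by positivity) hk hτ
    hcp.norm (fun t _ => norm_nonneg _) fun t ht => ?_
  have hr : ∀ {a b : ℝ}, a ∈ Icc D.t0 D.t1 → b ∈ Icc D.t0 D.t1 →
      IntervalIntegrable (s.Z n).r volume a b :=
    fun ha hb => PenSeq.intervalIntegrable (s.Z n).integrable_r ha hb
  have hc : ∀ {a b : ℝ}, a ∈ Icc D.t0 D.t1 → b ∈ Icc D.t0 D.t1 →
      IntervalIntegrable ((s.Z n).cut κ) volume a b :=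
    fun ha hb => PenSeq.intervalIntegrable ((s.Z n).integrable_cut κ) ha hb
  have hsub : uIcc τ t ⊆ Icc D.t0 D.t1 := uIcc_subset_Icc hτ ht
  have hpi : IntervalIntegrable (fun σ => ‖(s.Z n).p σ‖) volume τ t :=
    (hcp.norm.mono hsub).intervalIntegrable
  have h1 : (s.Z n).p t = (s.Z n).p τ + ∫ σ in τ..t, (s.Z n).r σ := by
    have := intervalIntegral.integral_add_adjacent_intervals (hr hτ ht)
      (hr ht (right_mem_Icc.2 D.ht.le))
    rw [PenSol.p, PenSol.p, adj, adj, ← this]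
    abel
  have h2 : ‖∫ σ in τ..t, ((s.Z n).r σ - (s.Z n).cut κ σ)‖ ≤ s.e n :=
    (norm_integral_le hτ ht ((s.Z n).integrable_r.sub ((s.Z n).integrable_cut κ))).trans
      (s.sub_cut_le n)
  rw [intervalIntegral.integral_sub (hr hτ ht) (hc hτ ht)] at h2
  have h3 : ‖∫ σ in τ..t, (s.Z n).cut κ σ‖ ≤
      |∫ σ in τ..t, (k * ‖(s.Z n).p σ‖ + 4 * (k + 1) * s.α n)| := by
    refine intervalIntegral.norm_integral_le_abs_of_norm_le ?_
      ((hpi.const_mul k).add intervalIntegrable_const)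
    have hss : uIoc τ t ⊆ Ioc D.t0 D.t1 :=
      Ioc_subset_Ioc (le_min hτ.1 ht.1) (max_le hτ.2 ht.2)
    filter_upwards [ae_restrict_of_ae_restrict_of_subset hss (s.near_le n)] with σ hσ
    by_cases hlt : ‖(s.Z n).w σ - D.ws σ‖ < κ
    · rw [PenSol.cut, indicator_of_mem (by exact hlt)]
      exact hσ hlt
    · rw [PenSol.cut, indicator_of_notMem (by exact hlt), norm_zero]
      positivity
  rw [intervalIntegral.integral_add (hpi.const_mul k) intervalIntegrable_const,
    intervalIntegral.integral_const_mul, intervalIntegral.integral_const, smul_eq_mul] at h3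
  have h4 := abs_add_le (k * ∫ σ in τ..t, ‖(s.Z n).p σ‖) ((t - τ) * (4 * (k + 1) * s.α n))
  rw [abs_mul, abs_mul, abs_of_nonneg hk,
    abs_of_nonneg (show 0 ≤ 4 * (k + 1) * s.α n by positivity)] at h4
  have h5 : |t - τ| ≤ D.t1 - D.t0 := abs_le.2 ⟨by linarith [ht.1, hτ.2], by linarith [ht.2, hτ.1]⟩
  have h6 := mul_le_mul_of_nonneg_right h5 (show 0 ≤ 4 * (k + 1) * s.α n by positivity)
  have h7 := norm_le_norm_add_norm_sub' (∫ σ in τ..t, (s.Z n).r σ) (∫ σ in τ..t, (s.Z n).cut κ σ)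
  have h8 := norm_add_le ((s.Z n).p τ) (∫ σ in τ..t, (s.Z n).r σ)
  rw [← h1] at h8
  linarith

theorem p_ne_zero (hs : s.Converges ec ed lam p) (hk : 0 ≤ k) (hlam : lam = 0) {τ : ℝ}
    (hτ : τ ∈ Icc D.t0 D.t1) : p τ ≠ 0 := by
  intro h0
  set P : ℕ → ℝ := fun n => 2 * (‖(s.Z n).p τ‖ + s.e n + 4 * (k + 1) * s.α n * (D.t1 - D.t0)) *
        Real.exp (2 * k * (D.t1 - D.t0)) with hPdef
  have hP : Tendsto P atTop (𝓝 0) := by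
    have h1 := (hs.p τ hτ).norm
    rw [h0, norm_zero] at h1
    have h2 := ((((h1.add s.e_tendsto).add ((s.α_tendsto.const_mul (4 * (k + 1))).mul_const
      (D.t1 - D.t0))).const_mul 2).mul_const (Real.exp (2 * k * (D.t1 - D.t0))))
    simpa using h2
  have hpt : ∀ t ∈ Icc D.t0 D.t1, p t = 0 := fun t ht => by
    refine tendsto_nhds_unique (hs.p t ht) ?_
    exact squeeze_zero_norm (fun n => norm_p_le_gronwall s hk n hτ t ht) hP
  have hed := hs.ed_eq_zero hlam
  have hec : ec = 0 := by
    have h1 := hs.p_left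
    have h2 := hs.p_right
    rw [hpt _ (left_mem_Icc.2 D.ht.le), hed, pl2fst_zero, add_zero] at h1
    rw [hpt _ (right_mem_Icc.2 D.ht.le), hed, pl2snd_zero, add_zero, eq_comm, neg_eq_zero] at h2
    rw [← norm_le_zero_iff]
    refine (norm_le_pl2 ec).trans ?_
    simp [← h1, h2]
  have hr : Tendsto (fun n => ∫ t, ‖(s.Z n).r t‖ ^ 2 ∂D.μ) atTop (𝓝 0) := by
    refine squeeze_zero (fun n => (s.Z n).integral_r_sq_nonneg)
      (fun n => s.sq_le n (P n) (norm_p_le_gronwall s hk n hτ)) ?_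
    have h1 := (((((hP.const_mul k).add (s.α_tendsto.const_mul (4 * (k + 1)))).pow 2).const_mul
      (D.t1 - D.t0)).add s.e_tendsto)
    simpa using h1
  have h1 := (((hs.lam.pow 2).add (hs.ec.norm.pow 2)).add (hs.ed.norm.pow 2)).add hr
  simp only [(s.Z _).normalised] at h1
  have h2 := tendsto_nhds_unique h1 tendsto_const_nhds
  rw [hlam, hec, hed, norm_zero] at h2
  norm_num at h2

end PenData.PenSeq.Converges

end Penalised

theorem sub_apply_mem_of_mem_closure_convexHull_tails {L F : Type*} [NormedAddCommGroup L]
    [NormedSpace ℝ L] [NormedAddCommGroup F] [NormedSpace ℝ F] {l : ℕ → L} {y : L}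
    (hy : ∀ n, y ∈ closure (convexHull ℝ (l '' Ici n))) (A : L →L[ℝ] F) (a : F) {N : Set F}
    (h : ∀ η > 0, ∀ᶠ n in atTop, ∃ ν ∈ N, ‖a - A (l n) - ν‖ ≤ η) :
    a - A y ∈ closure (convexHull ℝ N) := by
  have hmem : ∀ η > 0, a - A y ∈ Metric.cthickening η (convexHull ℝ N) := fun η hη => by
    obtain ⟨n, hn⟩ := eventually_atTop.1 (h η hη)
    have hco : Convex ℝ (Metric.cthickening η (convexHull ℝ N)) :=
      (convex_convexHull ℝ N).cthickening η
    have hcl : IsClosed {x | a - A x ∈ Metric.cthickening η (convexHull ℝ N)} :=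
      Metric.isClosed_cthickening.preimage (continuous_const.sub A.continuous)
    refine closure_minimal (convexHull_min ?_ ?_) hcl (hy n)
    · rintro _ ⟨i, hi, rfl⟩
      obtain ⟨ν, hν, hle⟩ := hn i hi
      exact Metric.mem_cthickening_of_dist_le _ ν _ _ (subset_convexHull ℝ N hν)
        (by rwa [dist_eq_norm])
    · intro x hx z hz c d hc hd hcd
      have := hco hx hz hc hd hcd
      have e : a - A (c • x + d • z) = c • (a - A x) + d • (a - A z) := by
        rw [map_add, map_smul, map_smul, smul_sub, smul_sub]
        nth_rewrite 1 [← one_smul ℝ a, ← hcd, add_smul]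
        abel
      show a - A (c • x + d • z) ∈ Metric.cthickening η (convexHull ℝ N)
      rwa [e]
  rw [Metric.closure_eq_iInter_cthickening]
  simpa using hmem

theorem norm_le_of_mem_closure_convexHull_tails {L : Type*} [NormedAddCommGroup L]
    [NormedSpace ℝ L] {l : ℕ → L} {y : L} {K : ℝ}
    (hy : ∀ n, y ∈ closure (convexHull ℝ (l '' Ici n)))
    (h : ∀ η > 0, ∀ᶠ n in atTop, ‖l n‖ ≤ K + η) : ‖y‖ ≤ K := by
  refine le_of_forall_pos_le_add fun η hη => ?_
  obtain ⟨n, hn⟩ := eventually_atTop.1 (h η hη)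
  have : closure (convexHull ℝ (l '' Ici n)) ⊆ Metric.closedBall 0 (K + η) := by
    refine closure_minimal (convexHull_min ?_ (convex_closedBall _ _)) Metric.isClosed_closedBall
    rintro _ ⟨i, hi, rfl⟩
    simpa using hn i hi
  simpa using this (hy n)

theorem eventually_exists_near_of_closed_graph {A F : Type*} [TopologicalSpace A]
    [NormedAddCommGroup F] [ProperSpace F] {Nq : A → Set F} {z0 : A} {z : ℕ → A} {ν y : ℕ → F}
    {K : ℝ} (hgraph : ∀ (z : ℕ → A) (ν : ℕ → F) (ν0 : F), Tendsto z atTop (𝓝 z0) →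
      Tendsto ν atTop (𝓝 ν0) → (∀ n, ν n ∈ Nq (z n)) → ν0 ∈ Nq z0)
    (hz : Tendsto z atTop (𝓝 z0)) (hν : ∀ᶠ n in atTop, ν n ∈ Nq (z n))
    (hK : ∀ᶠ n in atTop, ‖ν n‖ ≤ K) (hy : Tendsto (fun n => y n - ν n) atTop (𝓝 0)) {η : ℝ}
    (hη : 0 < η) : ∀ᶠ n in atTop, ∃ ν0 ∈ Nq z0, ‖y n - ν0‖ ≤ η := by
  by_contra hcon
  have hfr : ∃ᶠ n in atTop, (¬ ∃ ν0 ∈ Nq z0, ‖y n - ν0‖ ≤ η) ∧ ν n ∈ Nq (z n) ∧ ‖ν n‖ ≤ K :=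
    (not_eventually.1 hcon).and_eventually (hν.and hK)
  obtain ⟨φ, hφ, hP⟩ := extraction_of_frequently_atTop hfr
  obtain ⟨ν0, -, ψ, hψ, hlim⟩ := (isCompact_closedBall (0 : F) K).tendsto_subseq
    (x := fun n => ν (φ n)) fun n => by simpa using (hP n).2.2
  have hcomp : Tendsto (fun n => φ (ψ n)) atTop atTop := hφ.tendsto_atTop.comp hψ.tendsto_atTop
  have hmem := hgraph _ _ ν0 (hz.comp hcomp) hlim fun n => (hP (ψ n)).2.1
  have h1 := (hy.comp hcomp).add (hlim.sub_const ν0)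
  simp only [Function.comp_def, sub_self, add_zero, sub_add_sub_cancel] at h1
  obtain ⟨n, hn⟩ := (h1.norm.eventually (gt_mem_nhds (by simpa using hη))).exists
  exact (hP (ψ n)).1 ⟨ν0, hmem, hn.le⟩

theorem norm_adjoint_le {X Q : Type} [NormedAddCommGroup X] [InnerProductSpace ℝ X]
    [FiniteDimensional ℝ X] [NormedAddCommGroup Q] [InnerProductSpace ℝ Q]
    [FiniteDimensional ℝ Q] {V : Q →L[ℝ] X} (hV : ∀ q, ‖V q‖ ≤ ‖q‖) (x : X) :
    ‖ContinuousLinearMap.adjoint V x‖ ≤ ‖x‖ := by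
  refine (ContinuousLinearMap.le_opNorm _ _).trans (mul_le_of_le_one_left (norm_nonneg x) ?_)
  rw [LinearIsometryEquiv.norm_map]
  exact ContinuousLinearMap.opNorm_le_bound _ zero_le_one fun q => by
    rw [one_mul]; exact hV q

section Penalised

set_option linter.unusedSectionVars false

variable {X Q : Type} [NormedAddCommGroup X] [InnerProductSpace ℝ X] [FiniteDimensional ℝ X]
  [NormedAddCommGroup Q] [InnerProductSpace ℝ Q] [FiniteDimensional ℝ Q]

namespace PenData.PenSeq.Converges

variable {D : PenData X Q} {k κ : ℝ} {s : D.PenSeq k κ} {ec ed : PL2 X X} {lam : ℝ} {p : ℝ → X}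

/-- The limit adjoint arc satisfies the Weierstrass condition. -/
theorem ae_weierstrass (hs : s.Converges ec ed lam p) {ρ : ℝ} (hNB : D.NormalBound ρ k)
    (hρ : 0 < ρ) (hk : 0 ≤ k) : ∀ᵐ t ∂D.μ, ∀ q, pl2 (pl2fst (D.ws t)) q ∈ D.M →
      ‖q - pl2snd (D.ws t)‖ < D.ϱ t → ⟪p t, D.V (q - pl2snd (D.ws t))⟫ ≤ 0 := by
  filter_upwards [hNB, ae_all_iff.2 fun n => (s.Z n).ae_norm_x_sub_le,
    ae_all_iff.2 fun n => (s.Z n).var_w, hs.w, ae_restrict_mem measurableSet_Ioc]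
    with t h1 h2 h3 h4 h5 q hqM hq
  have hα2 : Tendsto (fun n => 2 * s.α n) atTop (𝓝 0) := by simpa using s.α_tendsto.const_mul 2
  have hx : Tendsto (fun n => (s.Z n).x t) atTop (𝓝 (pl2fst (D.ws t))) :=
    tendsto_iff_norm_sub_tendsto_zero.2 (squeeze_zero (fun _ => norm_nonneg _) h2 hα2)
  have hN := h1 _ hqM (by simpa using D.hε.le) (by simpa using hq.le)
  have hsmall : ∀ᶠ n in atTop, 2 * s.α n < ρ / 4 ∧ 16 * (2 * s.α n) < ρ ^ 2 ∧
      4 * (k + 1) ^ 2 * (2 * s.α n) < 1 ∧ 2 * s.α n < D.ε := by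
    refine (hα2.eventually (gt_mem_nhds (by positivity))).and
      ((Tendsto.eventually (by simpa using hα2.const_mul 16) (gt_mem_nhds (by positivity))).and
      ((Tendsto.eventually (by simpa using hα2.const_mul (4 * (k + 1) ^ 2))
        (gt_mem_nhds one_pos)).and (hα2.eventually (gt_mem_nhds D.hε))))
  have hex : ∀ᶠ n in atTop, ∃ q', pl2 ((s.Z n).x t) q' ∈ D.M ∧ ‖q' - q‖ ^ 2 ≤ 2 * s.α n ∧
      2 * s.α n < D.ε := by
    filter_upwards [hsmall] with n ⟨a1, a2, a3, a4⟩
    have hle : ‖(s.Z n).x t - pl2fst (pl2 (pl2fst (D.ws t)) q)‖ ≤ 2 * s.α n := by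
      rw [pl2fst_pl2]; exact h2 n
    obtain ⟨q', hq', hd⟩ := exists_mem_near D.hM hqM hρ hk hN (hle.trans_lt a1)
      (by linarith) (lt_of_le_of_lt (mul_le_mul_of_nonneg_left hle (by positivity)) a3)
    rw [pl2snd_pl2] at hd
    exact ⟨q', hq', hd.trans hle, a4⟩
  obtain ⟨qn, hqn⟩ := hex.choice
  have hqlim : Tendsto qn atTop (𝓝 q) := by
    rw [tendsto_iff_norm_sub_tendsto_zero]
    have h6 : Tendsto (fun n => ‖qn n - q‖ ^ 2) atTop (𝓝 0) :=
      squeeze_zero' (Eventually.of_forall fun _ => sq_nonneg _) (hqn.mono fun n hn => hn.2.1) hα2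
    have h7 := h6.sqrt
    simpa [Real.sqrt_sq (norm_nonneg _)] using h7
  have hpl : Tendsto (fun n => s.α n * ‖pl2 ((s.Z n).x t) (qn n) - (s.Z n).w t‖) atTop (𝓝 0) := by
    simpa using s.α_tendsto.mul ((tendsto_pl2 hx hqlim).sub h4).norm
  have hin : Tendsto (fun n => ⟪(s.Z n).p t, D.V (qn n - pl2snd ((s.Z n).w t))⟫) atTop
      (𝓝 ⟪p t, D.V (q - pl2snd (D.ws t))⟫) :=
    (hs.p t (Ioc_subset_Icc_self h5)).inner ((D.V.continuous.tendsto _).comp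
      (hqlim.sub ((continuous_pl2snd.tendsto _).comp h4)))
  refine le_of_tendsto_of_tendsto hin hpl ?_
  have hgap : Tendsto (fun n => D.ϱ t - ‖qn n - pl2snd (D.ws t)‖) atTop
      (𝓝 (D.ϱ t - ‖q - pl2snd (D.ws t)‖)) :=
    tendsto_const_nhds.sub (hqlim.sub_const _).norm
  have hbig := (s.N_tendsto.atTop_mul_pos (sub_pos.2 hq) hgap).eventually_ge_atTop 1
  filter_upwards [hqn, hbig, hgap.eventually (lt_mem_nhds (sub_pos.2 hq))]
    with n ⟨b1, b2, b3⟩ b4 b5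
  have h6 := h3 n _ b1 (by rw [pl2fst_pl2]; exact (h2 n).trans_lt b3)
    (by rw [pl2snd_pl2]; linarith)
  have hG := (s.Z n).G_pos
  have e1 : D.tr ⟨(s.Z n).x0, (s.Z n).w, (s.Z n).c, (s.Z n).d⟩ t = (s.Z n).x t := rfl
  have e2 : D.adj (pl2snd (s.Z n).ec + pl2snd (s.Z n).ed) (s.Z n).r t = (s.Z n).p t := rfl
  have e3 : D.barrier s.C (s.N n) t (qn n) = 0 := by
    rw [barrier, max_eq_left (by linarith), mul_zero]
  rw [e1, e2, pl2fst_pl2, pl2snd_pl2, e3, sub_self, norm_zero] at h6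
  have h7 := D.barrier_nonneg (N := s.N n) s.C_nonneg t (pl2snd ((s.Z n).w t))
  have h8 : 0 ≤ ‖(s.Z n).x t - pl2fst ((s.Z n).w t)‖ ^ 2 / (2 * (s.Z n).G) := by positivity
  have e : (0 ^ 2 - ‖(s.Z n).x t - pl2fst ((s.Z n).w t)‖ ^ 2) / (2 * (s.Z n).G) =
    -(‖(s.Z n).x t - pl2fst ((s.Z n).w t)‖ ^ 2 / (2 * (s.Z n).G)) := by ring
  rw [e] at h6
  linarith

end PenData.PenSeq.Converges

end Penalised

section Penalised

set_option linter.unusedSectionVars false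

variable {X Q : Type} [NormedAddCommGroup X] [InnerProductSpace ℝ X] [FiniteDimensional ℝ X]
  [NormedAddCommGroup Q] [InnerProductSpace ℝ Q] [FiniteDimensional ℝ Q]

/-- A rule representing normals to the constraint set by bounded multipliers in `L`. -/
structure PenData.MultRule (D : PenData X Q) (L : Type) [NormedAddCommGroup L]
    [InnerProductSpace ℝ L] (ρ k : ℝ) where
  B₁ : PL2 X Q → L →L[ℝ] X
  B₂ : PL2 X Q → L →L[ℝ] Q
  continuous_B₁ : Continuous B₁
  continuous_B₂ : Continuous B₂
  N : PL2 X Q → Set Q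
  closed_graph : ∀ (z : ℕ → PL2 X Q) (ν : ℕ → Q) (z0 : PL2 X Q) (ν0 : Q), Tendsto z atTop (𝓝 z0) →
    Tendsto ν atTop (𝓝 ν0) → (∀ n, ν n ∈ N (z n)) → ν0 ∈ N z0
  rule : ∀ᵐ t ∂D.μ, ∀ w ∈ D.M, ‖pl2fst w - pl2fst (D.ws t)‖ ≤ D.ε →
    ‖pl2snd w - pl2snd (D.ws t)‖ ≤ D.ϱ t → ∀ z ∈ D.M, ‖z - w‖ < ρ →
    ∀ ξ ∈ frechetNC D.M z, ‖pl2fst ξ‖ ≤ k * ‖pl2snd ξ‖ ∧ ∃ l, ‖l‖ ≤ k * ‖pl2snd ξ‖ ∧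
      pl2fst ξ = B₁ z l ∧ pl2snd ξ - B₂ z l ∈ N z

namespace PenData

variable {D : PenData X Q} {L : Type} [NormedAddCommGroup L] [InnerProductSpace ℝ L]
  [FiniteDimensional ℝ L] [MeasurableSpace L] [BorelSpace L] {ρ k κ : ℝ}

theorem MultRule.normalBound (B : D.MultRule L ρ k) : D.NormalBound ρ k := by
  filter_upwards [B.rule] with t h w hw h1 h2 z hz h3 ξ hξ using (h w hw h1 h2 z hz h3 ξ hξ).1

/-- `l` is, up to `c`, a multiplier of a normal close to `(r, V†p)` at a point close to `w`. -/
def MultRule.Near (B : D.MultRule L ρ k) (c : ℝ) (w : PL2 X Q) (r p : X) (l : L)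
    (i : PL2 X Q × PL2 X Q × L) : Prop :=
  (pl2fst i.2.1 = B.B₁ i.1 i.2.2 ∧ pl2snd i.2.1 - B.B₂ i.1 i.2.2 ∈ B.N i.1 ∧
    ‖i.2.2‖ ≤ k * ‖pl2snd i.2.1‖) ∧
  ‖i.1 - w‖ < c ∧ ‖i.2.1 - pl2 r (ContinuousLinearMap.adjoint D.V p)‖ < c ∧ ‖l - i.2.2‖ < c

theorem MultRule.isOpen_near (B : D.MultRule L ρ k) (c : ℝ) :
    IsOpen {q : (PL2 X Q × X × X) × L | ∃ i, B.Near c q.1.1 q.1.2.1 q.1.2.2 q.2 i} := by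
  simp only [ofPred_exists]
  refine isOpen_iUnion fun i => ?_
  refine isOpen_const.and (IsOpen.and ?_ (IsOpen.and ?_ ?_))
  · exact isOpen_lt (by fun_prop) continuous_const
  · refine isOpen_lt (Continuous.norm (continuous_const.sub ?_)) continuous_const
    exact continuous_pl2 (by fun_prop) (by fun_prop)
  · exact isOpen_lt (by fun_prop) continuous_const

theorem PenSeq.exists_multiplier (s : D.PenSeq k κ) (B : D.MultRule L ρ k) (hρ : 0 < ρ)
    (hk : 0 ≤ k) (hκε : κ ≤ D.ε) (hκδ : κ ≤ D.δ / 2) (n : ℕ) : ∃ l : ℝ → L, Measurable l ∧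
      ∀ᵐ t ∂D.μ, (‖(s.Z n).w t - D.ws t‖ < κ →
        ∃ i, B.Near (5 * s.α n) ((s.Z n).w t) ((s.Z n).r t) ((s.Z n).p t) (l t) i) ∧
        ‖l t‖ ≤ k * (3 + (D.t1 - D.t0) + 5) + 5 := by
  let _ : MeasurableSpace (PL2 X Q × X × X) := borel _
  have : BorelSpace (PL2 X Q × X × X) := ⟨rfl⟩
  have hT := sub_pos.2 D.ht
  have hα := s.α_pos n
  have hα1 := s.α_le_one n
  have hp : AEStronglyMeasurable (s.Z n).p D.μ :=
    ((s.Z n).continuousOn_p.mono Ioc_subset_Icc_self).aestronglyMeasurable measurableSet_Ioc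
  obtain ⟨l, hl, hsel⟩ := exists_measurable_selection (B.isOpen_near (5 * s.α n))
    ((s.Z n).integrable_w.aestronglyMeasurable.prodMk
      ((s.Z n).integrable_r.aestronglyMeasurable.prodMk hp))
  refine ⟨l, hl, ?_⟩
  filter_upwards [hsel, B.rule, (s.Z n).mem, ae_restrict_mem measurableSet_Ioc,
    (s.Z n).ae_near hκε hκδ hα.le (s.N_nonneg n) (s.N_δ n)] with t h1 h2 h3 h4 h5
  rcases h1 with ⟨i, hi⟩ | ⟨h1, h0⟩
  · refine ⟨fun _ => ⟨i, hi⟩, ?_⟩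
    obtain ⟨⟨-, -, a1⟩, -, a2, a3⟩ := hi
    have a4 := norm_sub_norm_le (l t) i.2.2
    have a5 := norm_pl2snd_le (i.2.1 - pl2 ((s.Z n).r t) (ContinuousLinearMap.adjoint D.V ((s.Z n).p t)))
    rw [pl2snd_sub, pl2snd_pl2] at a5
    have a6 := norm_sub_norm_le (pl2snd i.2.1) (ContinuousLinearMap.adjoint D.V ((s.Z n).p t))
    have a7 := norm_adjoint_le D.hV ((s.Z n).p t)
    have a8 := (s.Z n).norm_p_le (Ioc_subset_Icc_self h4)
    have a9 : k * ‖pl2snd i.2.1‖ ≤ k * (3 + (D.t1 - D.t0) + 5) :=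
      mul_le_mul_of_nonneg_left (by linarith) hk
    linarith
  · refine ⟨fun hlt => ?_, by rw [h0, norm_zero]; positivity⟩
    obtain ⟨z, hz, hzw, ξ, hξ, hξle⟩ := h5 hlt (min ρ (5 * s.α n)) (lt_min hρ (by positivity))
    obtain ⟨-, d, hd, hd1, hd2⟩ := h2 _ h3.1 h3.2.1 h3.2.2 z hz (hzw.trans_le (min_le_left _ _)) ξ hξ
    exact (h1 d ⟨(z, ξ, d), ⟨hd1, hd2, hd⟩, hzw.trans_le (min_le_right _ _), by linarith,
      by rw [sub_self, norm_zero]; positivity⟩).elim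

end PenData

end Penalised

theorem tendsto_apply_sub_apply {A L F : Type*} [TopologicalSpace A] [NormedAddCommGroup L]
    [NormedSpace ℝ L] [NormedAddCommGroup F] [NormedSpace ℝ F] {B : A → L →L[ℝ] F}
    (hB : Continuous B) {z : ℕ → A} {z0 : A} (hz : Tendsto z atTop (𝓝 z0)) {d l : ℕ → L} {K : ℝ}
    (hd : ∀ᶠ n in atTop, ‖d n‖ ≤ K) (hdl : Tendsto (fun n => l n - d n) atTop (𝓝 0)) :
    Tendsto (fun n => B (z n) (d n) - B z0 (l n)) atTop (𝓝 0) := by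
  have h1 : Tendsto (fun n => ‖B (z n) - B z0‖ * K + ‖B z0‖ * ‖l n - d n‖) atTop (𝓝 0) := by
    simpa using ((((hB.tendsto z0).comp hz).sub_const (B z0)).norm.mul_const K).add
      (hdl.norm.const_mul ‖B z0‖)
  refine squeeze_zero_norm' ?_ h1
  filter_upwards [hd] with n hn
  have e : B (z n) (d n) - B z0 (l n) = (B (z n) - B z0) (d n) - B z0 (l n - d n) := by
    simp only [sub_apply, map_sub]
    abel
  rw [e]
  refine (norm_sub_le _ _).trans (add_le_add ?_ (ContinuousLinearMap.le_opNorm _ _))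
  exact (ContinuousLinearMap.le_opNorm _ _).trans
    (mul_le_mul_of_nonneg_left hn (norm_nonneg _))

section Penalised

set_option linter.unusedSectionVars false

variable {X Q : Type} [NormedAddCommGroup X] [InnerProductSpace ℝ X] [FiniteDimensional ℝ X]
  [NormedAddCommGroup Q] [InnerProductSpace ℝ Q] [FiniteDimensional ℝ Q]

namespace PenData

variable {D : PenData X Q} {L : Type} [NormedAddCommGroup L] [InnerProductSpace ℝ L]
  [FiniteDimensional ℝ L] [MeasurableSpace L] [BorelSpace L] {ρ k κ : ℝ}

theorem MultRule.limits (B : D.MultRule L ρ k) (hk : 0 ≤ k) {c : ℕ → ℝ} {w : ℕ → PL2 X Q}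
    {r p : ℕ → X} {l : ℕ → L} {w0 : PL2 X Q} {p0 : X} (hc : Tendsto c atTop (𝓝 0))
    (hw : Tendsto w atTop (𝓝 w0)) (hp : Tendsto p atTop (𝓝 p0))
    (h : ∀ᶠ n in atTop, ∃ i, B.Near (c n) (w n) (r n) (p n) (l n) i) :
    Tendsto (fun n => r n - B.B₁ w0 (l n)) atTop (𝓝 0) ∧
    (∀ η > 0, ∀ᶠ n in atTop, ∃ ν ∈ B.N w0,
      ‖ContinuousLinearMap.adjoint D.V p0 - B.B₂ w0 (l n) - ν‖ ≤ η) ∧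
    ∀ η > 0, ∀ᶠ n in atTop, ‖l n‖ ≤ k * ‖p0‖ + η := by
  obtain ⟨i, hi⟩ := h.choice
  have hVp : Tendsto (fun n => ContinuousLinearMap.adjoint D.V (p n)) atTop
      (𝓝 (ContinuousLinearMap.adjoint D.V p0)) :=
    ((ContinuousLinearMap.adjoint D.V).continuous.tendsto p0).comp hp
  have hz : Tendsto (fun n => (i n).1) atTop (𝓝 w0) := by
    have h1 : Tendsto (fun n => (i n).1 - w n) atTop (𝓝 0) :=
      squeeze_zero_norm' (hi.mono fun n hn => hn.2.1.le) hc
    simpa using h1.add hw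
  have hξ : Tendsto (fun n => (i n).2.1 - pl2 (r n) (ContinuousLinearMap.adjoint D.V (p n))) atTop
      (𝓝 0) := squeeze_zero_norm' (hi.mono fun n hn => hn.2.2.1.le) hc
  have hξ1 : Tendsto (fun n => pl2fst (i n).2.1 - r n) atTop (𝓝 0) :=
    (continuous_pl2fst.tendsto _).comp hξ
  have hξ2 : Tendsto (fun n => pl2snd (i n).2.1) atTop
      (𝓝 (ContinuousLinearMap.adjoint D.V p0)) := by
    have h1 : Tendsto (fun n => pl2snd (i n).2.1 - ContinuousLinearMap.adjoint D.V (p n)) atTop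
      (𝓝 0) := (continuous_pl2snd.tendsto _).comp hξ
    simpa using h1.add hVp
  have hl : Tendsto (fun n => l n - (i n).2.2) atTop (𝓝 0) :=
    squeeze_zero_norm' (hi.mono fun n hn => hn.2.2.2.le) hc
  have hξn : ∀ᶠ n in atTop, ‖pl2snd (i n).2.1‖ ≤ ‖p0‖ + 1 := by
    filter_upwards [hξ2.norm.eventually (gt_mem_nhds (lt_add_one _))] with n hn
    linarith [norm_adjoint_le D.hV p0]
  have hd : ∀ᶠ n in atTop, ‖(i n).2.2‖ ≤ k * (‖p0‖ + 1) := by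
    filter_upwards [hi, hξn] with n hn h1
    exact hn.1.2.2.trans (mul_le_mul_of_nonneg_left h1 hk)
  have h1 := tendsto_apply_sub_apply B.continuous_B₁ hz hd hl
  have h2 := tendsto_apply_sub_apply B.continuous_B₂ hz hd hl
  refine ⟨?_, fun η hη => ?_, fun η hη => ?_⟩
  · have h3 := h1.sub hξ1
    rw [sub_zero] at h3
    refine h3.congr' ?_
    filter_upwards [hi] with n hn
    rw [hn.1.1]
    abel
  · refine eventually_exists_near_of_closed_graph (Nq := B.N) (z := fun n => (i n).1)
      (ν := fun n => pl2snd (i n).2.1 - B.B₂ (i n).1 (i n).2.2)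
      (K := ‖p0‖ + 1 + (‖B.B₂ w0‖ + 1) * (k * (‖p0‖ + 1)))
      (fun z ν ν0 => B.closed_graph z ν w0 ν0) hz (hi.mono fun n hn => hn.1.2.1) ?_ ?_ hη
    · filter_upwards [hξn, hd, (((B.continuous_B₂.tendsto w0).comp hz).norm).eventually
        (gt_mem_nhds (lt_add_one _))] with n a1 a2 a3
      refine (norm_sub_le _ _).trans (add_le_add a1 ((ContinuousLinearMap.le_opNorm _ _).trans ?_))
      exact mul_le_mul a3.le a2 (norm_nonneg _) (by positivity)
    · have h3 := (tendsto_const_nhds (x := ContinuousLinearMap.adjoint D.V p0)).sub hξ2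
      rw [sub_self] at h3
      have h4 := h3.add h2
      rw [add_zero] at h4
      refine h4.congr fun n => ?_
      abel
  · have h3 : Tendsto (fun n => k * ‖pl2snd (i n).2.1‖ + c n) atTop
        (𝓝 (k * ‖ContinuousLinearMap.adjoint D.V p0‖)) := by
      simpa using (hξ2.norm.const_mul k).add hc
    have h4 := mul_le_mul_of_nonneg_left (norm_adjoint_le D.hV p0) hk
    filter_upwards [hi, h3.eventually (gt_mem_nhds (lt_add_of_pos_right _ hη))] with n hn h5
    have h6 := norm_sub_norm_le (l n) (i n).2.2
    linarith [hn.1.2.2, hn.2.2.2]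

namespace PenSeq.Converges

variable {s : D.PenSeq k κ} {ec ed : PL2 X X} {lam : ℝ} {p : ℝ → X}

/-- Passing to the limit in the approximate Euler inclusions. -/
theorem exists_euler (hs : s.Converges ec ed lam p) (B : D.MultRule L ρ k) (hρ : 0 < ρ)
    (hk : 0 ≤ k) (hκ : 0 < κ) (hκε : κ ≤ D.ε) (hκδ : κ ≤ D.δ / 2) :
    ∃ l : ℝ → L, StronglyMeasurable l ∧ Integrable (fun t => B.B₁ (D.ws t) (l t)) D.μ ∧
      (∀ t ∈ Icc D.t0 D.t1, p t = p D.t0 + ∫ s in D.t0..t, B.B₁ (D.ws s) (l s)) ∧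
      ∀ᵐ t ∂D.μ, ‖l t‖ ≤ k * ‖p t‖ ∧
        ContinuousLinearMap.adjoint D.V (p t) - B.B₂ (D.ws t) (l t) ∈
          closure (convexHull ℝ (B.N (D.ws t))) := by
  have hT := sub_pos.2 D.ht
  choose l hlm hl using s.exists_multiplier B hρ hk hκε hκδ
  set K := k * (3 + (D.t1 - D.t0) + 5) + 5 with hKdef
  have hK0 : 0 ≤ K := by positivity
  obtain ⟨K₁, hK₁⟩ : ∃ K₁, ∀ t, ‖B.B₁ (D.ws t)‖ ≤ K₁ := by
    obtain ⟨K₁, hK₁⟩ := (isCompact_closedBall (0 : PL2 X Q) D.b).exists_bound_of_continuousOn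
      B.continuous_B₁.continuousOn
    exact ⟨K₁, fun t => hK₁ _ (by simpa using D.hwsb t)⟩
  have hK₁0 : 0 ≤ K₁ := (norm_nonneg _).trans (hK₁ 0)
  have hB₁m : StronglyMeasurable fun t => B.B₁ (D.ws t) :=
    B.continuous_B₁.comp_stronglyMeasurable D.hws
  have hmeas : ∀ {l : ℝ → L}, StronglyMeasurable l →
      StronglyMeasurable fun t => B.B₁ (D.ws t) (l t) := fun hl =>
    (isBoundedBilinearMap_apply (𝕜 := ℝ) (E := L) (F := X)).continuous.comp_stronglyMeasurable
      (hB₁m.prodMk hl)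
  have hle : ∀ {t : ℝ} {l : L}, ‖l‖ ≤ K → ‖B.B₁ (D.ws t) l‖ ≤ K₁ * K := fun h =>
    (ContinuousLinearMap.le_opNorm _ _).trans
      (mul_le_mul (hK₁ _) h (norm_nonneg _) hK₁0)
  obtain ⟨y, hy, hytail, hylim⟩ := exists_weak_limit (μ := D.μ) (l := l) (K := K)
    (fun n => (hlm n).aestronglyMeasurable) fun n => (hl n).mono fun t ht => ht.2
  have hyK : ∀ᵐ t ∂D.μ, ‖y t‖ ≤ K := by
    filter_upwards [hytail, ae_all_iff.2 hl] with t h1 h2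
    exact norm_le_of_mem_closure_convexHull_tails h1 fun η hη =>
      Eventually.of_forall fun n => (h2 n).2.trans (le_add_of_nonneg_right hη.le)
  have hint : ∀ {l : ℝ → L}, StronglyMeasurable l → (∀ᵐ t ∂D.μ, ‖l t‖ ≤ K) →
      Integrable (fun t => B.B₁ (D.ws t) (l t)) D.μ := fun hl hlK =>
    Integrable.of_bound (hmeas hl).aestronglyMeasurable (K₁ * K) (hlK.mono fun t ht => hle ht)
  have hlim : ∀ᵐ t ∂D.μ,
      Tendsto (fun n => (s.Z n).cut κ t - B.B₁ (D.ws t) (l n t)) atTop (𝓝 0) ∧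
      (∀ η > 0, ∀ᶠ n in atTop, ∃ ν ∈ B.N (D.ws t),
        ‖ContinuousLinearMap.adjoint D.V (p t) - B.B₂ (D.ws t) (l n t) - ν‖ ≤ η) ∧
      ∀ η > 0, ∀ᶠ n in atTop, ‖l n t‖ ≤ k * ‖p t‖ + η := by
    filter_upwards [hs.w, ae_all_iff.2 hl, ae_restrict_mem measurableSet_Ioc] with t h1 h2 h3
    have hnear : ∀ᶠ n in atTop, ‖(s.Z n).w t - D.ws t‖ < κ :=
      (tendsto_iff_norm_sub_tendsto_zero.1 h1).eventually (gt_mem_nhds hκ)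
    obtain ⟨a1, a2⟩ := B.limits hk (c := fun n => 5 * s.α n) (r := fun n => (s.Z n).r t)
      (l := fun n => l n t) (by simpa using s.α_tendsto.const_mul 5) h1
      (hs.p t (Ioc_subset_Icc_self h3)) (hnear.mono fun n hn => (h2 n).1 hn)
    refine ⟨a1.congr' ?_, a2⟩
    filter_upwards [hnear] with n hn
    rw [PenSol.cut, indicator_of_mem (by exact hn)]
  refine ⟨y, hy, hint hy hyK, fun t ht => ?_, ?_⟩
  · have ht0 : D.t0 ∈ Icc D.t0 D.t1 := left_mem_Icc.2 D.ht.le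
    have hr : ∀ n, (s.Z n).p t - (s.Z n).p D.t0 = ∫ σ in D.t0..t, (s.Z n).r σ := fun n => by
      have := intervalIntegral.integral_add_adjacent_intervals
        (PenSeq.intervalIntegrable (s.Z n).integrable_r ht0 ht)
        (PenSeq.intervalIntegrable (s.Z n).integrable_r ht (right_mem_Icc.2 D.ht.le))
      rw [PenSol.p, PenSol.p, adj, adj, ← this]
      abel
    have hli : ∀ n, Integrable (fun t => B.B₁ (D.ws t) (l n t)) D.μ := fun n =>
      hint (hlm n).stronglyMeasurable ((hl n).mono fun t ht => ht.2)
    have hci : ∀ n, Integrable ((s.Z n).cut κ) D.μ := fun n => (s.Z n).integrable_cut κ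
    have h1 : Tendsto (fun n => ∫ σ, ‖(s.Z n).cut κ σ - B.B₁ (D.ws σ) (l n σ)‖ ∂D.μ) atTop
        (𝓝 0) := by
      have h := tendsto_integral_of_dominated_convergence (μ := D.μ)
        (F := fun n σ => ‖(s.Z n).cut κ σ - B.B₁ (D.ws σ) (l n σ)‖) (f := fun _ => (0 : ℝ))
        (fun _ => k * (3 + (D.t1 - D.t0)) + 4 * (k + 1) + K₁ * K)
        (fun n => ((hci n).sub (hli n)).aestronglyMeasurable.norm) (integrable_const _)
        (fun n => by
          filter_upwards [ae_norm_cut_le s hk n, hl n] with σ b1 b2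
          rw [norm_norm]
          exact (norm_sub_le _ _).trans (add_le_add b1 (hle b2.2)))
        (hlim.mono fun σ hσ => by simpa using hσ.1.norm)
      simpa using h
    have h2 : Tendsto (fun n => ∫ σ in D.t0..t, B.B₁ (D.ws σ) (l n σ)) atTop
        (𝓝 (p t - p D.t0)) := by
      have h3 : Tendsto (fun n => ((s.Z n).p t - (s.Z n).p D.t0) -
          ∫ σ in D.t0..t, B.B₁ (D.ws σ) (l n σ)) atTop (𝓝 0) := by
        have h4 := s.e_tendsto.add h1
        rw [add_zero] at h4
        refine squeeze_zero_norm (fun n => ?_) h4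
        have e : ((s.Z n).p t - (s.Z n).p D.t0) - ∫ σ in D.t0..t, B.B₁ (D.ws σ) (l n σ) =
            (∫ σ in D.t0..t, ((s.Z n).r σ - (s.Z n).cut κ σ)) +
            ∫ σ in D.t0..t, ((s.Z n).cut κ σ - B.B₁ (D.ws σ) (l n σ)) := by
          rw [hr, intervalIntegral.integral_sub (PenSeq.intervalIntegrable (s.Z n).integrable_r ht0 ht)
            (PenSeq.intervalIntegrable (hci n) ht0 ht),
            intervalIntegral.integral_sub (PenSeq.intervalIntegrable (hci n) ht0 ht)
            (PenSeq.intervalIntegrable (hli n) ht0 ht)]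
          abel
        rw [e]
        refine (norm_add_le _ _).trans (add_le_add ?_ ?_)
        · exact (PenSeq.norm_integral_le ht0 ht ((s.Z n).integrable_r.sub (hci n))).trans
            (s.sub_cut_le n)
        · exact PenSeq.norm_integral_le ht0 ht ((hci n).sub (hli n))
      have h5 := ((hs.p t ht).sub (hs.p _ ht0)).sub h3
      rw [sub_zero] at h5
      exact h5.congr fun n => by abel
    rw [← sub_eq_iff_eq_add']
    refine ext_inner_left ℝ fun dx => ?_
    set h : ℝ → L := (Ioc D.t0 t).indicator fun σ =>
      ContinuousLinearMap.adjoint (B.B₁ (D.ws σ)) dx with hdef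
    have hsub : Ioc D.t0 t ⊆ Ioc D.t0 D.t1 := Ioc_subset_Ioc_right ht.2
    have hh : MemLp h 2 D.μ := by
      refine MemLp.of_bound (C := K₁ * ‖dx‖) ?_ (Eventually.of_forall fun σ => ?_)
      · refine AEStronglyMeasurable.indicator ?_ measurableSet_Ioc
        have hA : StronglyMeasurable fun σ => ContinuousLinearMap.adjoint (B.B₁ (D.ws σ)) :=
          (ContinuousLinearMap.adjoint (𝕜 := ℝ) (E := L) (F := X)).continuous.comp_stronglyMeasurable
            hB₁m
        exact hA.aestronglyMeasurable.apply_continuousLinearMap dx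
      · refine (norm_indicator_le_norm_self _ _).trans ((ContinuousLinearMap.le_opNorm _ _).trans ?_)
        rw [LinearIsometryEquiv.norm_map]
        exact mul_le_mul_of_nonneg_right (hK₁ σ) (norm_nonneg _)
    have hinner : ∀ {l : ℝ → L}, Integrable (fun t => B.B₁ (D.ws t) (l t)) D.μ →
        ∫ σ, ⟪h σ, l σ⟫ ∂D.μ = ⟪dx, ∫ σ in D.t0..t, B.B₁ (D.ws σ) (l σ)⟫ := fun {l} hl => by
      have hl' : IntegrableOn (fun t => B.B₁ (D.ws t) (l t)) (Ioc D.t0 t) :=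
        hl.mono_measure (Measure.restrict_mono hsub le_rfl)
      have e : (fun σ => ⟪h σ, l σ⟫) =
          (Ioc D.t0 t).indicator fun σ => ⟪dx, B.B₁ (D.ws σ) (l σ)⟫ := by
        funext σ
        by_cases hσ : σ ∈ Ioc D.t0 t
        · rw [hdef, indicator_of_mem hσ, indicator_of_mem hσ,
            ContinuousLinearMap.adjoint_inner_left]
        · rw [hdef, indicator_of_notMem hσ, indicator_of_notMem hσ, inner_zero_left]
      rw [e, integral_indicator measurableSet_Ioc, Measure.restrict_restrict measurableSet_Ioc,
        inter_eq_left.2 hsub, intervalIntegral.integral_of_le ht.1, integral_inner hl']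
    rw [← hinner (hint hy hyK)]
    refine (hylim h hh _ ?_).symm
    have h6 := (tendsto_const_nhds (x := dx)).inner h2 (𝕜 := ℝ)
    exact h6.congr fun n => (hinner (hint (hlm n).stronglyMeasurable
      ((hl n).mono fun t ht => ht.2))).symm
  · filter_upwards [hlim, hytail] with t h1 h2
    exact ⟨norm_le_of_mem_closure_convexHull_tails h2 h1.2.2,
      sub_apply_mem_of_mem_closure_convexHull_tails h2 _ _ h1.2.1⟩

end PenSeq.Converges

/-- Maximum principle for the abstract problem. -/
theorem exists_multipliers (D : PenData X Q) (B : D.MultRule L ρ k) (hρ : 0 < ρ) (hk : 0 ≤ k) :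
    ∃ (p : ℝ → X) (l : ℝ → L) (lam : ℝ), 0 ≤ lam ∧ (lam = 0 → ∀ t ∈ Icc D.t0 D.t1, p t ≠ 0) ∧
      (∃ a ∈ limSubdiff D.f (D.ends D.star), ∃ b ∈ limitingNC D.S (D.ends D.star),
        pl2 (p D.t0) (-(p D.t1)) = lam • a + b) ∧
      StronglyMeasurable l ∧ Integrable (fun t => B.B₁ (D.ws t) (l t)) D.μ ∧
      (∀ t ∈ Icc D.t0 D.t1, p t = p D.t0 + ∫ s in D.t0..t, B.B₁ (D.ws s) (l s)) ∧
      (∀ᵐ t ∂D.μ, ‖l t‖ ≤ k * ‖p t‖ ∧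
        ContinuousLinearMap.adjoint D.V (p t) - B.B₂ (D.ws t) (l t) ∈
          closure (convexHull ℝ (B.N (D.ws t)))) ∧
      ∀ᵐ t ∂D.μ, ∀ q, pl2 (pl2fst (D.ws t)) q ∈ D.M →
        ‖q - pl2snd (D.ws t)‖ < D.ϱ t → ⟪p t, D.V (q - pl2snd (D.ws t))⟫ ≤ 0 := by
  have hκ : 0 < min D.ε (D.δ / 2) := lt_min D.hε (half_pos D.hδ)
  obtain ⟨s0⟩ := exists_penSeq B.normalBound hρ hk hκ (min_le_left _ _) (min_le_right _ _)
  obtain ⟨s, ec, ed, lam, p, hs⟩ := PenSeq.exists_converges s0 hk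
  obtain ⟨l, h1, h2, h3, h4⟩ := hs.exists_euler B hρ hk hκ (min_le_left _ _) (min_le_right _ _)
  obtain ⟨a, ha, hed⟩ := hs.exists_ed_eq
  refine ⟨p, l, lam, hs.lam_nonneg, fun h t ht => hs.p_ne_zero hk h ht,
    ⟨a, ha, ec, hs.ec_mem, ?_⟩, h1, h2, h3, h4, hs.ae_weierstrass B.normalBound hρ hk⟩
  rw [← hed, hs.p_left, hs.p_right, neg_neg, add_comm ed ec]
  rfl

end PenData

end Penalised

section Dynamics

variable {nx nu m : ℕ} {t0 t1 : ℝ} {E : Matrix (Fin m) (Fin nx) ℝ}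
  {g : PL2 (Euc nx) (Euc nu) → Euc m}
  {g' : PL2 (Euc nx) (Euc nu) → (PL2 (Euc nx) (Euc nu) →L[ℝ] Euc m)} {U : Set (Euc nu)}
  {S : Set (PL2 (Euc nx) (Euc nx))} {f : PL2 (Euc nx) (Euc nx) → ℝ}
  {ε δ : ℝ} {R : ℝ → ℝ≥0∞} {xs : Arc nx t0 t1} {us : ℝ → Euc nu}

theorem continuous_phi' (hg : ∀ z, HasStrictFDerivAt g (g' z) z) : Continuous (phi' E g') := by
  have h1 : Continuous g' := continuous_of_hasStrictFDerivAt hg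
  exact continuous_const.sub ((h1.comp (xuCLM nx nu).continuous).clm_comp continuous_const)

theorem continuous_adjoint_phi' (hg : ∀ z, HasStrictFDerivAt g (g' z) z) :
    Continuous fun z => ContinuousLinearMap.adjoint (phi' E g' z) :=
  (ContinuousLinearMap.adjoint (𝕜 := ℝ)).continuous.comp (continuous_phi' hg)

theorem IsMultiplier.exists_sub_eq {w ξ : PL3 (Euc nx) (Euc nu) (Euc nx)} {lam : Euc m}
    (h : IsMultiplier E g' U w ξ lam) : ∃ η ∈ limitingNC U (pl2fst (pl2snd w)),
      ξ - ContinuousLinearMap.adjoint (phi' E g' w) lam = pl2 0 (pl2 η 0) := by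
  obtain ⟨η, hη, h⟩ := h
  refine ⟨η, hη, ext_inner_right ℝ fun z => ?_⟩
  rw [inner_sub_left, ContinuousLinearMap.adjoint_inner_left, h, inner_pl2 (pl2 0 _), pl2fst_pl2,
    pl2snd_pl2, inner_pl2 (pl2 η 0), pl2fst_pl2, pl2snd_pl2, inner_zero_left, inner_zero_left]
  ring

theorem mem_Cset {t : ℝ} (ht : t ∈ Icc t0 t1) {w : PL3 (Euc nx) (Euc nu) (Euc nx)}
    (hw : w ∈ Mmap E g U 0) (h1 : ‖pl2fst w - xs.f t‖ ≤ ε)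
    (h2 : ENNReal.ofReal ‖pl2snd w - pl2 (us t) (xs.d t)‖ ≤ R t) :
    ((t, pl2fst w, pl2fst (pl2snd w), pl2snd (pl2snd w)) : ℝ × Euc nx × Euc nu × Euc nx) ∈
      Cset E g U ε R xs us := by
  refine subset_closure ⟨ht, hw.1, ?_, h1, ?_⟩
  · have := hw.2
    rwa [add_zero, sub_eq_zero] at this
  · rw [ofReal_norm] at h2
    exact h2

theorem pl3_mem_of_mem_Cset (hU : IsClosed U) (hg : ∀ z, HasStrictFDerivAt g (g' z) z)
    {q : ℝ × Euc nx × Euc nu × Euc nx} (hq : q ∈ Cset E g U ε R xs us) :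
    pl3 q.2.1 q.2.2.1 q.2.2.2 ∈ Mmap E g U 0 := by
  have hc : Continuous fun q : ℝ × Euc nx × Euc nu × Euc nx => pl3 q.2.1 q.2.2.1 q.2.2.2 :=
    continuous_pl2 (by fun_prop) (continuous_pl2 (by fun_prop) (by fun_prop))
  refine closure_minimal ?_ ((isClosed_Mmap (E := E) hU hg).preimage hc) hq
  rintro q ⟨-, h1, h2, -⟩
  refine ⟨h1, ?_⟩
  show mV E q.2.2.2 - g (pl2 q.2.1 q.2.2.1) + 0 = 0
  rw [h2, sub_self, add_zero]

/-- The projection of `Cset` to the `(x,u,v)` space. -/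
def Kset (E : Matrix (Fin m) (Fin nx) ℝ) (g : PL2 (Euc nx) (Euc nu) → Euc m)
    (U : Set (Euc nu)) (ε : ℝ) (R : ℝ → ℝ≥0∞) (xs : Arc nx t0 t1) (us : ℝ → Euc nu) :
    Set (PL3 (Euc nx) (Euc nu) (Euc nx)) :=
  (fun q : ℝ × Euc nx × Euc nu × Euc nx => pl3 q.2.1 q.2.2.1 q.2.2.2) '' Cset E g U ε R xs us

theorem isCompact_Kset (h : IsCompact (Cset E g U ε R xs us)) :
    IsCompact (Kset E g U ε R xs us) :=
  h.image (continuous_pl2 (by fun_prop) (continuous_pl2 (by fun_prop) (by fun_prop)))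

theorem mem_Kset {t : ℝ} (ht : t ∈ Icc t0 t1) {w : PL3 (Euc nx) (Euc nu) (Euc nx)}
    (hw : w ∈ Mmap E g U 0) (h1 : ‖pl2fst w - xs.f t‖ ≤ ε)
    (h2 : ENNReal.ofReal ‖pl2snd w - pl2 (us t) (xs.d t)‖ ≤ R t) :
    w ∈ Kset E g U ε R xs us :=
  ⟨_, mem_Cset ht hw h1 h2, rfl⟩

theorem continuousOn_arc (ht : t0 ≤ t1) (x : Arc nx t0 t1) : ContinuousOn x.f (Icc t0 t1) := by
  have h := intervalIntegral.continuousOn_primitive_interval' x.intble left_mem_uIcc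
  rw [uIcc_of_le ht] at h
  exact (continuousOn_const.add h).congr x.rel

/-- A bounded measurable representative of the reference process, and of the radius. -/
theorem exists_reference (ht : t0 < t1) (hε : 0 < ε) (hR : Measurable R)
    (hδ : 0 < δ) (hRδ : ∀ᵐ t ∂(volume.restrict (Icc t0 t1)), ENNReal.ofReal δ ≤ R t)
    (hadm : Admissible E g U S xs us) (hC : IsCompact (Cset E g U ε R xs us)) :
    ∃ (b : ℝ) (ws : ℝ → PL3 (Euc nx) (Euc nu) (Euc nx)) (ϱ : ℝ → ℝ), StronglyMeasurable ws ∧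
      (∀ t, ‖ws t‖ ≤ b) ∧ Measurable ϱ ∧ (∀ t, δ ≤ ϱ t) ∧ (∀ t, ϱ t ≤ b) ∧
      ∀ᵐ t ∂(volume.restrict (Ioc t0 t1)), ws t = pl2 (xs.f t) (pl2 (us t) (xs.d t)) ∧
        ws t ∈ Mmap E g U 0 ∧
        ENNReal.ofReal (ϱ t) ≤ R t ∧ ∀ q, pl2 (xs.f t) q ∈ Mmap E g U 0 →
          ENNReal.ofReal ‖q - pl2 (us t) (xs.d t)‖ < R t →
          ‖q - pl2 (us t) (xs.d t)‖ < ϱ t := by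
  obtain ⟨b0, hb0⟩ := (isCompact_Kset hC).isBounded.exists_norm_le
  have hadm2 := hadm.2.1
  rw [← restrict_Ioc_eq_restrict_Icc] at hadm2 hRδ
  set b := max (2 * |b0| + 1) δ with hbdef
  have hb1 : 2 * |b0| + 1 ≤ b := le_max_left _ _
  have hb2 : δ ≤ b := le_max_right _ _
  have hbpos : 0 < b := hδ.trans_le hb2
  have hwm : AEStronglyMeasurable (fun t => pl2 (xs.f t) (pl2 (us t) (xs.d t)))
      (volume.restrict (Ioc t0 t1)) := by
    have h1 : AEStronglyMeasurable xs.f (volume.restrict (Ioc t0 t1)) :=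
      ((continuousOn_arc ht.le xs).mono Ioc_subset_Icc_self).aestronglyMeasurable measurableSet_Ioc
    have h2 : AEStronglyMeasurable xs.d (volume.restrict (Ioc t0 t1)) :=
      ((intervalIntegrable_iff_integrableOn_Ioc_of_le ht.le).1 xs.intble).aestronglyMeasurable
    have h3 := hadm.1.aestronglyMeasurable (μ := volume.restrict (Ioc t0 t1))
    exact continuous_pl2_uncurry.comp_aestronglyMeasurable
      (h1.prodMk (continuous_pl2_uncurry.comp_aestronglyMeasurable (h3.prodMk h2)))
  have hM : ∀ᵐ t ∂(volume.restrict (Ioc t0 t1)),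
      pl2 (xs.f t) (pl2 (us t) (xs.d t)) ∈ Mmap E g U 0 := by
    filter_upwards [hadm2] with t h1
    refine ⟨h1.2, ?_⟩
    show mV E (xs.d t) - g (pl2 (xs.f t) (us t)) + 0 = 0
    rw [h1.1, sub_self, add_zero]
  have hbd : ∀ᵐ t ∂(volume.restrict (Ioc t0 t1)),
      ‖pl2 (xs.f t) (pl2 (us t) (xs.d t))‖ ≤ |b0| := by
    filter_upwards [hM, ae_restrict_mem measurableSet_Ioc] with t h1 h2
    refine (hb0 _ (mem_Kset (Ioc_subset_Icc_self h2) h1 ?_ ?_)).trans (le_abs_self b0)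
    · simpa using hε.le
    · simp
  have hset : MeasurableSet {t | ‖hwm.mk _ t‖ ≤ b} :=
    measurableSet_le hwm.stronglyMeasurable_mk.norm.measurable measurable_const
  refine ⟨b, {t | ‖hwm.mk _ t‖ ≤ b}.indicator (hwm.mk _),
    fun t => max δ (min (R t) (ENNReal.ofReal b)).toReal,
    hwm.stronglyMeasurable_mk.indicator hset, fun t => ?_,
    measurable_const.max (hR.min measurable_const).ennreal_toReal, fun t => le_max_left _ _,
    fun t => max_le hb2 (ENNReal.toReal_le_of_le_ofReal hbpos.le (min_le_right _ _)), ?_⟩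
  · by_cases h : t ∈ {t | ‖hwm.mk _ t‖ ≤ b}
    · rw [indicator_of_mem h]; exact h
    · rw [indicator_of_notMem h, norm_zero]; exact hbpos.le
  · filter_upwards [hM, hbd, hwm.ae_eq_mk, hRδ, ae_restrict_mem measurableSet_Ioc]
      with t h1 h2 h3 h4 h5
    have e1 : {t | ‖hwm.mk _ t‖ ≤ b}.indicator (hwm.mk _) t =
        pl2 (xs.f t) (pl2 (us t) (xs.d t)) := by
      rw [indicator_of_mem, ← h3]
      show ‖hwm.mk _ t‖ ≤ b
      rw [← h3]
      linarith [abs_nonneg b0]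
    have hfin : min (R t) (ENNReal.ofReal b) ≠ ∞ :=
      ne_top_of_le_ne_top ENNReal.ofReal_ne_top (min_le_right _ _)
    have hδm : δ ≤ (min (R t) (ENNReal.ofReal b)).toReal :=
      (ENNReal.ofReal_le_iff_le_toReal hfin).1 (le_min h4 (ENNReal.ofReal_le_ofReal hb2))
    rw [e1]
    refine ⟨rfl, h1, ?_, fun q hq hlt => ?_⟩
    · rw [max_eq_right hδm, ENNReal.ofReal_toReal hfin]
      exact min_le_left _ _
    · rw [max_eq_right hδm]
      refine (ENNReal.ofReal_lt_iff_lt_toReal (norm_nonneg _) hfin).1 (lt_min hlt ?_)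
      rw [ENNReal.ofReal_lt_ofReal_iff hbpos]
      have h6 := (hb0 _ (mem_Kset (xs := xs) (us := us) (R := R) (ε := ε)
        (Ioc_subset_Icc_self h5) hq (by simpa using hε.le)
        (by rw [pl2snd_pl2]; exact hlt.le))).trans (le_abs_self b0)
      have h7 := (norm_pl2snd_le _).trans h6
      have h8 := (norm_pl2snd_le _).trans h2
      rw [pl2snd_pl2] at h7 h8
      linarith [norm_sub_le q (pl2 (us t) (xs.d t))]

end Dynamics

section Reduction

variable {nx nu m : ℕ} {t0 t1 : ℝ} {E : Matrix (Fin m) (Fin nx) ℝ}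
  {g : PL2 (Euc nx) (Euc nu) → Euc m}
  {g' : PL2 (Euc nx) (Euc nu) → (PL2 (Euc nx) (Euc nu) →L[ℝ] Euc m)} {U : Set (Euc nu)}
  {S : Set (PL2 (Euc nx) (Euc nx))} {f : PL2 (Euc nx) (Euc nx) → ℝ}
  {ε δ : ℝ} {R : ℝ → ℝ≥0∞} {xs : Arc nx t0 t1} {us : ℝ → Euc nu}

/-- The arc with initial value `x0` and derivative `d`. -/
def arcOf (ht : t0 ≤ t1) (x0 : Euc nx) (d : ℝ → Euc nx)
    (hd : Integrable d (volume.restrict (Ioc t0 t1))) : Arc nx t0 t1 where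
  f t := x0 + ∫ s in t0..t, d s
  d := d
  intble := (intervalIntegrable_iff_integrableOn_Ioc_of_le ht).2 hd
  rel t _ := by rw [intervalIntegral.integral_same, add_zero]

theorem IsLocalMinOfRadius.le_of_process (hmin : IsLocalMinOfRadius E g f U S ε R xs us)
    (ht : t0 < t1) {ws : ℝ → PL3 (Euc nx) (Euc nu) (Euc nx)} {ϱ : ℝ → ℝ}
    (hwsm : StronglyMeasurable ws) {b : ℝ} (hwsb : ∀ t, ‖ws t‖ ≤ b)
    (hws : ∀ᵐ t ∂(volume.restrict (Ioc t0 t1)), ws t = pl2 (xs.f t) (pl2 (us t) (xs.d t)) ∧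
      ENNReal.ofReal (ϱ t) ≤ R t)
    {x0 : Euc nx} {w : ℝ → PL3 (Euc nx) (Euc nu) (Euc nx)}
    (hw : Integrable w (volume.restrict (Ioc t0 t1)))
    (hwt : ∀ᵐ t ∂(volume.restrict (Ioc t0 t1)), w t ∈ Mmap E g U 0 ∧
      ‖pl2fst (w t) - pl2fst (ws t)‖ ≤ ε ∧ ‖pl2snd (w t) - pl2snd (ws t)‖ ≤ ϱ t ∧
      x0 + ∫ s in t0..t, pl2snd (pl2snd (w s)) = pl2fst (w t))
    (hS : pl2 x0 (x0 + ∫ s in t0..t1, pl2snd (pl2snd (w s))) ∈ S)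
    (hle : (∫ t in Ioc t0 t1, ‖w t - ws t‖) ≤ ε) :
    f (pl2 (xs.f t0) (xs.f t1)) ≤
      f (pl2 x0 (x0 + ∫ s in t0..t1, pl2snd (pl2snd (w s)))) := by
  have hq : Integrable (fun t => pl2snd (w t)) (volume.restrict (Ioc t0 t1)) :=
    (sndCLM (Euc nx) (PL2 (Euc nu) (Euc nx))).integrable_comp hw
  have hd : Integrable (fun t => pl2snd (pl2snd (w t))) (volume.restrict (Ioc t0 t1)) :=
    (sndCLM (Euc nu) (Euc nx)).integrable_comp hq
  have hu : Integrable (fun t => pl2fst (pl2snd (w t))) (volume.restrict (Ioc t0 t1)) :=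
    (fstCLM (Euc nu) (Euc nx)).integrable_comp hq
  set u := hu.aestronglyMeasurable.mk _ with hudef
  have hum : Measurable u := hu.aestronglyMeasurable.stronglyMeasurable_mk.measurable
  have hue : ∀ᵐ t ∂(volume.restrict (Ioc t0 t1)), pl2fst (pl2snd (w t)) = u t :=
    hu.aestronglyMeasurable.ae_eq_mk
  have e0 : (arcOf ht.le x0 _ hd).f t0 = x0 := by
    show x0 + ∫ s in t0..t0, _ = x0
    rw [intervalIntegral.integral_same, add_zero]
  have h := hmin.2 (arcOf ht.le x0 _ hd) u
  rw [e0] at h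
  refine h ⟨hum, ?_, ?_⟩ ?_ ?_
  · rw [← restrict_Ioc_eq_restrict_Icc]
    filter_upwards [hwt, hue] with t h1 h2
    obtain ⟨⟨h3, h4⟩, -, -, h5⟩ := h1
    rw [add_zero, sub_eq_zero, h2, ← h5] at h4
    exact ⟨h4, h2 ▸ h3⟩
  · rw [e0]
    exact hS
  · rw [← restrict_Ioc_eq_restrict_Icc]
    filter_upwards [hwt, hue, hws] with t h1 h2 h3
    obtain ⟨-, h4, h5, h6⟩ := h1
    rw [h3.1, pl2fst_pl2, ← h6] at h4
    rw [h3.1, pl2snd_pl2] at h5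
    refine ⟨h4, ?_⟩
    have h7 : pl2snd (w t) = pl2 (u t) (pl2snd (pl2snd (w t))) := by rw [← h2]; rfl
    rw [h7, pl2_sub] at h5
    refine le_trans ?_ h3.2
    rw [← enorm_eq_nnnorm, ← ofReal_norm]
    exact ENNReal.ofReal_le_ofReal h5
  · refine le_trans ?_ hle
    have hwsi : Integrable ws (volume.restrict (Ioc t0 t1)) :=
      Integrable.of_bound hwsm.aestronglyMeasurable b (Eventually.of_forall hwsb)
    rw [intervalIntegral.integral_of_le ht.le]
    refine integral_mono_of_nonneg (Eventually.of_forall fun t => norm_nonneg _)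
      (hw.sub hwsi).norm ?_
    filter_upwards [hws] with t h1
    show ‖pl2snd (pl2snd (w t)) - xs.d t‖ ≤ ‖w t - ws t‖
    have h2 : pl2snd (pl2snd (w t)) - xs.d t = pl2snd (pl2snd (w t - ws t)) := by
      rw [h1.1]; rfl
    rw [h2]
    exact (norm_pl2snd_le _).trans (norm_pl2snd_le _)

theorem integral_reference {ws : ℝ → PL3 (Euc nx) (Euc nu) (Euc nx)}
    (hws : ∀ᵐ t ∂(volume.restrict (Ioc t0 t1)), ws t = pl2 (xs.f t) (pl2 (us t) (xs.d t)))
    {t : ℝ} (htm : t ∈ Icc t0 t1) :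
    xs.f t0 + ∫ s in t0..t, pl2snd (pl2snd (ws s)) = xs.f t := by
  rw [xs.rel t htm]
  congr 1
  rw [intervalIntegral.integral_of_le htm.1, intervalIntegral.integral_of_le htm.1]
  refine integral_congr_ae (ae_restrict_of_ae_restrict_of_subset (Ioc_subset_Ioc_right htm.2) ?_)
  filter_upwards [hws] with s hs
  rw [hs]; rfl

/-- The problem with `x' = V(u,v) = v` and `(x,u,v) ∈ M_φ(0)`, for given representatives. -/
def penData (ht : t0 < t1) (hU : IsClosed U) (hg : ∀ z, HasStrictFDerivAt g (g' z) z)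
    (hS : IsClosed S) (hf : LocallyLipschitz f) (hε : 0 < ε) (hδ : 0 < δ)
    (hmin : IsLocalMinOfRadius E g f U S ε R xs us) (b : ℝ)
    (ws : ℝ → PL3 (Euc nx) (Euc nu) (Euc nx)) (ϱ : ℝ → ℝ) (hwsm : StronglyMeasurable ws)
    (hwsb : ∀ t, ‖ws t‖ ≤ b) (hϱ : Measurable ϱ) (hδϱ : ∀ t, δ ≤ ϱ t) (hϱb : ∀ t, ϱ t ≤ b)
    (hws : ∀ᵐ t ∂(volume.restrict (Ioc t0 t1)), ws t = pl2 (xs.f t) (pl2 (us t) (xs.d t)) ∧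
      ws t ∈ Mmap E g U 0 ∧ ENNReal.ofReal (ϱ t) ≤ R t) :
    PenData (Euc nx) (PL2 (Euc nu) (Euc nx)) where
  t0 := t0
  t1 := t1
  ht := ht
  V := sndCLM (Euc nu) (Euc nx)
  hV q := norm_pl2snd_le q
  M := Mmap E g U 0
  hM := isClosed_Mmap hU hg
  S := S
  hS := hS
  f := f
  hf := hf
  ε := ε
  hε := hε
  δ := δ
  hδ := hδ
  b := b
  ws := ws
  hws := hwsm
  hwsb := hwsb
  ϱ := ϱ
  hϱ := hϱ
  hδϱ := hδϱ
  hϱb := hϱb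
  xs0 := xs.f t0
  hwsM := hws.mono fun _ h => h.2.1
  hrel := by
    filter_upwards [hws, ae_restrict_mem measurableSet_Ioc] with t h1 h2
    rw [h1.1]
    exact integral_reference (hws.mono fun _ h => h.1) (Ioc_subset_Icc_self h2)
  hS0 := by
    have := integral_reference (hws.mono fun _ h => h.1) (right_mem_Icc.2 ht.le)
    simp only [sndCLM_apply]
    rw [this]
    exact hmin.1.2.2
  hmin := by
    intro x0 w hw h1 h2 h3
    have := integral_reference (hws.mono fun _ h => h.1) (right_mem_Icc.2 ht.le)
    simp only [sndCLM_apply] at h1 h2 ⊢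
    rw [this]
    exact hmin.le_of_process ht hwsm hwsb (hws.mono fun _ h => ⟨h.1, h.2.2⟩) hw h1 h2 h3

/-- The normals `{ν = (η, 0) : η ∈ N_U(u)}`. -/
def controlNormals (U : Set (Euc nu)) (z : PL3 (Euc nx) (Euc nu) (Euc nx)) :
    Set (PL2 (Euc nu) (Euc nx)) :=
  {ν | pl2fst ν ∈ limitingNC U (pl2fst (pl2snd z)) ∧ pl2snd ν = 0}

theorem controlNormals_closed_graph {z : ℕ → PL3 (Euc nx) (Euc nu) (Euc nx)}
    {ν : ℕ → PL2 (Euc nu) (Euc nx)} {z0 : PL3 (Euc nx) (Euc nu) (Euc nx)}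
    {ν0 : PL2 (Euc nu) (Euc nx)} (hz : Tendsto z atTop (𝓝 z0)) (hν : Tendsto ν atTop (𝓝 ν0))
    (h : ∀ n, ν n ∈ controlNormals U (z n)) : ν0 ∈ controlNormals U z0 := by
  refine ⟨limitingNC_closed_graph (fun n => (h n).1)
    (((continuous_pl2fst.comp continuous_pl2snd).tendsto z0).comp hz)
    ((continuous_pl2fst.tendsto ν0).comp hν), ?_⟩
  have h1 := (continuous_pl2snd.tendsto ν0).comp hν
  have h2 : pl2snd ∘ ν = fun _ => (0 : Euc nx) := funext fun n => (h n).2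
  rw [h2] at h1
  exact tendsto_nhds_unique h1 tendsto_const_nhds

theorem mem_of_mem_closure_convexHull_controlNormals {z : PL3 (Euc nx) (Euc nu) (Euc nx)}
    {ν : PL2 (Euc nu) (Euc nx)} (h : ν ∈ closure (convexHull ℝ (controlNormals U z))) :
    pl2fst ν ∈ clarkeNC U (pl2fst (pl2snd z)) ∧ pl2snd ν = 0 := by
  have h1 : convexHull ℝ (controlNormals U z) ⊆
      fstCLM (Euc nu) (Euc nx) ⁻¹' convexHull ℝ (limitingNC U (pl2fst (pl2snd z))) ∩
        sndCLM (Euc nu) (Euc nx) ⁻¹' {0} :=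
    convexHull_min (fun ν hν => ⟨subset_convexHull ℝ _ hν.1, hν.2⟩)
      (((convex_convexHull ℝ _).is_linear_preimage (fstCLM _ _).toLinearMap.isLinear).inter
        ((convex_singleton 0).is_linear_preimage (sndCLM _ _).toLinearMap.isLinear))
  constructor
  · exact map_mem_closure (fstCLM (Euc nu) (Euc nx)).continuous h fun ν hν => (h1 hν).1
  · exact closure_minimal (fun ν hν => (h1 hν).2)
      (isClosed_singleton.preimage (sndCLM (Euc nu) (Euc nx)).continuous) h

end Reduction

section Conclusion

variable {nx nu m : ℕ} {t0 t1 : ℝ} {E : Matrix (Fin m) (Fin nx) ℝ}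
  {g : PL2 (Euc nx) (Euc nu) → Euc m}
  {g' : PL2 (Euc nx) (Euc nu) → (PL2 (Euc nx) (Euc nu) →L[ℝ] Euc m)} {U : Set (Euc nu)}
  {S : Set (PL2 (Euc nx) (Euc nx))} {f : PL2 (Euc nx) (Euc nx) → ℝ}
  {ε δ : ℝ} {R : ℝ → ℝ≥0∞} {xs : Arc nx t0 t1} {us : ℝ → Euc nu}

/-- The multiplier rule for normals of `M_φ(0)`, uniformly near the compact set `Kset`. -/
theorem exists_multiplier_bound (hU : IsClosed U) (hg : ∀ z, HasStrictFDerivAt g (g' z) z)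
    (hC : IsCompact (Cset E g U ε R xs us))
    (hCQ : ∀ q ∈ Cset E g U ε R xs us, WBCQ E g' U q.2.1 q.2.2.1 q.2.2.2 ∧
      Calm (Mmap E g U) 0 (pl3 q.2.1 q.2.2.1 q.2.2.2)) :
    ∃ ρ > 0, ∃ k ≥ 0, ∀ w ∈ Kset E g U ε R xs us, ∀ z ∈ Mmap E g U 0, ‖z - w‖ < ρ →
      ∀ ξ ∈ frechetNC (Mmap E g U 0) z, ‖pl2fst ξ‖ ≤ k * ‖pl2snd ξ‖ ∧
        ∃ l, ‖l‖ ≤ k * ‖pl2snd ξ‖ ∧ IsMultiplier E g' U z ξ l := by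
  refine exists_normal_bound_of_isCompact hU hg (isCompact_Kset hC) ?_ ?_
  · rintro _ ⟨q, hq, rfl⟩
    exact pl3_mem_of_mem_Cset hU hg hq
  · rintro _ ⟨q, hq, rfl⟩
    exact hCQ q hq

/-- The data of the multiplier rule for `M_φ(0)`. -/
def multRule (D : PenData (Euc nx) (PL2 (Euc nu) (Euc nx)))
    (hg : ∀ z, HasStrictFDerivAt g (g' z) z) (hM : D.M = Mmap E g U 0) {ρ k : ℝ}
    (h : ∀ᵐ t ∂D.μ, ∀ w ∈ D.M, ‖pl2fst w - pl2fst (D.ws t)‖ ≤ D.ε →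
      ‖pl2snd w - pl2snd (D.ws t)‖ ≤ D.ϱ t → w ∈ Kset E g U ε R xs us)
    (hK : ∀ w ∈ Kset E g U ε R xs us, ∀ z ∈ Mmap E g U 0, ‖z - w‖ < ρ →
      ∀ ξ ∈ frechetNC (Mmap E g U 0) z, ‖pl2fst ξ‖ ≤ k * ‖pl2snd ξ‖ ∧
        ∃ l, ‖l‖ ≤ k * ‖pl2snd ξ‖ ∧ IsMultiplier E g' U z ξ l) :
    D.MultRule (Euc m) ρ k where
  B₁ z := (fstCLM _ _).comp (ContinuousLinearMap.adjoint (phi' E g' z))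
  B₂ z := (sndCLM _ _).comp (ContinuousLinearMap.adjoint (phi' E g' z))
  continuous_B₁ := continuous_const.clm_comp (continuous_adjoint_phi' hg)
  continuous_B₂ := continuous_const.clm_comp (continuous_adjoint_phi' hg)
  N := controlNormals U
  closed_graph _ _ _ _ hz hν hn := controlNormals_closed_graph hz hν hn
  rule := by
    filter_upwards [h] with t ht w hw h1 h2 z hz h3 ξ hξ
    rw [hM] at hz hξ
    obtain ⟨h4, l, h5, h6⟩ := hK w (ht w hw h1 h2) z hz h3 ξ hξ
    obtain ⟨η, hη, h7⟩ := h6.exists_sub_eq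
    refine ⟨h4, l, h5, ?_, ?_, ?_⟩
    · exact sub_eq_zero.1 (congrArg pl2fst h7)
    · have h8 : pl2fst (pl2snd ξ - pl2snd (ContinuousLinearMap.adjoint (phi' E g' z) l)) = η :=
        congrArg (fun ζ => pl2fst (pl2snd ζ)) h7
      exact h8 ▸ hη
    · exact congrArg (fun ζ => pl2snd (pl2snd ζ)) h7

theorem adjoint_phi'_snd_snd (z : PL3 (Euc nx) (Euc nu) (Euc nx)) (l : Euc m) :
    pl2snd (pl2snd (ContinuousLinearMap.adjoint (phi' E g' z) l)) = mV E.transpose l := by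
  refine ext_inner_right ℝ fun v => ?_
  have h := ContinuousLinearMap.adjoint_inner_left (phi' E g' z) (pl2 0 (pl2 0 v)) l
  have h0 : (pl2 0 0 : PL2 (Euc nx) (Euc nu)) = 0 := rfl
  rw [phi'_apply, inner_pl2 _ (pl2 0 (pl2 0 v)), pl2snd_pl2, inner_pl2 _ (pl2 0 v)] at h
  simp only [pl2fst_pl2, pl2snd_pl2, inner_zero_right, zero_add, h0, map_zero, sub_zero] at h
  rw [h, inner_mV]

theorem inner_adjoint_phi' (z : PL3 (Euc nx) (Euc nu) (Euc nx)) (l : Euc m)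
    (w : PL2 (Euc nx) (Euc nu)) :
    ⟪pl2 (-pl2fst (ContinuousLinearMap.adjoint (phi' E g' z) l))
      (-pl2fst (pl2snd (ContinuousLinearMap.adjoint (phi' E g' z) l))), w⟫ =
      ⟪l, g' (pl2 (pl2fst z) (pl2fst (pl2snd z))) w⟫ := by
  have h := ContinuousLinearMap.adjoint_inner_left (phi' E g' z)
    (pl2 (pl2fst w) (pl2 (pl2snd w) 0)) l
  have h0 : mV E 0 = 0 := (mVL E).map_zero
  rw [phi'_apply, inner_pl2 _ (pl2 (pl2fst w) _), pl2snd_pl2, inner_pl2 _ (pl2 (pl2snd w) 0)] at h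
  simp only [pl2fst_pl2, pl2snd_pl2, inner_zero_right, add_zero, h0, zero_sub, inner_neg_right,
    pl2_eta] at h
  rw [inner_pl2, pl2fst_pl2, pl2snd_pl2, inner_neg_left, inner_neg_left, ← neg_add, h, neg_neg]

/-- The necessary conditions with a multiplier `lam ≥ 0` that is not normalised. -/
theorem exists_unscaled_multipliers (ht : t0 < t1) (hU : IsClosed U)
    (hg : ∀ z, HasStrictFDerivAt g (g' z) z) (hS : IsClosed S) (hf : LocallyLipschitz f)
    (hε : 0 < ε) (hR : Measurable R) (hδ : 0 < δ)
    (hRδ : ∀ᵐ t ∂(volume.restrict (Icc t0 t1)), ENNReal.ofReal δ ≤ R t)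
    (hmin : IsLocalMinOfRadius E g f U S ε R xs us) (hC : IsCompact (Cset E g U ε R xs us))
    (hCQ : ∀ q ∈ Cset E g U ε R xs us, WBCQ E g' U q.2.1 q.2.2.1 q.2.2.2 ∧
      Calm (Mmap E g U) 0 (pl3 q.2.1 q.2.2.1 q.2.2.2)) :
    ∃ (p : Arc nx t0 t1) (lam k : ℝ) (l : ℝ → Euc m) (μf : ℝ → Euc nu), 0 ≤ lam ∧ 0 ≤ k ∧
      Measurable l ∧ Measurable μf ∧ (lam = 0 → ∀ t ∈ Icc t0 t1, p.f t ≠ 0) ∧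
      (∃ a ∈ limSubdiff f (pl2 (xs.f t0) (xs.f t1)),
        ∃ b ∈ limitingNC S (pl2 (xs.f t0) (xs.f t1)),
        pl2 (p.f t0) (-(p.f t1)) = lam • a + b) ∧
      (∀ᵐ t ∂(volume.restrict (Icc t0 t1)),
        μf t ∈ clarkeNC U (us t) ∧
        (∀ w : PL2 (Euc nx) (Euc nu),
          ⟪pl2 (-(p.d t)) (μf t), w⟫ = ⟪l t, g' (pl2 (xs.f t) (us t)) w⟫) ∧
        p.f t = mV E.transpose (l t) ∧ ‖l t‖ ≤ k * ‖p.f t‖) ∧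
      ∀ᵐ t ∂(volume.restrict (Icc t0 t1)), ∀ u ∈ U, ∀ v : Euc nx,
        mV E v = g (pl2 (xs.f t) u) →
        (‖pl2 (u - us t) (v - xs.d t)‖₊ : ℝ≥0∞) < R t →
        ⟪p.f t, v - xs.d t⟫ ≤ 0 := by
  obtain ⟨b, ws, ϱ, hwsm, hwsb, hϱ, hδϱ, hϱb, hws⟩ :=
    exists_reference ht hε hR hδ hRδ hmin.1 hC
  have hws3 := hws.mono fun _ h => (⟨h.1, h.2.1, h.2.2.1⟩ : _ ∧ _ ∧ _)
  obtain ⟨ρ, hρ, k, hk, hK⟩ := exists_multiplier_bound hU hg hC hCQ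
  set D := penData ht hU hg hS hf hε hδ hmin b ws ϱ hwsm hwsb hϱ hδϱ hϱb hws3 with hD
  have hmemK : ∀ᵐ t ∂D.μ, ∀ w ∈ D.M, ‖pl2fst w - pl2fst (D.ws t)‖ ≤ D.ε →
      ‖pl2snd w - pl2snd (D.ws t)‖ ≤ D.ϱ t → w ∈ Kset E g U ε R xs us := by
    show ∀ᵐ t ∂(volume.restrict (Ioc t0 t1)), ∀ w ∈ Mmap E g U 0,
      ‖pl2fst w - pl2fst (ws t)‖ ≤ ε → ‖pl2snd w - pl2snd (ws t)‖ ≤ ϱ t →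
      w ∈ Kset E g U ε R xs us
    filter_upwards [hws3, ae_restrict_mem measurableSet_Ioc] with t h1 h2 w hw h3 h4
    rw [h1.1] at h3 h4
    exact mem_Kset (Ioc_subset_Icc_self h2) hw h3
      ((ENNReal.ofReal_le_ofReal h4).trans h1.2.2)
  obtain ⟨p, l, lam, hlam, hnt, ⟨a, ha, c, hc, htr⟩, hl, hint, hp, hE, hW⟩ :=
    D.exists_multipliers (multRule D hg rfl hmemK hK) hρ hk
  have hends : D.ends D.star = pl2 (xs.f t0) (xs.f t1) :=
    congrArg (pl2 (xs.f t0)) (integral_reference (hws3.mono fun _ h => h.1)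
      (right_mem_Icc.2 ht.le))
  rw [hends] at ha hc
  set A : ℝ → PL3 (Euc nx) (Euc nu) (Euc nx) :=
    fun t => ContinuousLinearMap.adjoint (phi' E g' (ws t)) (l t) with hA
  have hAm : StronglyMeasurable A :=
    isBoundedBilinearMap_apply.continuous.comp_stronglyMeasurable
      (((continuous_adjoint_phi' hg).comp_stronglyMeasurable hwsm).prodMk hl)
  have hp' : ∀ t ∈ Icc t0 t1, p t = p t0 + ∫ s in t0..t, pl2fst (A s) := hp
  have hint' : Integrable (fun t => pl2fst (A t)) (volume.restrict (Ioc t0 t1)) := hint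
  have hE' : ∀ᵐ t ∂(volume.restrict (Ioc t0 t1)), ‖l t‖ ≤ k * ‖p t‖ ∧
      ContinuousLinearMap.adjoint (sndCLM (Euc nu) (Euc nx)) (p t) - pl2snd (A t) ∈
        closure (convexHull ℝ (controlNormals U (ws t))) := hE
  have hW' : ∀ᵐ t ∂(volume.restrict (Ioc t0 t1)), ∀ q, pl2 (pl2fst (ws t)) q ∈ Mmap E g U 0 →
      ‖q - pl2snd (ws t)‖ < ϱ t → ⟪p t, pl2snd (q - pl2snd (ws t))⟫ ≤ 0 := hW
  have hadj : ∀ v : Euc nx, ContinuousLinearMap.adjoint (sndCLM (Euc nu) (Euc nx)) v = pl2 0 v := by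
    intro v
    refine ext_inner_right ℝ fun z => ?_
    rw [ContinuousLinearMap.adjoint_inner_left, inner_pl2, pl2fst_pl2, pl2snd_pl2,
      inner_zero_left, zero_add, sndCLM_apply]
  refine ⟨⟨p, fun t => pl2fst (A t), (intervalIntegrable_iff_integrableOn_Ioc_of_le ht.le).2 hint',
    hp'⟩, lam, k, l, fun t => -pl2fst (pl2snd (A t)), hlam, hk, hl.measurable, ?_, hnt,
    ⟨a, ha, c, hc, htr⟩, ?_, ?_⟩
  · exact ((continuous_pl2fst.comp continuous_pl2snd).neg.comp_stronglyMeasurable hAm).measurable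
  · rw [← restrict_Ioc_eq_restrict_Icc]
    filter_upwards [hE', hws3] with t h1 h2
    rw [hadj] at h1
    obtain ⟨h3, h4⟩ := mem_of_mem_closure_convexHull_controlNormals h1.2
    have e1 := inner_adjoint_phi' (E := E) (g' := g') (ws t) (l t)
    rw [pl2snd_sub, pl2snd_pl2, adjoint_phi'_snd_snd, sub_eq_zero] at h4
    rw [pl2fst_sub, pl2fst_pl2, zero_sub] at h3
    have e2 : pl2fst (ws t) = xs.f t := by rw [h2.1, pl2fst_pl2]
    have e3 : pl2fst (pl2snd (ws t)) = us t := by rw [h2.1, pl2snd_pl2, pl2fst_pl2]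
    rw [e3] at h3 e1
    rw [e2] at e1
    exact ⟨h3, e1, h4, h1.1⟩
  · rw [← restrict_Ioc_eq_restrict_Icc]
    filter_upwards [hW', hws] with t h1 h2 u hu v hv hlt
    obtain ⟨h3, -, -, h4⟩ := h2
    have hm : pl2 (xs.f t) (pl2 u v) ∈ Mmap E g U 0 := by
      refine ⟨hu, ?_⟩
      show mV E v - g (pl2 (xs.f t) u) + 0 = 0
      rw [hv, sub_self, add_zero]
    have h5 := h1 (pl2 u v)
    rw [h3] at h5
    refine h5 hm (h4 _ hm ?_)
    rw [pl2_sub, ofReal_norm]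
    exact hlt

end Conclusion

/-- The arc `c • x`. -/
def scaleArc {n : ℕ} {t0 t1 : ℝ} (c : ℝ) (x : Arc n t0 t1) : Arc n t0 t1 where
  f t := c • x.f t
  d t := c • x.d t
  intble := x.intble.smul c
  rel t ht := by
    rw [intervalIntegral.integral_smul, ← smul_add, ← x.rel t ht]

theorem mV_smul {nx m : ℕ} (E : Matrix (Fin m) (Fin nx) ℝ) (c : ℝ) (x : Euc nx) :
    mV E (c • x) = c • mV E x :=
  (mVL E).map_smul c x

/-- Necessary optimality conditions for (P'_DAE) when `E` is not of
full row rank, under WBCQ plus calmness of `M_φ` on `C_φ^{ε,R}`: nontriviality,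
transversality, the Weierstrass condition and the explicit Euler adjoint equations
`ṗ(t) = −∇ₓgᵀλ_φ(t)`, `μ(t) = ∇ᵤgᵀλ_φ(t)`, `p(t) = Eᵀλ_φ(t)`, with the multiplier
estimate `|λ_φ(t)| ≤ k|p(t)|` when `N^C_U(u_*(t)) = {0}`; in the free end point case
`λ₀` can be taken as `1`. -/
theorem necessary_optimality_PDAE_notfullrank
    {nx nu m : ℕ} {t0 t1 : ℝ} (ht : t0 < t1)
    (E : Matrix (Fin m) (Fin nx) ℝ) (hrank : E.rank ≠ m)
    (g : PL2 (Euc nx) (Euc nu) → Euc m)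
    (g' : PL2 (Euc nx) (Euc nu) → (PL2 (Euc nx) (Euc nu) →L[ℝ] Euc m))
    (hg : ∀ z, HasStrictFDerivAt g (g' z) z)
    (f : PL2 (Euc nx) (Euc nx) → ℝ) (hf : LocallyLipschitz f)
    (Uset : Set (Euc nu)) (S : Set (PL2 (Euc nx) (Euc nx)))
    (hU : IsClosed Uset) (hS : IsClosed S)
    (ε : ℝ) (hε : 0 < ε) (R : ℝ → ℝ≥0∞) (hR : Measurable R)
    (xs : Arc nx t0 t1) (us : ℝ → Euc nu)
    (hmin : IsLocalMinOfRadius E g f Uset S ε R xs us)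
    (δ : ℝ) (hδ : 0 < δ)
    (hRδ : ∀ᵐ t ∂(volume.restrict (Set.Icc t0 t1)), ENNReal.ofReal δ ≤ R t)
    (hCcpt : IsCompact (Cset E g Uset ε R xs us))
    -- WBCQ + calmness of M_φ on C_φ^{ε,R}
    (hCQ : ∀ q ∈ Cset E g Uset ε R xs us,
      WBCQ E g' Uset q.2.1 q.2.2.1 q.2.2.2 ∧
      Calm (Mmap E g Uset) 0 (pl3 q.2.1 q.2.2.1 q.2.2.2)) :
    ∃ (p : Arc nx t0 t1) (lam0 : ℝ) (lamf : ℝ → Euc m) (μf : ℝ → Euc nu),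
      lam0 ∈ ({0, 1} : Set ℝ) ∧ Measurable lamf ∧ Measurable μf ∧
      -- nontriviality
      (∀ t ∈ Set.Icc t0 t1, (lam0, p.f t) ≠ 0) ∧
      -- transversality
      (∃ a ∈ limSubdiff f (pl2 (xs.f t0) (xs.f t1)),
        ∃ b ∈ limitingNC S (pl2 (xs.f t0) (xs.f t1)),
        pl2 (p.f t0) (-(p.f t1)) = lam0 • a + b) ∧
      -- Euler adjoint equations:
      -- ṗ(t) = −∇ₓgᵀλ_φ(t), μ(t) = ∇ᵤgᵀλ_φ(t), p(t) = Eᵀλ_φ(t)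
      (∀ᵐ t ∂(volume.restrict (Set.Icc t0 t1)),
        μf t ∈ clarkeNC Uset (us t) ∧
        (∀ w : PL2 (Euc nx) (Euc nu),
          ⟪pl2 (-(p.d t)) (μf t), w⟫ = ⟪lamf t, g' (pl2 (xs.f t) (us t)) w⟫) ∧
        p.f t = mV E.transpose (lamf t)) ∧
      -- Weierstrass condition of radius R(·)
      (∀ᵐ t ∂(volume.restrict (Set.Icc t0 t1)), ∀ u ∈ Uset, ∀ v : Euc nx,
        mV E v = g (pl2 (xs.f t) u) →
        (‖pl2 (u - us t) (v - xs.d t)‖₊ : ℝ≥0∞) < R t →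
        ⟪p.f t, v - xs.d t⟫ ≤ 0) ∧
      -- multiplier estimate when N^C_U(u_*(t)) = {0}
      ((∀ᵐ t ∂(volume.restrict (Set.Icc t0 t1)), clarkeNC Uset (us t) = {0}) →
        ∃ k : ℝ, 0 < k ∧
          ∀ᵐ t ∂(volume.restrict (Set.Icc t0 t1)), ‖lamf t‖ ≤ k * ‖p.f t‖) ∧
      -- free end point
      (S = Set.univ → lam0 = 1) := by
  obtain ⟨p, lam, k, l, μf, hlam, hk, hl, hμ, hnt, ⟨a, ha, c, hc, htr⟩, hE, hW⟩ :=
    exists_unscaled_multipliers ht hU hg hS hf hε hR hδ hRδ hmin hCcpt hCQ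
  rcases hlam.eq_or_lt with h0 | h0
  · refine ⟨p, 0, l, μf, by simp, hl, hμ, fun t htm h => hnt h0.symm t htm (congrArg Prod.snd h),
      ⟨a, ha, c, hc, by rw [htr, ← h0]⟩, hE.mono fun t h => ⟨h.1, h.2.1, h.2.2.1⟩, hW,
      fun _ => ⟨k + 1, by positivity, hE.mono fun t h => h.2.2.2.trans ?_⟩, fun hSu => ?_⟩
    · nlinarith [norm_nonneg (p.f t)]
    · subst hSu
      rw [limitingNC_univ hc, ← h0, zero_smul, zero_add] at htr
      exact absurd (congrArg pl2fst htr) (hnt h0.symm t0 (left_mem_Icc.2 ht.le))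
  · have hi : 0 < lam⁻¹ := inv_pos.2 h0
    refine ⟨scaleArc lam⁻¹ p, 1, fun t => lam⁻¹ • l t, fun t => lam⁻¹ • μf t, by simp,
      hl.const_smul lam⁻¹, hμ.const_smul lam⁻¹, fun t _ h => one_ne_zero (congrArg Prod.fst h),
      ⟨a, ha, lam⁻¹ • c, limitingNC_smul hc hi, ?_⟩, hE.mono fun t h => ⟨?_, fun w => ?_, ?_⟩, ?_,
      fun _ => ⟨k + 1, by positivity, hE.mono fun t h => ?_⟩, fun _ => rfl⟩
    · have h1 : pl2 ((scaleArc lam⁻¹ p).f t0) (-((scaleArc lam⁻¹ p).f t1)) =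
          lam⁻¹ • pl2 (p.f t0) (-(p.f t1)) := congrArg (pl2 _) (smul_neg _ _).symm
      rw [h1, htr, smul_add, smul_smul, inv_mul_cancel₀ h0.ne']
    · exact clarkeNC_smul h.1 hi
    · have h1 : pl2 (-((scaleArc lam⁻¹ p).d t)) (lam⁻¹ • μf t) =
          lam⁻¹ • pl2 (-(p.d t)) (μf t) :=
        congrArg (fun y => pl2 y (lam⁻¹ • μf t)) (smul_neg _ _).symm
      rw [h1, real_inner_smul_left, real_inner_smul_left, h.2.1]
    · show lam⁻¹ • p.f t = mV E.transpose (lam⁻¹ • l t)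
      rw [mV_smul, h.2.2.1]
    · filter_upwards [hW] with t h u hu v hv hlt
      show ⟪lam⁻¹ • p.f t, v - xs.d t⟫ ≤ 0
      rw [real_inner_smul_left]
      exact mul_nonpos_of_nonneg_of_nonpos hi.le (h u hu v hv hlt)
    · show ‖lam⁻¹ • l t‖ ≤ (k + 1) * ‖lam⁻¹ • p.f t‖
      rw [norm_smul, norm_smul, mul_left_comm]
      refine mul_le_mul_of_nonneg_left (h.2.2.2.trans ?_) (norm_nonneg _)
      nlinarith [norm_nonneg (p.f t)]

end ProblemPDAE

end
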